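/- Let G be a finite 3-connected simple graph with |V(G)| ≥ 7 that is not isomorphic to the complete bipartite graph K_{3,4}. Then G has a 4-contractible set, i.e. a set W ⊆ V(G) with |W| = 4 such that G[W] is connected and G − W is 2-connected. -/

import Mathlib

open SimpleGraph

/-- A graph is `n`-connected if it has more than `n` vertices and remains connected
after deletion of any set of fewer than `n` vertices. -/
def NConnected {V : Type*} (G : SimpleGraph V) (n : ℕ) : Prop :=
  n < Nat.card V ∧ ∀ S : Set V, S.ncard < n → (G.induce (Sᶜ : Set V)).Connected

/-- `W` is a contractible set of `G` if `G[W]` is connected and `G − W` is `2`-connected. -/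
def ContractibleSet {V : Type*} (G : SimpleGraph V) (W : Set V) : Prop :=
  (G.induce W).Connected ∧ NConnected (G.induce (Wᶜ : Set V)) 2

namespace FourContractible
open Classical
variable {V : Type*} {G : SimpleGraph V}

/-- `S` is nonempty and induces a connected subgraph. -/
def Cn (G : SimpleGraph V) (S : Finset V) : Prop :=
  S.Nonempty ∧ ∀ J ⊆ S, J.Nonempty → (∀ x ∈ J, ∀ y ∈ S, G.Adj x y → y ∈ J) → ∀ y ∈ S, y ∈ J

/-- `S` induces a `2`-connected subgraph. -/
def TC (G : SimpleGraph V) (S : Finset V) : Prop :=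
  3 ≤ S.card ∧ ∀ J ⊆ S, J.Nonempty → ∀ x, x ∉ J →
    (∀ j ∈ J, ∀ y ∈ S, G.Adj j y → y ∈ J ∨ y = x) → ∀ y ∈ S, y ∈ J ∨ y = x

/-- `C` has two distinct neighbours in `R`. -/
def TwoNb (G : SimpleGraph V) (R C : Finset V) : Prop :=
  ∃ s ∈ R, ∃ t ∈ R, s ≠ t ∧ (∃ x ∈ C, G.Adj x s) ∧ ∃ x ∈ C, G.Adj x t

lemma Cn.singleton (x : V) : Cn G {x} := by
  refine ⟨⟨x, by simp⟩, fun J hJ hne _ y hy => ?_⟩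
  obtain ⟨z, hz⟩ := hne
  have := hJ hz
  simp at this hy; subst this; subst hy; exact hz

lemma Cn.union_adj {C D : Finset V} (hC : Cn G C) (hD : Cn G D) {x y : V} (hx : x ∈ C)
    (hy : y ∈ D) (h : x = y ∨ G.Adj x y) : Cn G (C ∪ D) := by
  refine ⟨hC.1.mono Finset.subset_union_left, fun J hJ hne hcl => ?_⟩
  have key : ∀ E : Finset V, Cn G E → E ⊆ C ∪ D → (∃ z ∈ J, z ∈ E) → E ⊆ J := by
    intro E hE hEs ⟨z, hz, hzE⟩ e he
    have := hE.2 (J ∩ E) Finset.inter_subset_right ⟨z, by simp [hz, hzE]⟩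
      (fun a ha b hb hab => by
        simp at ha ⊢; exact ⟨hcl a ha.1 b (hEs hb) hab, hb⟩) e he
    simp at this; exact this.1
  have h1 := key C hC Finset.subset_union_left
  have h2 := key D hD Finset.subset_union_right
  obtain ⟨z, hz⟩ := hne
  have hz' := hJ hz
  intro w hw
  have hxy : x ∈ J ↔ y ∈ J := by
    rcases h with h | h
    · rw [h]
    · exact ⟨fun hx' => hcl x hx' y (by simp [hy]) h, fun hy' => hcl y hy' x (by simp [hx]) h.symm⟩
  have : x ∈ J := by
    rcases Finset.mem_union.1 hz' with h' | h'
    · exact h1 ⟨z, hz, h'⟩ hx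
    · exact hxy.2 (h2 ⟨z, hz, h'⟩ hy)
  rcases Finset.mem_union.1 hw with h' | h'
  · exact h1 ⟨x, this, hx⟩ h'
  · exact h2 ⟨y, hxy.1 this, hy⟩ h'

lemma Cn.insert_adj {C : Finset V} (hC : Cn G C) {x y : V} (hx : x ∈ C) (h : G.Adj x y) :
    Cn G (insert y C) := by
  have := hC.union_adj (Cn.singleton y) hx (by simp) (Or.inr h)
  rwa [Finset.union_comm, ← Finset.insert_eq] at this

lemma Cn.pair {x y : V} (h : G.Adj x y) : Cn G {x, y} :=
  (Cn.singleton y).insert_adj (by simp) h.symm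

/-- A proper nonempty subset of a connected set has an edge leaving it. -/
lemma Cn.exists_adj {S J : Finset V} (hS : Cn G S) (hJ : J ⊆ S) (hne : J.Nonempty)
    (hlt : ∃ y ∈ S, y ∉ J) : ∃ x ∈ J, ∃ y ∈ S, y ∉ J ∧ G.Adj x y := by
  by_contra hcon
  push Not at hcon
  obtain ⟨y, hy, hyJ⟩ := hlt
  exact hyJ (hS.2 J hJ hne (fun x hx y hy h => by_contra fun h' => hcon x hx y hy h' h) y hy)

lemma Cn.exists_nbr {S : Finset V} (hS : Cn G S) {x : V} (hx : x ∈ S) (h2 : 2 ≤ S.card) :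
    ∃ y ∈ S, G.Adj x y := by
  obtain ⟨z, hz, hzx⟩ := Finset.exists_mem_ne (by omega : 1 < S.card) x
  obtain ⟨a, ha, y, hy, -, h⟩ := hS.exists_adj (J := {x}) (by simpa using hx) ⟨x, by simp⟩
    ⟨z, hz, by simpa using hzx⟩
  simp at ha; subst ha; exact ⟨y, hy, h⟩

/-- A connected subset can be enlarged inside a connected set to any intermediate size. -/
lemma Cn.exists_superset {S C : Finset V} (hS : Cn G S) (hC : Cn G C) (hCS : C ⊆ S) {k : ℕ}
    (h1 : C.card ≤ k) (h2 : k ≤ S.card) : ∃ D, C ⊆ D ∧ D ⊆ S ∧ Cn G D ∧ D.card = k := by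
  induction k, h1 using Nat.le_induction with
  | base => exact ⟨C, le_rfl, hCS, hC, rfl⟩
  | succ k hk ih =>
    obtain ⟨D, hCD, hDS, hD, rfl⟩ := ih (by omega)
    have : ∃ y ∈ S, y ∉ D := by
      by_contra hcon
      push Not at hcon
      have := Finset.card_le_card (show S ⊆ D from hcon)
      omega
    obtain ⟨x, hx, y, hy, hyD, h⟩ := hS.exists_adj hDS hD.1 this
    exact ⟨insert y D, hCD.trans (Finset.subset_insert _ _),
      Finset.insert_subset hy hDS, hD.insert_adj hx h, Finset.card_insert_of_notMem hyD⟩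

lemma Cn.exists_subset {S : Finset V} (hS : Cn G S) {k : ℕ} (h1 : 1 ≤ k) (h2 : k ≤ S.card) :
    ∃ D, D ⊆ S ∧ Cn G D ∧ D.card = k := by
  obtain ⟨x, hx⟩ := hS.1
  obtain ⟨D, -, h⟩ := hS.exists_superset (Cn.singleton x) (by simpa using hx) (by simpa using h1) h2
  exact ⟨D, h⟩

/-- The connected component of `x` in the subgraph induced on `T`. -/
noncomputable def cmp (G : SimpleGraph V) (T : Finset V) (x : V) : Finset V :=
  T.filter fun y => ∃ C ⊆ T, Cn G C ∧ x ∈ C ∧ y ∈ C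

lemma cmp_subset (T : Finset V) (x : V) : cmp G T x ⊆ T := Finset.filter_subset _ _

lemma mem_cmp_self {T : Finset V} {x : V} (hx : x ∈ T) : x ∈ cmp G T x :=
  Finset.mem_filter.2 ⟨hx, {x}, by simpa using hx, Cn.singleton x, by simp, by simp⟩

lemma cmp_cn {T : Finset V} {x : V} (hx : x ∈ T) : Cn G (cmp G T x) := by
  refine ⟨⟨x, mem_cmp_self hx⟩, fun J hJ hne hcl => ?_⟩
  have key : ∀ C ⊆ T, Cn G C → x ∈ C → (∃ z ∈ J, z ∈ C) → C ⊆ J := by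
    intro C hCT hC hxC ⟨z, hz, hzC⟩ e he
    have := hC.2 (J ∩ C) Finset.inter_subset_right ⟨z, by simp [hz, hzC]⟩
      (fun a ha b hb hab => by
        simp at ha ⊢
        exact ⟨hcl a ha.1 b (Finset.mem_filter.2 ⟨hCT hb, C, hCT, hC, hxC, hb⟩) hab, hb⟩) e he
    simp at this; exact this.1
  obtain ⟨z, hz⟩ := hne
  obtain ⟨-, C, hCT, hC, hxC, hzC⟩ := Finset.mem_filter.1 (hJ hz)
  have hxJ := key C hCT hC hxC ⟨z, hz, hzC⟩ hxC
  intro y hy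
  obtain ⟨-, D, hDT, hD, hxD, hyD⟩ := Finset.mem_filter.1 hy
  exact key D hDT hD hxD ⟨x, hxJ, hxD⟩ hyD

lemma cmp_max {T C : Finset V} {x y : V} (hx : x ∈ T) (hCT : C ⊆ T) (hC : Cn G C) (hyC : y ∈ C)
    (hy : y ∈ cmp G T x) : C ⊆ cmp G T x := by
  intro z hz
  refine Finset.mem_filter.2 ⟨hCT hz, cmp G T x ∪ C, Finset.union_subset (cmp_subset _ _) hCT,
    (cmp_cn hx).union_adj hC hy hyC (Or.inl rfl), ?_, ?_⟩
  · simp [mem_cmp_self hx]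
  · simp [hz]

lemma cmp_closed {T : Finset V} {x y z : V} (hx : x ∈ T) (hy : y ∈ cmp G T x) (hz : z ∈ T)
    (h : G.Adj y z) : z ∈ cmp G T x :=
  cmp_max (C := {y, z}) hx (by
    intro a ha; simp at ha; rcases ha with rfl | rfl
    exacts [cmp_subset _ _ hy, hz]) (Cn.pair h) (by simp) hy (by simp)

lemma TC.cn {S : Finset V} (hS : TC G S) : Cn G S := by
  have h3 := hS.1
  refine ⟨Finset.card_pos.1 (by omega), fun J hJ hne hcl y hy => ?_⟩
  by_contra hyJ
  have h1 := hS.2 J hJ hne y hyJ (fun j hj z hz h => Or.inl (hcl j hj z hz h))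
  obtain ⟨j, hj⟩ := hne
  have h2 := hS.2 {y} (by simpa using hy) ⟨y, by simp⟩ j (by rintro h; simp at h; exact hyJ (h ▸ hj))
    (fun a ha z hz h => by
      simp at ha; subst ha
      rcases h1 z hz with h' | h'
      · exact absurd (hcl z h' a hy h.symm) hyJ
      · exact absurd h (h' ▸ G.irrefl))
  have : S ⊆ {y, j} := fun z hz => by
    rcases h2 z hz with h | h <;> simp at h ⊢ <;> simp [h]
  have := (Finset.card_le_card this).trans Finset.card_le_two
  omega

/-- In a `2`-connected set a proper part has two neighbours, unless it misses only one vertex. -/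
lemma TC.twoNb {S J : Finset V} (hS : TC G S) (hJ : J ⊆ S) (hne : J.Nonempty)
    (h2 : ∃ a ∈ S, ∃ b ∈ S, a ∉ J ∧ b ∉ J ∧ a ≠ b) : TwoNb G (S \ J) J := by
  obtain ⟨a, ha, b, hb, haJ, hbJ, hab⟩ := h2
  obtain ⟨x, hx, s, hs, hsJ, hxs⟩ := hS.cn.exists_adj hJ hne ⟨a, ha, haJ⟩
  by_contra hcon
  have : ∀ j ∈ J, ∀ y ∈ S, G.Adj j y → y ∈ J ∨ y = s := by
    intro j hj y hy h
    by_contra h'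
    push Not at h'
    exact hcon ⟨s, by simp [hs, hsJ], y, by simp [hy, h'], h'.2.symm, ⟨x, hx, hxs⟩, ⟨j, hj, h⟩⟩
  have := hS.2 J hJ hne s hsJ this
  have h1 := this a ha
  have h2 := this b hb
  grind

lemma TC.two_nbrs {S : Finset V} (hS : TC G S) {x : V} (hx : x ∈ S) :
    ∃ y ∈ S, ∃ z ∈ S, y ≠ z ∧ G.Adj x y ∧ G.Adj x z := by
  have h3 := hS.1
  have : 2 ≤ (S.erase x).card := by rw [Finset.card_erase_of_mem hx]; omega
  obtain ⟨a, ha, b, hb, hab⟩ := Finset.one_lt_card.1 (by omega : 1 < (S.erase x).card)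
  simp at ha hb
  obtain ⟨s, hs, t, ht, hst, ⟨u, hu, h1⟩, ⟨v, hv, h2⟩⟩ := hS.twoNb (J := {x}) (by simpa using hx)
    ⟨x, by simp⟩ ⟨a, ha.2, b, hb.2, by simp [ha.1], by simp [hb.1], hab⟩
  simp at hs ht hu hv; subst hu; subst hv
  exact ⟨s, hs.1, t, ht.1, hst, h1, h2⟩

/-- Deleting a vertex from a `2`-connected set leaves a connected set. -/
lemma TC.erase_cn {S : Finset V} (hS : TC G S) (x : V) : Cn G (S.erase x) := by
  have h3 := hS.1
  refine ⟨Finset.card_pos.1 ?_, fun J hJ hne hcl y hy => ?_⟩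
  · have := Finset.pred_card_le_card_erase (s := S) (a := x); omega
  · have hxJ : x ∉ J := fun h => by simpa using hJ h
    have := hS.2 J (hJ.trans (Finset.erase_subset _ _)) hne x hxJ (fun j hj z hz h => by
      by_cases hzx : z = x
      · exact Or.inr hzx
      · exact Or.inl (hcl j hj z (by simp [hz, hzx]) h)) y (Finset.mem_of_mem_erase hy)
    rcases this with h | h
    · exact h
    · simp [h] at hy

lemma TC.of_erase {S : Finset V} (h3 : 3 ≤ S.card) (h : ∀ x, Cn G (S.erase x)) : TC G S := by
  refine ⟨h3, fun J hJ hne x hx hcl y hy => ?_⟩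
  by_cases hyx : y = x
  · exact Or.inr hyx
  · refine Or.inl ((h x).2 J (fun j hj => ?_) hne (fun j hj z hz hjz => ?_) y (by simp [hy, hyx]))
    · simp [hJ hj]; rintro rfl; exact hx hj
    · simp at hz
      rcases hcl j hj z hz.2 hjz with hzJ | hzx
      · exact hzJ
      · exact absurd hzx hz.1

/-- A set containing a `2`-connected set `R` is `2`-connected once every nonempty part outside `R`
has two neighbours. -/
lemma TC.extend {R S : Finset V} (hR : TC G R) (hRS : R ⊆ S)
    (h : ∀ J ⊆ S, Disjoint J R → J.Nonempty → TwoNb G (S \ J) J) : TC G S := by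
  refine ⟨hR.1.trans (Finset.card_le_card hRS), fun J hJ hne x hx hcl y hy => ?_⟩
  by_contra hcon
  push Not at hcon
  have hRJ : (∀ r ∈ R, r ∈ J ∨ r = x) ∨ ∀ r ∈ R, r ∉ J := by
    by_cases hRJ : ∀ r ∈ R, r ∉ J
    · exact Or.inr hRJ
    · push Not at hRJ
      obtain ⟨r, hr, hrJ⟩ := hRJ
      left
      intro z hz
      have := hR.2 (J ∩ R) Finset.inter_subset_right ⟨r, by simp [hr, hrJ]⟩ x (by simp [hx])
        (fun j hj y hy hjy => by
          simp at hj ⊢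
          rcases hcl j hj.1 y (hRS hy) hjy with h' | h'
          · exact Or.inl ⟨h', hy⟩
          · exact Or.inr h') z hz
      rcases this with h' | h'
      · simp at h'; exact Or.inl h'.1
      · exact Or.inr h'
  rcases hRJ with hRJ | hRJ
  · obtain ⟨s, hs, t, ht, hst, ⟨a, ha, has⟩, b, hb, hbt⟩ := h (S.filter fun z => z ∉ J ∧ z ≠ x)
      (Finset.filter_subset _ _) (by
        rw [Finset.disjoint_left]; intro z hz hzR; simp at hz; have := hRJ z hzR; tauto)
      ⟨y, by simp [hy, hcon]⟩
    have key : ∀ c ∈ S.filter (fun z => z ∉ J ∧ z ≠ x), ∀ z ∈ S \ S.filter (fun z => z ∉ J ∧ z ≠ x),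
        G.Adj c z → z = x := by
      intro c hc z hz hcz
      simp at hc hz
      by_contra hzx
      have hzJ : z ∈ J := by by_contra h'; exact hzx (hz.2 hz.1 h')
      rcases hcl z hzJ c hc.1 hcz.symm with h' | h' <;> tauto
    exact hst ((key a ha s hs has).trans (key b hb t ht hbt).symm)
  · obtain ⟨s, hs, t, ht, hst, ⟨a, ha, has⟩, b, hb, hbt⟩ := h J hJ (by
      rw [Finset.disjoint_left]; intro z hz hzR; exact hRJ z hzR hz) hne
    simp at hs ht
    have h1 := hcl a ha s hs.1 has
    have h2 := hcl b hb t ht.1 hbt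
    grind

lemma TC.add_one {R : Finset V} (hR : TC G R) {x u v : V} (hu : u ∈ R) (hv : v ∈ R) (huv : u ≠ v)
    (h1 : G.Adj x u) (h2 : G.Adj x v) : TC G (insert x R) := by
  by_cases hx : x ∈ R
  · rwa [Finset.insert_eq_of_mem hx]
  refine hR.extend (Finset.subset_insert _ _) fun J hJ hd hne => ?_
  rw [Finset.disjoint_left] at hd
  obtain ⟨z, hz⟩ := hne
  have := hJ hz
  simp at this
  rcases this with rfl | h
  · exact ⟨u, by simp [hu]; exact fun h => hd h hu, v, by simp [hv]; exact fun h => hd h hv, huv,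
      ⟨z, hz, h1⟩, z, hz, h2⟩
  · exact absurd h (hd hz)

lemma TC.add_two {R : Finset V} (hR : TC G R) {x y u v : V} (hx : x ∉ R) (hy : y ∉ R)
    (hu : u ∈ R) (hv : v ∈ R) (huv : u ≠ v)
    (h1 : G.Adj x u) (hxy : G.Adj x y) (h2 : G.Adj y v) : TC G (insert x (insert y R)) := by
  have hne' := hxy.ne
  refine hR.extend (by intro; simp; tauto) fun J hJ hd hne => ?_
  rw [Finset.disjoint_left] at hd
  have huJ : u ∉ J := fun h => hd h hu
  have hvJ : v ∉ J := fun h => hd h hv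
  have hyx := hxy.symm
  unfold TwoNb
  by_cases hxJ : x ∈ J <;> by_cases hyJ : y ∈ J
  · exact ⟨u, by simp [*], v, by simp [*], huv, ⟨x, hxJ, h1⟩, y, hyJ, h2⟩
  · exact ⟨u, by simp [*], y, by simp [*], by grind, ⟨x, hxJ, h1⟩, x, hxJ, hxy⟩
  · exact ⟨v, by simp [*], x, by simp [*], by grind, ⟨y, hyJ, h2⟩, y, hyJ, hyx⟩
  · obtain ⟨z, hz⟩ := hne
    have := hJ hz
    simp at this
    grind

lemma TC.add_three {R : Finset V} (hR : TC G R) {x y z u v : V} (hx : x ∉ R) (hy : y ∉ R)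
    (hz : z ∉ R) (hxz : x ≠ z) (hu : u ∈ R) (hv : v ∈ R) (huv : u ≠ v)
    (h1 : G.Adj x u) (hxy : G.Adj x y) (hyz : G.Adj y z) (h2 : G.Adj z v) :
    TC G (insert x (insert y (insert z R))) := by
  have hne' := hxy.ne
  have hne'' := hyz.ne
  refine hR.extend (by intro; simp; tauto) fun J hJ hd hne => ?_
  rw [Finset.disjoint_left] at hd
  have huJ : u ∉ J := fun h => hd h hu
  have hvJ : v ∉ J := fun h => hd h hv
  have hyx := hxy.symm
  have hzy := hyz.symm
  unfold TwoNb
  by_cases hxJ : x ∈ J <;> by_cases hyJ : y ∈ J <;> by_cases hzJ : z ∈ J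
  · exact ⟨u, by simp [*], v, by simp [*], huv, ⟨x, hxJ, h1⟩, z, hzJ, h2⟩
  · exact ⟨u, by simp [*], z, by simp [*], by grind, ⟨x, hxJ, h1⟩, y, hyJ, hyz⟩
  · exact ⟨u, by simp [*], v, by simp [*], huv, ⟨x, hxJ, h1⟩, z, hzJ, h2⟩
  · exact ⟨u, by simp [*], y, by simp [*], by grind, ⟨x, hxJ, h1⟩, x, hxJ, hxy⟩
  · exact ⟨v, by simp [*], x, by simp [*], by grind, ⟨z, hzJ, h2⟩, y, hyJ, hyx⟩
  · exact ⟨x, by simp [*], z, by simp [*], by grind, ⟨y, hyJ, hyx⟩, y, hyJ, hyz⟩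
  · exact ⟨v, by simp [*], y, by simp [*], by grind, ⟨z, hzJ, h2⟩, z, hzJ, hzy⟩
  · obtain ⟨w, hw⟩ := hne
    have := hJ hw
    simp at this
    grind

/-- Deleting from a connected set a part that hangs on a single vertex leaves a connected set. -/
lemma Cn.sdiff {Q J : Finset V} (hQ : Cn G Q) {x : V} (hx : x ∈ Q) (hxJ : x ∉ J)
    (hcl : ∀ j ∈ J, ∀ y ∈ Q, G.Adj j y → y ∈ J ∨ y = x) : Cn G (Q \ J) := by
  refine ⟨⟨x, by simp [hx, hxJ]⟩, fun K hK hne hKcl y hy => ?_⟩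
  simp at hy
  by_cases hxK : x ∈ K
  · have := hQ.2 (K ∪ (J ∩ Q)) (Finset.union_subset (hK.trans Finset.sdiff_subset) Finset.inter_subset_right)
      (hne.mono Finset.subset_union_left) (fun a ha b hb hab => by
        simp at ha ⊢
        by_cases hbJ : b ∈ J
        · exact Or.inr ⟨hbJ, hb⟩
        left
        rcases ha with ha | ha
        · exact hKcl a ha b (by simp [hb, hbJ]) hab
        · rcases hcl a ha.1 b hb hab with h' | h'
          · exact absurd h' hbJ
          · exact h' ▸ hxK) y hy.1
    simp at this; tauto
  · have := hQ.2 K (hK.trans Finset.sdiff_subset) hne (fun a ha b hb hab => by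
        by_cases hbJ : b ∈ J
        · rcases hcl b hbJ a (Finset.sdiff_subset (hK ha)) hab.symm with h' | h'
          · have := hK ha; simp at this; tauto
          · exact absurd (h' ▸ ha) hxK
        · exact hKcl a ha b (by simp [hb, hbJ]) hab) x hx
    exact absurd this hxK

/-- A connected set with two neighbours in a `2`-connected set `R` contains an ear of `R`. -/
lemma TC.exists_ear {R C : Finset V} (hR : TC G R) (hC : Cn G C) (hd : Disjoint C R)
    (h2 : TwoNb G R C) : ∃ D ⊆ C, Cn G D ∧ TwoNb G R D ∧ TC G (R ∪ D) := by
  obtain ⟨D, hD, hmin⟩ := Finset.exists_min_image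
    (C.powerset.filter fun D => Cn G D ∧ TwoNb G R D) Finset.card ⟨C, by simp [hC, h2]⟩
  simp at hD hmin
  refine ⟨D, hD.1, hD.2.1, hD.2.2, hR.extend Finset.subset_union_left fun J hJ hdJ hne => ?_⟩
  have hJD : J ⊆ D := fun j hj => by
    have := hJ hj
    simp at this
    rcases this with h | h
    · exact absurd h (Finset.disjoint_left.1 hdJ hj)
    · exact h
  obtain ⟨s, hs, t, ht, hst, ⟨a, ha, has⟩, b, hb, hbt⟩ := hD.2.2
  have hRJ : ∀ r ∈ R, r ∉ J := fun r hr hrJ => Finset.disjoint_left.1 hdJ hrJ hr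
  by_contra hcon
  have hnb : ∀ x ∈ J, ∀ y ∈ J, ∀ p ∈ R ∪ D, ∀ q ∈ R ∪ D, p ∉ J → q ∉ J → G.Adj x p → G.Adj y q →
      p = q := by
    intro x hx y hy p hp q hq hpJ hqJ h1 h2
    by_contra hpq
    exact hcon ⟨p, by simpa using ⟨by simpa using hp, hpJ⟩, q, by simpa using ⟨by simpa using hq, hqJ⟩,
      hpq, ⟨x, hx, h1⟩, y, hy, h2⟩
  by_cases hall : ∃ y ∈ D, y ∉ J
  · obtain ⟨j, hj, x, hx, hxJ, hjx⟩ := hD.2.1.exists_adj hJD hne hall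
    have hcl : ∀ j ∈ J, ∀ y ∈ D, G.Adj j y → y ∈ J ∨ y = x := fun k hk y hy hky => by
      by_cases hyJ : y ∈ J
      · exact Or.inl hyJ
      · exact Or.inr (hnb k hk j hj y (by simp [hy]) x (by simp [hx]) hyJ hxJ hky hjx)
    have hRn : ∀ k ∈ J, ∀ r ∈ R, ¬ G.Adj k r := fun k hk r hr hkr => by
      have := hnb k hk j hj r (by simp [hr]) x (by simp [hx]) (hRJ r hr) hxJ hkr hjx
      exact Finset.disjoint_left.1 hd (hD.1 hx) (this ▸ hr)
    have := hmin (D \ J) (Finset.sdiff_subset.trans hD.1) (hD.2.1.sdiff hx hxJ hcl)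
      ⟨s, hs, t, ht, hst, ⟨a, by simp [ha]; exact fun h => hRn a h s hs has, has⟩, b,
        by simp [hb]; exact fun h => hRn b h t ht hbt, hbt⟩
    have h4 := Finset.card_sdiff_add_card_eq_card hJD
    have := hne.card_pos
    omega
  · push Not at hall
    exact hst (hnb a (hall a ha) b (hall b hb) s (by simp [hs]) t (by simp [ht]) (hRJ s hs) (hRJ t ht) has hbt)

/-- A closed form of `3`-connectivity: no nonempty set is separated by two vertices. -/
def K3 (G : SimpleGraph V) : Prop :=
  ∀ J : Finset V, J.Nonempty → ∀ a b, (∃ y, y ∉ J ∧ y ≠ a ∧ y ≠ b) →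
    ∃ x ∈ J, ∃ y, y ∉ J ∧ y ≠ a ∧ y ≠ b ∧ G.Adj x y

/-- `x` has a neighbour in `W`. -/
def Att (G : SimpleGraph V) (W : Finset V) (x : V) : Prop := ∃ w ∈ W, G.Adj x w

lemma TwoNb.mono {R C D : Finset V} (h : TwoNb G R C) (hCD : C ⊆ D) : TwoNb G R D := by
  obtain ⟨s, hs, t, ht, hst, ⟨x, hx, h1⟩, y, hy, h2⟩ := h
  exact ⟨s, hs, t, ht, hst, ⟨x, hCD hx, h1⟩, y, hCD hy, h2⟩

/-- A part of `U` whose only neighbours in `U` outside it equal `u` sees both `u` and `S \ U`. -/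
lemma TC.hang {S U K : Finset V} (hS : TC G S) (hU : U ⊆ S) (hR : 2 ≤ (S \ U).card)
    (hK : K ⊆ U) (hne : K.Nonempty) {u : V}
    (hcl : ∀ k ∈ K, ∀ y ∈ U, G.Adj k y → y ∈ K ∨ y = u) :
    (∃ x ∈ K, ∃ r ∈ S \ U, G.Adj x r) ∧ (¬ TwoNb G (S \ U) K → ∃ x ∈ K, G.Adj x u) := by
  obtain ⟨a, ha, b, hb, hab⟩ := Finset.one_lt_card.1 (by omega : 1 < (S \ U).card)
  simp at ha hb
  obtain ⟨s, hs, t, ht, hst, ⟨x, hx, h1⟩, y, hy, h2⟩ := hS.twoNb (hK.trans hU) hne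
    ⟨a, ha.1, b, hb.1, fun h => ha.2 (hK h), fun h => hb.2 (hK h), hab⟩
  simp at hs ht
  have key : ∀ x ∈ K, ∀ s ∈ S, s ∉ K → G.Adj x s → s ∉ U ∨ s = u := fun x hx s hs hsK h => by
    by_cases hsU : s ∈ U
    · rcases hcl x hx s hsU h with h' | h' <;> tauto
    · exact Or.inl hsU
  have k1 := key x hx s hs.1 hs.2 h1
  have k2 := key y hy t ht.1 ht.2 h2
  constructor
  · rcases k1 with k1 | k1
    · exact ⟨x, hx, s, by simp [*], h1⟩
    · rcases k2 with k2 | k2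
      · exact ⟨y, hy, t, by simp [*], h2⟩
      · exact absurd (k1.trans k2.symm) hst
  · intro hT
    rcases k1 with k1 | k1
    · rcases k2 with k2 | k2
      · exact absurd ⟨s, by simp [*], t, by simp [*], hst, ⟨x, hx, h1⟩, y, hy, h2⟩ hT
      · exact ⟨y, hy, k2 ▸ h2⟩
    · exact ⟨x, hx, k1 ▸ h1⟩

lemma cmp_erase_closed {U : Finset V} {u k : V} (hk : k ∈ U.erase u) :
    ∀ x ∈ cmp G (U.erase u) k, ∀ y ∈ U, G.Adj x y → y ∈ cmp G (U.erase u) k ∨ y = u := by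
  intro x hx y hy h
  by_cases hyu : y = u
  · exact Or.inr hyu
  · exact Or.inl (cmp_closed hk hx (by simp [hy, hyu]) h)

lemma notMem_cmp_erase {U : Finset V} {u k : V} : u ∉ cmp G (U.erase u) k := fun h => by
  simpa using cmp_subset _ _ h

section Core
variable {S U : Finset V}

lemma TC.twoNb_sub (hS : TC G S) (hU : U ⊆ S) (hR : 2 ≤ (S \ U).card)
    (hne : U.Nonempty) : TwoNb G (S \ U) U := by
  obtain ⟨a, ha, b, hb, hab⟩ := Finset.one_lt_card.1 (by omega : 1 < (S \ U).card)
  simp at ha hb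
  exact hS.twoNb hU hne ⟨a, ha.1, b, hb.1, ha.2, hb.2, hab⟩

/-- If all ears inside `U` contain all attachments of `W` in `U`, then `U` consists of
attachments. -/
lemma core_att (hS : TC G S) (hU : U ⊆ S) (hR : 2 ≤ (S \ U).card)
    {W : Finset V} (hK : K3 G) (hW : W.Nonempty) (hWS : ∀ v, v ∈ S ↔ v ∉ W)
    (hC : ∀ C ⊆ U, Cn G C → TwoNb G (S \ U) C → ∀ u ∈ U, Att G W u → u ∈ C)
    (hatt : ∃ u ∈ U, Att G W u) : ∀ u ∈ U, Att G W u := by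
  by_contra hcon
  push Not at hcon
  obtain ⟨z, hzU, hz⟩ := hcon
  obtain ⟨w, hw⟩ := hW
  set T := U.filter (fun u => ¬ Att G W u) with hT
  have hzT : z ∈ T := by simp [hT, hzU, hz]
  set Z := cmp G T z with hZ
  have hZT : Z ⊆ T := cmp_subset _ _
  have hZU : Z ⊆ U := hZT.trans (Finset.filter_subset _ _)
  have hZatt : ∀ x ∈ Z, ¬ Att G W x := fun x hx => (Finset.mem_filter.1 (hZT hx)).2
  have hzZ : z ∈ Z := mem_cmp_self hzT
  have hZc : Cn G Z := cmp_cn hzT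
  have hnb : ∀ a ∈ S, ∀ b ∈ S, ∃ x ∈ Z, ∃ y, y ∈ S ∧ y ∉ Z ∧ y ≠ a ∧ y ≠ b ∧ G.Adj x y ∧
      (y ∈ U → Att G W y) := by
    intro a ha b hb
    obtain ⟨x, hx, y, hy, hya, hyb, h⟩ := hK Z ⟨z, hzZ⟩ a b ⟨w,
      fun h => (hWS w).1 (hU (hZU h)) hw, fun h => (hWS w).1 (h ▸ ha) hw,
      fun h => (hWS w).1 (h ▸ hb) hw⟩
    refine ⟨x, hx, y, (hWS y).2 fun hyW => hZatt x hx ⟨y, hyW, h⟩, hy, hya, hyb, h, fun hyU => ?_⟩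
    by_contra hyA
    exact hy (cmp_closed hzT hx (by simp [hT, hyU, hyA]) h)
  have hZR : ¬ TwoNb G (S \ U) Z := fun h => by
    obtain ⟨u, huU, hu⟩ := hatt
    exact hZatt u (hC Z hZU hZc h u huU hu) hu
  -- the part of `U - d` containing `Z`
  have hA : ∀ d ∈ U, Att G W d → ∃ r ∈ S \ U, (∃ x ∈ cmp G (U.erase d) z, G.Adj x r) ∧
      ∀ x ∈ cmp G (U.erase d) z, ∀ r' ∈ S \ U, G.Adj x r' → r' = r := by
    intro d hd hdA
    have hzd : z ∈ U.erase d := by simp [hzU]; rintro rfl; exact hz hdA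
    obtain ⟨x, hx, r, hr, h⟩ := (hS.hang hU hR ((cmp_subset _ _).trans (Finset.erase_subset _ _))
      ⟨z, mem_cmp_self hzd⟩ (cmp_erase_closed (G := G) hzd)).1
    refine ⟨r, hr, ⟨x, hx, h⟩, fun x' hx' r' hr' h' => ?_⟩
    by_contra hne
    exact notMem_cmp_erase (hC _ ((cmp_subset _ _).trans (Finset.erase_subset _ _)) (cmp_cn hzd)
      ⟨r', hr', r, hr, hne, ⟨x', hx', h'⟩, x, hx, h⟩ d hd hdA)
  have hZK : ∀ d ∈ U, Att G W d → Z ⊆ cmp G (U.erase d) z := by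
    intro d hd hdA
    have hzd : z ∈ U.erase d := by simp [hzU]; rintro rfl; exact hz hdA
    refine cmp_max hzd (fun x hx => ?_) hZc hzZ (mem_cmp_self hzd)
    simp [hZU hx]; rintro rfl; exact hZatt _ hx hdA
  have hB : ∀ d ∈ U, Att G W d → (∃ x ∈ Z, G.Adj x d) → ∀ e ∈ U, Att G W e → (∃ x ∈ Z, G.Adj x e) →
      d ≠ e → ∀ u ∈ U, u ∈ cmp G (U.erase d) z ∨ u ∈ cmp G (U.erase e) z := by
    rintro d hd hdA ⟨x, hx, hxd⟩ e he heA ⟨x', hx', hxe⟩ hde u hu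
    by_contra hcon
    push Not at hcon
    have hzd : z ∈ U.erase d := by simp [hzU]; rintro rfl; exact hz hdA
    have hze : z ∈ U.erase e := by simp [hzU]; rintro rfl; exact hz heA
    have hdK : d ∈ cmp G (U.erase e) z := cmp_closed hze (hZK e he heA hx) (by simp [hd, hde]) hxd
    have heK : e ∈ cmp G (U.erase d) z :=
      cmp_closed hzd (hZK d hd hdA hx') (by simp [he, hde.symm]) hxe
    have hud : u ∈ U.erase d := by simp [hu]; rintro rfl; exact hcon.2 hdK
    have hKs : cmp G (U.erase d) u ⊆ U := (cmp_subset _ _).trans (Finset.erase_subset _ _)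
    obtain ⟨k, hk, hkd⟩ := (hS.hang hU hR hKs
      ⟨u, mem_cmp_self hud⟩ (cmp_erase_closed (G := G) hud)).2 fun h =>
        notMem_cmp_erase (hC _ hKs (cmp_cn hud) h d hd hdA)
    have heu : e ∉ cmp G (U.erase d) u := fun h =>
      hcon.1 (cmp_max hzd (cmp_subset _ _) (cmp_cn hud) h heK (mem_cmp_self hud))
    refine hcon.2 (cmp_max hze (C := insert d (cmp G (U.erase d) u)) (fun a ha => ?_)
      ((cmp_cn hud).insert_adj hk hkd) (y := d) (by simp) hdK (by simp [mem_cmp_self hud]))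
    simp at ha
    rcases ha with rfl | ha
    · simp [hd, hde]
    · simp [hKs ha]; rintro rfl; exact heu ha
  obtain ⟨p, hp, q, hq, hpq, ⟨a, ha, hap⟩, b, hb, hbq⟩ := hS.twoNb_sub hU hR ⟨z, hzU⟩
  have hD : ∀ d ∈ U, Att G W d → (∃ x ∈ Z, G.Adj x d) → ∀ e ∈ U, Att G W e → (∃ x ∈ Z, G.Adj x e) →
      d ≠ e → ∀ y ∈ S, (y ∈ U → Att G W y) → y ≠ d → y ≠ e → ∀ x ∈ Z, ¬ G.Adj x y := by
    intro d hd hdA hdZ e he heA heZ hde y hyS hyA hyd hye x hx hxy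
    obtain ⟨r1, hr1, ⟨x1, hx1, h1⟩, u1⟩ := hA d hd hdA
    obtain ⟨r2, hr2, ⟨x2, hx2, h2⟩, u2⟩ := hA e he heA
    have hall : ∀ u ∈ U, ∀ r ∈ S \ U, G.Adj u r → r = r1 ∨ r = r2 := fun u hu r hr h => by
      rcases hB d hd hdA hdZ e he heA heZ hde u hu with h' | h'
      · exact Or.inl (u1 u h' r hr h)
      · exact Or.inr (u2 u h' r hr h)
    have k1 := hall a ha p hp hap
    have k2 := hall b hb q hq hbq
    by_cases hyU : y ∈ U
    · have hyA := hyA hyU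
      obtain ⟨r3, hr3, ⟨x3, hx3, h3⟩, u3⟩ := hA y hyU hyA
      have hall' : ∀ u ∈ U, ∀ r ∈ S \ U, G.Adj u r → r = r1 ∨ r = r3 := fun u hu r hr h => by
        rcases hB d hd hdA hdZ y hyU hyA ⟨x, hx, hxy⟩ hyd.symm u hu with h' | h'
        · exact Or.inl (u1 u h' r hr h)
        · exact Or.inr (u3 u h' r hr h)
      have hall'' : ∀ u ∈ U, ∀ r ∈ S \ U, G.Adj u r → r = r2 ∨ r = r3 := fun u hu r hr h => by
        rcases hB e he heA heZ y hyU hyA ⟨x, hx, hxy⟩ hye.symm u hu with h' | h'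
        · exact Or.inl (u2 u h' r hr h)
        · exact Or.inr (u3 u h' r hr h)
      have := hall' a ha p hp hap
      have := hall' b hb q hq hbq
      have := hall'' a ha p hp hap
      have := hall'' b hb q hq hbq
      grind
    · have := u1 x (hZK d hd hdA hx) y ((Finset.mem_sdiff.2 ⟨‹_›, ‹_›⟩)) hxy
      have := u2 x (hZK e he heA hx) y ((Finset.mem_sdiff.2 ⟨‹_›, ‹_›⟩)) hxy
      grind
  obtain ⟨x1, hx1, y1, hy1S, hy1Z, -, -, h1, hy1⟩ := hnb z (hU hzU) z (hU hzU)
  obtain ⟨x2, hx2, y2, hy2S, hy2Z, h21, -, h2, hy2⟩ := hnb y1 hy1S y1 hy1S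
  obtain ⟨x3, hx3, y3, hy3S, hy3Z, h31, h32, h3, hy3⟩ := hnb y1 hy1S y2 hy2S
  by_cases c1 : y1 ∈ U <;> by_cases c2 : y2 ∈ U
  · exact hD y1 c1 (hy1 c1) ⟨x1, hx1, h1⟩ y2 c2 (hy2 c2) ⟨x2, hx2, h2⟩ h21.symm y3 hy3S hy3 h31 h32
      x3 hx3 h3
  · by_cases c3 : y3 ∈ U
    · exact hD y1 c1 (hy1 c1) ⟨x1, hx1, h1⟩ y3 c3 (hy3 c3) ⟨x3, hx3, h3⟩ h31.symm y2 hy2S hy2 h21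
        h32.symm x2 hx2 h2
    · exact hZR ⟨y2, Finset.mem_sdiff.2 ⟨‹_›, ‹_›⟩, y3, Finset.mem_sdiff.2 ⟨‹_›, ‹_›⟩, h32.symm, ⟨x2, hx2, h2⟩, x3, hx3, h3⟩
  · by_cases c3 : y3 ∈ U
    · exact hD y2 c2 (hy2 c2) ⟨x2, hx2, h2⟩ y3 c3 (hy3 c3) ⟨x3, hx3, h3⟩ h32.symm y1 hy1S hy1
        h21.symm h31.symm x1 hx1 h1
    · exact hZR ⟨y1, Finset.mem_sdiff.2 ⟨‹_›, ‹_›⟩, y3, Finset.mem_sdiff.2 ⟨‹_›, ‹_›⟩, h31.symm, ⟨x1, hx1, h1⟩, x3, hx3, h3⟩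
  · exact hZR ⟨y1, Finset.mem_sdiff.2 ⟨‹_›, ‹_›⟩, y2, Finset.mem_sdiff.2 ⟨‹_›, ‹_›⟩, h21.symm, ⟨x1, hx1, h1⟩, x2, hx2, h2⟩

lemma core_cn (hS : TC G S) (hU : U ⊆ S) (hR : 2 ≤ (S \ U).card)
    (hM : ∀ C ⊆ U, Cn G C → TwoNb G (S \ U) C → C = U) (hne : U.Nonempty) : Cn G U := by
  obtain ⟨u, hu⟩ := hne
  have hcn : Cn G (cmp G U u) := cmp_cn hu
  have : cmp G U u = U := by
    refine hM _ (cmp_subset _ _) hcn ?_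
    obtain ⟨a, ha, b, hb, hab⟩ := Finset.one_lt_card.1 (by omega : 1 < (S \ U).card)
    simp at ha hb
    obtain ⟨s, hs, t, ht, hst, ⟨x, hx, h1⟩, y, hy, h2⟩ := hS.twoNb ((cmp_subset U u).trans hU)
      hcn.1 ⟨a, ha.1, b, hb.1, fun h => ha.2 (cmp_subset _ _ h), fun h => hb.2 (cmp_subset _ _ h), hab⟩
    simp at hs ht
    exact ⟨s, by simp [hs]; exact fun h => hs.2 (cmp_closed hu hx h h1), t,
      by simp [ht]; exact fun h => ht.2 (cmp_closed hu hy h h2), hst, ⟨x, hx, h1⟩, y, hy, h2⟩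
  rwa [this] at hcn


lemma core_nbr_unique (hS : TC G S) (hU : U ⊆ S) (hR : 2 ≤ (S \ U).card)
    (hM : ∀ C ⊆ U, Cn G C → TwoNb G (S \ U) C → C = U) (hcn : Cn G U)
    {u k : V} (hu : u ∈ U) (hk : k ∈ U.erase u) :
    ∀ y ∈ cmp G (U.erase u) k, ∀ y' ∈ cmp G (U.erase u) k, G.Adj y u → G.Adj y' u → y = y' := by
  intro y hy y' hy' h h'
  by_contra hne
  set K := cmp G (U.erase u) k with hKdef
  have hKc : Cn G K := cmp_cn hk
  have hKU : K ⊆ U := (cmp_subset _ _).trans (Finset.erase_subset _ _)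
  have huK : u ∉ K := notMem_cmp_erase
  have hyK : y ∈ K.erase y' := by simp [hy, hne]
  have hrest : Cn G (U \ K) := hcn.sdiff hu huK (cmp_erase_closed hk)
  have hKR : ¬ TwoNb G (S \ U) K := fun hT => huK ((hM K hKU hKc hT).symm ▸ hu)
  obtain ⟨p, hp, q, hq, hpq, ⟨a, ha, hap⟩, b, hb, hbq⟩ := hS.twoNb_sub hU hR ⟨u, hu⟩
  set J := cmp G (K.erase y') y with hJdef
  have hJK : J ⊆ K := (cmp_subset _ _).trans (Finset.erase_subset _ _)
  have hyJ : y ∈ J := mem_cmp_self hyK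
  have hy'J : y' ∉ J := notMem_cmp_erase
  by_cases hr : ∃ x ∈ J, ∃ r ∈ S \ U, G.Adj x r
  · obtain ⟨x, hx, r, hr, hxr⟩ := hr
    have huniq : ∀ x ∈ K, ∀ r' ∈ S \ U, G.Adj x r' → r' = r := fun x' hx' r' hr' h' => by
      by_contra hne
      exact hKR ⟨r', hr', r, hr, hne, ⟨x', hx', h'⟩, x, hJK hx, hxr⟩
    have hnb : ∀ a ∈ U, ∀ p ∈ S \ U, G.Adj a p → ∃ x ∈ J ∪ (U \ K), G.Adj x p := by
      intro a ha p hp h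
      by_cases haK : a ∈ K
      · exact ⟨x, by simp [hx], huniq a haK p hp h ▸ hxr⟩
      · exact ⟨a, by simp [ha, haK], h⟩
    have := hM (J ∪ (U \ K)) (Finset.union_subset (hJK.trans hKU) Finset.sdiff_subset)
      ((cmp_cn hyK).union_adj hrest hyJ (by simp [hu, huK]) (Or.inr h))
      ⟨p, hp, q, hq, hpq, hnb a ha p hp hap, hnb b hb q hq hbq⟩
    have h4 : y' ∈ J ∪ (U \ K) := this.symm ▸ hKU hy'
    simp [hy'J, hy'] at h4
  · push Not at hr
    have hnb : ∀ a ∈ U, ∀ p ∈ S \ U, G.Adj a p → ∃ x ∈ (K \ J) ∪ (U \ K), G.Adj x p := by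
      intro a ha p hp h
      have : a ∉ J := fun haJ => hr a haJ p hp h
      exact ⟨a, by simp [ha, this]; tauto, h⟩
    have := hM ((K \ J) ∪ (U \ K)) (Finset.union_subset (Finset.sdiff_subset.trans hKU)
      Finset.sdiff_subset)
      ((hKc.sdiff hy' hy'J (cmp_erase_closed hyK)).union_adj hrest (by simp [hy', hy'J])
        (by simp [hu, huK]) (Or.inr h'))
      ⟨p, hp, q, hq, hpq, hnb a ha p hp hap, hnb b hb q hq hbq⟩
    have h4 : y ∈ (K \ J) ∪ (U \ K) := this.symm ▸ hKU hy
    simp [hyJ, hy] at h4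

lemma core_part (hS : TC G S) (hU : U ⊆ S) (hR : 2 ≤ (S \ U).card)
    (hM : ∀ C ⊆ U, Cn G C → TwoNb G (S \ U) C → C = U) (hcn : Cn G U)
    {u s : V} (hu : u ∈ U) (hs : s ∈ U) (hus : G.Adj u s) :
    ∃ r ∈ S \ U, ∃ r' ∈ S \ U, r ≠ r' ∧ (∀ x ∈ cmp G (U.erase u) s, ∀ t ∈ S \ U, G.Adj x t → t = r) ∧
      (∀ x ∈ U, x ∉ cmp G (U.erase u) s → ∀ t ∈ S \ U, G.Adj x t → t = r') ∧
      (∃ x ∈ cmp G (U.erase u) s, G.Adj x r) := by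
  have hsu : s ∈ U.erase u := by simp [hs, hus.ne']
  set K := cmp G (U.erase u) s with hKdef
  have hKc : Cn G K := cmp_cn hsu
  have hKU : K ⊆ U := (cmp_subset _ _).trans (Finset.erase_subset _ _)
  have huK : u ∉ K := notMem_cmp_erase
  have hrest : Cn G (U \ K) := hcn.sdiff hu huK (cmp_erase_closed hsu)
  have hsK : s ∈ K := mem_cmp_self hsu
  have hKR : ¬ TwoNb G (S \ U) K := fun hT => huK ((hM K hKU hKc hT).symm ▸ hu)
  have hKR' : ¬ TwoNb G (S \ U) (U \ K) := fun hT => by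
    have h4 : s ∈ U \ K := (hM (U \ K) Finset.sdiff_subset hrest hT).symm ▸ hs
    simp [hsK] at h4
  obtain ⟨x, hx, r, hr, hxr⟩ := (hS.hang hU hR hKU ⟨s, hsK⟩ (cmp_erase_closed hsu)).1
  have hun : ∀ x ∈ K, ∀ t ∈ S \ U, G.Adj x t → t = r := fun x' hx' r' hr' h' => by
      by_contra hne
      exact hKR ⟨r', hr', r, hr, hne, ⟨x', hx', h'⟩, x, hx, hxr⟩
  obtain ⟨p, hp, q, hq, hpq, ⟨a, ha, hap⟩, b, hb, hbq⟩ := hS.twoNb_sub hU hR ⟨u, hu⟩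
  have : ∃ r' ∈ S \ U, r ≠ r' ∧ ∃ c ∈ U \ K, G.Adj c r' := by
    by_cases hpr : p = r
    · refine ⟨q, hq, hpr ▸ hpq, b, ?_, hbq⟩
      simp [hb]; intro hbK; exact hpq (hpr.trans (hun b hbK q hq hbq).symm)
    · refine ⟨p, hp, Ne.symm hpr, a, ?_, hap⟩
      simp [ha]; intro haK; exact hpr (hun a haK p hp hap)
  obtain ⟨r', hr', hrr', c, hc, hcr⟩ := this
  refine ⟨r, hr, r', hr', hrr', hun, fun x' hx' hx'K t ht h => ?_, x, hx, hxr⟩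
  by_contra hne
  exact hKR' ⟨t, ht, r', hr', hne, ⟨x', Finset.mem_sdiff.2 ⟨‹_›, ‹_›⟩, h⟩, c, hc, hcr⟩

/-- Vertices of a minimal ear have degree two, unless the ear is a single vertex. -/
lemma core_deg (hS : TC G S) (hU : U ⊆ S) (hR : 2 ≤ (S \ U).card)
    (hM : ∀ C ⊆ U, Cn G C → TwoNb G (S \ U) C → C = U) (hcn : Cn G U)
    {u a b c : V} (hu : u ∈ U) (ha : a ∈ S) (hb : b ∈ S) (hc : c ∈ S)
    (hab : a ≠ b) (hac : a ≠ c) (hbc : b ≠ c) (h1 : G.Adj u a) (h2 : G.Adj u b) (h3 : G.Adj u c) :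
    U = {u} := by
  -- a neighbour `d` sends an `R`-edge from outside the part of another neighbour `s`
  have hrho : ∀ s ∈ U, G.Adj u s → ∀ d ∈ S, G.Adj u d → s ≠ d →
      (d ∈ U → ∀ x ∈ cmp G (U.erase u) d, x ∉ cmp G (U.erase u) s) := by
    intro s hs hus d hd hud hsd hdU x hx hxs
    have hsu : s ∈ U.erase u := by simp [hs, hus.ne']
    have hdu : d ∈ U.erase u := by simp [hdU, hud.ne']
    have := cmp_max hsu (cmp_subset (U.erase u) d) (cmp_cn hdu) hx hxs (mem_cmp_self hdu)
    exact hsd (core_nbr_unique hS hU hR hM hcn hu hsu s (mem_cmp_self hsu) d this hus.symm hud.symm)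
  have key : ∀ a ∈ U, ∀ b ∈ S, ∀ c ∈ S, G.Adj u a → G.Adj u b → G.Adj u c → a ≠ b → a ≠ c → b ≠ c →
      False := by
    intro a ha b hb c hc h1 h2 h3 hab hac hbc
    obtain ⟨r, hr, r', hr', hrr', hA, hB, xa, hxa, hxar⟩ := core_part hS hU hR hM hcn hu ha h1
    by_cases hbU : b ∈ U
    · obtain ⟨r2, hr2, r2', hr2', hrr2', hA2, hB2, xb, hxb, hxbr⟩ := core_part hS hU hR hM hcn hu hbU h2
      have e1 := hB xb (Finset.mem_of_mem_erase (cmp_subset _ _ hxb))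
        (hrho a ha h1 b hb h2 hab hbU xb hxb) r2 hr2 hxbr
      have e2 := hB2 xa (Finset.mem_of_mem_erase (cmp_subset _ _ hxa))
        (hrho b hbU h2 a (hU ha) h1 hab.symm ha xa hxa) r hr hxar
      by_cases hcU : c ∈ U
      · obtain ⟨r3, hr3, r3', hr3', hrr3', hA3, hB3, xc, hxc, hxcr⟩ := core_part hS hU hR hM hcn hu hcU h3
        have e3 := hB xc (Finset.mem_of_mem_erase (cmp_subset _ _ hxc))
          (hrho a ha h1 c hc h3 hac hcU xc hxc) r3 hr3 hxcr
        have e4 := hB2 xc (Finset.mem_of_mem_erase (cmp_subset _ _ hxc))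
          (hrho b hbU h2 c hc h3 hbc hcU xc hxc) r3 hr3 hxcr
        grind
      · have e3 := hB u hu notMem_cmp_erase c (by simp [*]) h3
        have e4 := hB2 u hu notMem_cmp_erase c (by simp [*]) h3
        grind
    · have e1 := hB u hu notMem_cmp_erase b (by simp [*]) h2
      by_cases hcU : c ∈ U
      · obtain ⟨r3, hr3, r3', hr3', hrr3', hA3, hB3, xc, hxc, hxcr⟩ := core_part hS hU hR hM hcn hu hcU h3
        have e3 := hB xc (Finset.mem_of_mem_erase (cmp_subset _ _ hxc))
          (hrho a ha h1 c hc h3 hac hcU xc hxc) r3 hr3 hxcr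
        have e4 := hB3 u hu notMem_cmp_erase b (by simp [*]) h2
        have e5 := hB3 xa (Finset.mem_of_mem_erase (cmp_subset _ _ hxa))
          (hrho c hcU h3 a (hU ha) h1 hac.symm ha xa hxa) r hr hxar
        grind
      · have e3 := hB u hu notMem_cmp_erase c (by simp [*]) h3
        grind
  by_cases haU : a ∈ U
  · exact (key a haU b hb c hc h1 h2 h3 hab hac hbc).elim
  by_cases hbU : b ∈ U
  · exact (key b hbU a ha c hc h2 h1 h3 hab.symm hbc hac).elim
  exact (hM {u} (by simpa using hu) (Cn.singleton u) ⟨a, by simp [*], b, by simp [*], hab,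
    ⟨u, by simp, h1⟩, u, by simp, h2⟩).symm

/-- A minimal ear with at least two vertices is attached by exactly two edges. -/
lemma core_ends (hS : TC G S) (hU : U ⊆ S) (hR : 2 ≤ (S \ U).card)
    (hM : ∀ C ⊆ U, Cn G C → TwoNb G (S \ U) C → C = U) (hcn : Cn G U)
    (h2 : 2 ≤ U.card) : ∃ p ∈ U, ∃ q ∈ U, ∃ s ∈ S \ U, ∃ t ∈ S \ U, p ≠ q ∧ s ≠ t ∧
    G.Adj p s ∧ G.Adj q t ∧ ∀ u ∈ U, ∀ r ∈ S \ U, G.Adj u r → (u = p ∧ r = s) ∨ (u = q ∧ r = t) := by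
  have hone : ∀ u ∈ U, U ≠ {u} := by rintro u - h; rw [h] at h2; simp at h2
  have hdeg : ∀ u ∈ U, ∀ r ∈ S \ U, G.Adj u r → ∀ t ∈ S \ U, G.Adj u t → r = t := by
    intro u hu r hr h t ht h'
    by_contra hrt
    exact hone u hu (hM {u} (by simpa using hu) (Cn.singleton u) ⟨r, hr, t, ht, hrt,
      ⟨u, by simp, h⟩, u, by simp, h'⟩).symm
  have herase : ∀ u ∈ U, ∀ r ∈ S \ U, G.Adj u r → Cn G (U \ {u}) := by
    intro u hu r hr h
    obtain ⟨y, hy, huy⟩ := hcn.exists_nbr hu h2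
    refine hcn.sdiff hy (by simp [huy.ne']) fun j hj z hz hjz => ?_
    simp at hj ⊢; subst hj
    right
    by_contra hzy
    have hr' := hr
    simp at hr'
    exact hone _ hu (core_deg hS hU hR hM hcn hu (hU hy) (hU hz) hr'.1 (Ne.symm hzy)
      (by rintro rfl; exact hr'.2 hy) (by rintro rfl; exact hr'.2 hz) huy hjz h)
  have hno : ∀ u ∈ U, ∀ r ∈ S \ U, G.Adj u r → ¬ TwoNb G (S \ U) (U \ {u}) := by
    intro u hu r hr h hT
    have := hM _ Finset.sdiff_subset (herase u hu r hr h) hT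
    have : u ∈ U \ {u} := this.symm ▸ hu
    simp at this
  obtain ⟨s, hs, t, ht, hst, ⟨p, hp, hps⟩, q, hq, hqt⟩ := hS.twoNb_sub hU hR hcn.1
  have hpq : p ≠ q := by rintro rfl; exact hst (hdeg p hp s hs hps t ht hqt)
  refine ⟨p, hp, q, hq, s, hs, t, ht, hpq, hst, hps, hqt, fun u hu r hr h => ?_⟩
  by_cases hup : u = p
  · exact Or.inl ⟨hup, hdeg u hu r hr h s hs (hup ▸ hps)⟩
  by_cases huq : u = q
  · exact Or.inr ⟨huq, hdeg u hu r hr h t ht (huq ▸ hqt)⟩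
  exfalso
  by_cases hrs : r = s
  · exact hno p hp s hs hps ⟨s, hs, t, ht, hst, ⟨u, by simp [hu, hup], hrs ▸ h⟩, q,
      by simp [hq, hpq.symm], hqt⟩
  · exact hno q hq t ht hqt ⟨r, hr, s, hs, hrs, ⟨u, by simp [hu, huq], h⟩, p, by simp [hp, hpq], hps⟩

end Core

/-- `x` has at most two neighbours in `S`. -/
def D2 (G : SimpleGraph V) (S : Finset V) (x : V) : Prop :=
  ∀ a ∈ S, ∀ b ∈ S, ∀ c ∈ S, G.Adj x a → G.Adj x b → G.Adj x c → a = b ∨ a = c ∨ b = c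

/-- A removable ear of `S` with at least two vertices, all of them attached to `W`. -/
structure Leaf (G : SimpleGraph V) (W S U : Finset V) : Prop where
  tc : TC G S
  sub : U ⊆ S
  att : ∀ u ∈ U, Att G W u
  two : 2 ≤ U.card
  tcR : TC G (S \ U)
  min : ∀ C ⊆ U, Cn G C → TwoNb G (S \ U) C → C = U

namespace Leaf
variable {W S U : Finset V}

lemma card_rest (h : Leaf G W S U) : 2 ≤ (S \ U).card := by have := h.tcR.1; omega

lemma cn (h : Leaf G W S U) : Cn G U :=
  core_cn h.tc h.sub h.card_rest h.min (Finset.card_pos.1 (by have := h.two; omega))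

lemma d2 (h : Leaf G W S U) {u : V} (hu : u ∈ U) : D2 G S u := by
  intro a ha b hb c hc h1 h2 h3
  by_contra hcon
  push Not at hcon
  have := core_deg h.tc h.sub h.card_rest h.min h.cn hu ha hb hc hcon.1 hcon.2.1 hcon.2.2 h1 h2 h3
  have h4 := h.two
  rw [this] at h4; simp at h4

lemma ends (h : Leaf G W S U) : ∃ p ∈ U, ∃ q ∈ U, ∃ s ∈ S \ U, ∃ t ∈ S \ U, p ≠ q ∧ s ≠ t ∧
    G.Adj p s ∧ G.Adj q t ∧ ∀ u ∈ U, ∀ r ∈ S \ U, G.Adj u r → (u = p ∧ r = s) ∨ (u = q ∧ r = t) :=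
  core_ends h.tc h.sub h.card_rest h.min h.cn h.two

lemma mem_of_adj (h : Leaf G W S U)
    {u x : V} (hu : u ∈ U) (hx : x ∈ S) (hux : G.Adj u x) (hd : D2 G S x) :
    x ∈ U := by
  by_contra hxU
  obtain ⟨y, hy, z, hz, hyz, h1, h2⟩ := h.tcR.two_nbrs (x := x) (Finset.mem_sdiff.2 ⟨hx, hxU⟩)
  simp at hy hz
  rcases hd y hy.1 z hz.1 u (h.sub hu) h1 h2 hux.symm with h' | h' | h'
  · exact hyz h'
  · exact hy.2 (h' ▸ hu)
  · exact hz.2 (h' ▸ hu)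

end Leaf

lemma Cn.of_attach {Q X : Finset V} (hQ : Cn G Q) (hQX : Q ⊆ X)
    (h : ∀ J ⊆ X, Disjoint J Q → J.Nonempty → ∃ x ∈ J, ∃ y ∈ X, y ∉ J ∧ G.Adj x y) : Cn G X := by
  refine ⟨hQ.1.mono hQX, fun J hJ hne hcl y hy => ?_⟩
  by_contra hyJ
  by_cases hJQ : Disjoint J Q
  · obtain ⟨x, hx, z, hz, hzJ, hxz⟩ := h J hJ hJQ hne
    exact hzJ (hcl x hx z hz hxz)
  · rw [Finset.not_disjoint_iff] at hJQ
    obtain ⟨j, hjJ, hjQ⟩ := hJQ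
    have hQJ : ∀ q ∈ Q, q ∈ J := fun q hq => by
      have := hQ.2 (J ∩ Q) Finset.inter_subset_right ⟨j, by simp [*]⟩ (fun a ha b hb hab => by
        simp at ha ⊢; exact ⟨hcl a ha.1 b (hQX hb) hab, hb⟩) q hq
      simp at this; exact this.1
    obtain ⟨x, hx, z, hz, hzJ, hxz⟩ := h (X \ J) Finset.sdiff_subset (by
      rw [Finset.disjoint_left]; intro a ha haQ; simp at ha; exact ha.2 (hQJ a haQ))
      ⟨y, by simp [*]⟩
    simp at hx hzJ
    exact hx.2 (hcl z (hzJ hz) x hx.1 hxz.symm)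

/-- `W` cannot be enlarged by a single vertex. -/
def Nonext (G : SimpleGraph V) (W S : Finset V) : Prop :=
  ∀ v ∈ S, Att G W v → ¬ TC G (S.erase v)

section
variable {W S : Finset V}

lemma exists_leaf (hK : K3 G) (hW : W.Nonempty) (hWS : ∀ v, v ∈ S ↔ v ∉ W) (hS : TC G S)
    (hn : Nonext G W S) {R0 : Finset V} (hR0 : TC G R0) (hR0S : R0 ⊆ S)
    (hv : ∃ v ∈ S, Att G W v ∧ v ∉ R0) : ∃ U, Leaf G W S U ∧ Disjoint U R0 := by
  obtain ⟨R, hR, hmax⟩ := Finset.exists_max_image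
    (S.powerset.filter fun R => TC G R ∧ R0 ⊆ R ∧ ∃ v ∈ S, Att G W v ∧ v ∉ R) Finset.card
    ⟨R0, by simp [hR0, hR0S, hv]⟩
  simp only [Finset.mem_filter, Finset.mem_powerset] at hR hmax
  obtain ⟨hRS, hRT, hR0R, v, hvS, hv, hvR⟩ := hR
  have hSU : S \ (S \ R) = R := by exact Finset.sdiff_sdiff_eq_self hRS
  have hC : ∀ C ⊆ S \ R, Cn G C → TwoNb G R C → ∀ u ∈ S \ R, Att G W u → u ∈ C := by
    intro C hC hCc hT u hu hua
    by_contra huC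
    obtain ⟨D, hDC, hD, -, hRD⟩ := hRT.exists_ear hCc
      (Finset.disjoint_left.2 fun x hx => (Finset.mem_sdiff.1 (hC hx)).2) hT
    have hle := hmax (R ∪ D) ⟨Finset.union_subset hRS (hDC.trans (hC.trans Finset.sdiff_subset)), hRD,
      hR0R.trans Finset.subset_union_left, u, (Finset.mem_sdiff.1 hu).1, hua, by
        simp [(Finset.mem_sdiff.1 hu).2]; exact fun h => huC (hDC h)⟩
    obtain ⟨d, hd⟩ := hD.1
    have : R.card < (R ∪ D).card := Finset.card_lt_card ⟨Finset.subset_union_left, fun h =>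
      (Finset.mem_sdiff.1 (hC (hDC hd))).2 (h (by simp [hd]))⟩
    omega
  have hvU : v ∈ S \ R := Finset.mem_sdiff.2 ⟨hvS, hvR⟩
  have hR2 : 2 ≤ (S \ (S \ R)).card := by rw [hSU]; have := hRT.1; omega
  have hatt := core_att hS Finset.sdiff_subset hR2 hK hW hWS (by rwa [hSU]) ⟨v, hvU, hv⟩
  refine ⟨S \ R, ⟨hS, Finset.sdiff_subset, hatt, ?_, by rwa [hSU], ?_⟩, ?_⟩
  · by_contra hlt
    have h1 : (S \ R).card = 1 := by
      have := Finset.card_pos.2 ⟨v, hvU⟩; omega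
    obtain ⟨u, hu⟩ := Finset.card_eq_one.1 h1
    have : v = u := by rw [hu] at hvU; simpa using hvU
    subst this
    refine hn v hvS hv ?_
    rw [Finset.erase_eq, ← hu, hSU]; exact hRT
  · intro C hCU hCc hT
    rw [hSU] at hT
    exact Finset.Subset.antisymm hCU fun u hu => hC C hCU hCc hT u hu (hatt u hu)
  · rw [Finset.disjoint_left]; intro x hx hx0; exact (Finset.mem_sdiff.1 hx).2 (hR0R hx0)

lemma exists_second_leaf (hK : K3 G) (hW : W.Nonempty) (hWS : ∀ v, v ∈ S ↔ v ∉ W) (hS : TC G S)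
    (hn : Nonext G W S) {U : Finset V} (hU : Leaf G W S U) :
    ∃ U', Leaf G W S U' ∧ Disjoint U' U := by
  obtain ⟨p, hp, q, hq, s, hs, t, ht, hpq, hst, hps, hqt, hends⟩ := hU.ends
  have h3 := hU.tcR.1
  obtain ⟨v, hv, hvs, hvt, hva⟩ : ∃ v ∈ S \ U, v ≠ s ∧ v ≠ t ∧ Att G W v := by
    obtain ⟨x, hx, y, hy, hys, hyt, hxy⟩ := hK (((S \ U).erase s).erase t) (by
      apply Finset.card_pos.1
      rw [Finset.card_erase_of_mem (by simp [hst.symm, Finset.mem_sdiff.1 ht]),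
        Finset.card_erase_of_mem hs]; omega) s t
        ⟨p, by simp [hp], by rintro rfl; simp [hp] at hs, by rintro rfl; simp [hp] at ht⟩
    simp only [Finset.mem_erase] at hx hy
    refine ⟨x, hx.2.2, hx.2.1, hx.1, y, ?_, hxy⟩
    by_contra hyW
    have hyS := (hWS y).2 hyW
    by_cases hyU : y ∈ U
    · rcases hends y hyU x hx.2.2 hxy.symm with h' | h' <;> tauto
    · exact hy ⟨hyt, hys, Finset.mem_sdiff.2 ⟨hyS, hyU⟩⟩
  obtain ⟨Q, hQ, hmin⟩ := Finset.exists_min_image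
    (((S \ U).erase v).powerset.filter fun Q => Cn G Q ∧ s ∈ Q ∧ t ∈ Q) Finset.card
    ⟨(S \ U).erase v, by
      simp only [Finset.mem_filter, Finset.mem_powerset, Finset.mem_erase]
      exact ⟨le_rfl, hU.tcR.erase_cn v, ⟨hvs.symm, hs⟩, hvt.symm, ht⟩⟩
  simp only [Finset.mem_filter, Finset.mem_powerset] at hQ hmin
  obtain ⟨hQR, hQc, hsQ, htQ⟩ := hQ
  have hQU : ∀ x ∈ Q, x ∈ S ∧ x ∉ U := fun x hx => by
    have := hQR hx; simp at this; exact this.2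
  have hX : TC G (U ∪ Q) := by
    refine TC.of_erase ?_ fun x => ?_
    · have : (insert s U).card ≤ (U ∪ Q).card := Finset.card_le_card (by
        intro y hy; simp at hy ⊢; rcases hy with rfl | hy <;> simp [*])
      rw [Finset.card_insert_of_notMem (hQU s hsQ).2] at this
      have := hU.two; omega
    by_cases hxU : x ∈ U
    · refine hQc.of_attach (fun y hy => ?_) fun J hJ hd hne => ?_
      · simp [hy]; rintro rfl; exact (hQU _ hy).2 hxU
      · have hJU : J ⊆ U := fun j hj => by
          have := hJ hj; simp at this
          exact this.2.resolve_right (Finset.disjoint_left.1 hd hj)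
        by_contra hcon
        push Not at hcon
        obtain ⟨u, hu, r, hr, hur⟩ := (hU.tc.hang hU.sub hU.card_rest hJU hne (u := x)
          fun k hk y hy hky => by
            by_contra h'; push Not at h'
            exact hcon k hk y (by simp [h', hy]) h'.1 hky).1
        rcases hends u (hJU hu) r hr hur with ⟨-, rfl⟩ | ⟨-, rfl⟩
        · exact hcon u hu r (by simp [hsQ]; rintro rfl; exact (hQU _ hsQ).2 hxU)
            (fun h => (hQU _ hsQ).2 (hJU h)) hur
        · exact hcon u hu r (by simp [htQ]; rintro rfl; exact (hQU _ htQ).2 hxU)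
            (fun h => (hQU _ htQ).2 (hJU h)) hur
    by_cases hxQ : x ∈ Q
    · refine hU.cn.of_attach (fun y hy => ?_) fun J hJ hd hne => ?_
      · simp [hy]; rintro rfl; exact hxU hy
      · have hJQ : J ⊆ Q := fun j hj => by
          have := hJ hj; simp at this
          exact this.2.resolve_left (Finset.disjoint_left.1 hd hj)
        have hxJ : x ∉ J := fun h => by simpa using hJ h
        by_contra hcon
        push Not at hcon
        have hout : ∀ u ∈ U, u ∈ (U ∪ Q).erase x ∧ u ∉ J := fun u hu =>
          ⟨by simp [hu]; rintro rfl; exact hxU hu, fun h => Finset.disjoint_left.1 hd h hu⟩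
        have hsJ : s ∉ J := fun h => hcon s h p (hout p hp).1 (hout p hp).2 hps.symm
        have htJ : t ∉ J := fun h => hcon t h q (hout q hq).1 (hout q hq).2 hqt.symm
        have := hmin (Q \ J) ⟨Finset.sdiff_subset.trans hQR, hQc.sdiff hxQ hxJ fun j hj y hy hjy => by
          by_contra h'; push Not at h'
          exact hcon j hj y (by simp [h', hy]) h'.1 hjy, by simp [*], by simp [*]⟩
        have h4 := Finset.card_sdiff_add_card_eq_card hJQ
        have := hne.card_pos
        omega
    · rw [Finset.erase_eq_of_notMem (by simp [*])]
      exact hU.cn.union_adj hQc hp hsQ (Or.inr hps)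
  have hv' := Finset.mem_sdiff.1 hv
  obtain ⟨U', hU', hd⟩ := exists_leaf hK hW hWS hS hn hX
    (Finset.union_subset hU.sub fun x hx => (hQU x hx).1) ⟨v, hv'.1, hva, by
      simp [hv'.2]; intro h; simpa using hQR h⟩
  exact ⟨U', hU', Finset.disjoint_of_subset_right Finset.subset_union_left hd⟩

/-- One side of a cut `{v, g}` of `S`, when no smaller `2`-connected set misses an attachment. -/
lemma cut_side (hK : K3 G) (hW : W.Nonempty) (hWS : ∀ v, v ∈ S ↔ v ∉ W) (hS : TC G S)
    (hno : ∀ R ⊆ S, TC G R → ∀ v ∈ S, Att G W v → v ∈ R) {v g : V} (hv : v ∈ S)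
    (hg : g ∈ S) (hvg : v ≠ g) {T1 T2 : Finset V} (hT1 : T1.Nonempty) (hT2 : T2.Nonempty)
    (hmem : ∀ x, x ∈ S ↔ x ∈ T1 ∨ x ∈ T2 ∨ x = v ∨ x = g) (hd : ∀ x ∈ T1, x ∉ T2)
    (hv1 : v ∉ T1) (hv2 : v ∉ T2) (hg1 : g ∉ T1) (hg2 : g ∉ T2)
    (hE : ∀ x ∈ T1, ∀ y ∈ T2, ¬ G.Adj x y) :
    (∀ u ∈ T1, Att G W u ∧ D2 G S u) ∧ Cn G T1 ∧ (∃ a ∈ T1, ∀ y ∈ T1, G.Adj v y ↔ y = a) ∧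
      ∃ a ∈ T1, ∀ y ∈ T1, G.Adj g y ↔ y = a := by
  have hU : T1 ⊆ S := fun x hx => (hmem x).2 (Or.inl hx)
  have hRm : ∀ x, x ∈ S \ T1 ↔ x ∈ T2 ∨ x = v ∨ x = g := fun x => by
    simp only [Finset.mem_sdiff, hmem]
    constructor
    · tauto
    · rintro (h | rfl | rfl)
      · exact ⟨by tauto, fun h' => hd x h' h⟩
      · tauto
      · tauto
  have hR2 : 2 ≤ (S \ T1).card := by
    rw [← Finset.card_pair hvg]; apply Finset.card_le_card
    intro x hx; rw [hRm]; simp at hx; tauto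
  obtain ⟨z1, hz1⟩ := hT1
  obtain ⟨z2, hz2⟩ := hT2
  have hside : ∀ J ⊆ T2, J.Nonempty → ∀ x, x ∉ J → (∀ j ∈ J, ∀ y ∈ S \ T1, G.Adj j y → y ∈ J ∨ y = x) →
      x ∉ T1 → False := by
    intro J hJ hne x hx hcl hxT
    rcases hS.2 J (fun j hj => (hmem j).2 (by right; left; exact hJ hj)) hne x hx (fun j hj y hy hjy => by
      refine hcl j hj y (Finset.mem_sdiff.2 ⟨hy, fun hyT => hE y hyT j (hJ hj) hjy.symm⟩) hjy) z1 (hU hz1) with h | h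
    · exact hd z1 hz1 (hJ h)
    · exact hxT (h ▸ hz1)
  have hRc : Cn G (S \ T1) := by
    refine (Cn.singleton v).of_attach (by simp [hv, hv1]) fun J hJ hdJ hne => ?_
    by_contra hcon
    push Not at hcon
    have hvJ : v ∉ J := fun h => Finset.disjoint_left.1 hdJ h (by simp)
    by_cases hgJ : g ∈ J
    · by_cases hT : ∃ x ∈ T2, x ∈ J
      · obtain ⟨x, hx, hxJ⟩ := hT
        refine hside (J ∩ T2) Finset.inter_subset_right ⟨x, by simp [*]⟩ g (by simp [hg2]) (fun j hj y hy hjy => ?_) hg1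
        simp at hj ⊢
        have hyJ : y ∈ J := by by_contra h'; exact hcon j hj.1 y hy h' hjy
        rcases (hRm y).1 hy with h' | rfl | rfl <;> tauto
      · push Not at hT
        refine hside T2 le_rfl ⟨z2, hz2⟩ v hv2 (fun j hj y hy hjy => ?_) hv1
        rcases (hRm y).1 hy with h' | rfl | rfl
        · tauto
        · tauto
        · exact absurd hjy.symm (hcon y hgJ j ((hRm j).2 (by tauto)) (hT j hj))
    · refine hside J (fun j hj => ?_) hne v hvJ (fun j hj y hy hjy => ?_) hv1
      · rcases (hRm j).1 (hJ hj) with h' | rfl | rfl <;> tauto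
      · by_contra h'
        push Not at h'
        exact hcon j hj y hy h'.1 hjy
  have hnbR : ∀ x ∈ T1, ∀ r ∈ S \ T1, G.Adj x r → r = v ∨ r = g := fun x hx r hr h => by
    rcases (hRm r).1 hr with h' | h'
    · exact absurd h (hE x hx r h')
    · exact h'
  have htwo : ∀ C ⊆ T1, TwoNb G (S \ T1) C → (∃ x ∈ C, G.Adj x v) ∧ ∃ x ∈ C, G.Adj x g := by
    rintro C hC ⟨s, hs, t, ht, hst, ⟨x, hx, h1⟩, y, hy, h2⟩
    rcases hnbR x (hC hx) s hs h1 with rfl | rfl <;> rcases hnbR y (hC hy) t ht h2 with rfl | rfl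
    · exact absurd rfl hst
    · exact ⟨⟨x, hx, h1⟩, y, hy, h2⟩
    · exact ⟨⟨y, hy, h2⟩, x, hx, h1⟩
    · exact absurd rfl hst
  have hC : ∀ C ⊆ T1, Cn G C → TwoNb G (S \ T1) C → ∀ u ∈ T1, Att G W u → u ∈ C := by
    intro C hC hCc hT u hu hua
    obtain ⟨D, hD, hmin⟩ := Finset.exists_min_image
      (C.powerset.filter fun D => Cn G D ∧ TwoNb G (S \ T1) D) Finset.card ⟨C, by simp [hCc, hT]⟩
    simp only [Finset.mem_filter, Finset.mem_powerset] at hD hmin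
    obtain ⟨hDC, hDc, hDT⟩ := hD
    obtain ⟨⟨xv, hxv, hxv'⟩, xg, hxg, hxg'⟩ := htwo D (hDC.trans hC) hDT
    have hX : TC G ((S \ T1) ∪ D) := by
      refine TC.of_erase ?_ fun x => ?_
      · have : (insert xv (S \ T1)).card ≤ ((S \ T1) ∪ D).card := Finset.card_le_card (by
          intro y hy; rw [Finset.mem_insert] at hy; rw [Finset.mem_union]
          rcases hy with rfl | hy
          · exact Or.inr hxv
          · exact Or.inl hy)
        rw [Finset.card_insert_of_notMem (by simp [hC (hDC hxv)])] at this
        omega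
      by_cases hxR : x ∈ S \ T1
      · refine hDc.of_attach (fun y hy => ?_) fun J hJ hdJ hne => ?_
        · simp [hy]; rintro rfl; exact (Finset.mem_sdiff.1 hxR).2 (hC (hDC hy))
        · have hJR : ∀ j ∈ J, j ∈ S \ T1 ∧ j ≠ x := fun j hj => by
            have := hJ hj; rw [Finset.mem_erase, Finset.mem_union] at this
            exact ⟨this.2.resolve_right (Finset.disjoint_left.1 hdJ hj), this.1⟩
          have hD' : ∀ y ∈ D, y ∈ ((S \ T1) ∪ D).erase x ∧ y ∉ J := fun y hy =>
            ⟨by simp [hy]; rintro rfl; exact (Finset.mem_sdiff.1 hxR).2 (hC (hDC hy)),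
              fun h => Finset.disjoint_left.1 hdJ h hy⟩
          by_contra hcon
          push Not at hcon
          have hvJ : v ∉ J := fun h => hcon v h xv (hD' _ hxv).1 (hD' _ hxv).2 hxv'.symm
          have hgJ : g ∉ J := fun h => hcon g h xg (hD' _ hxg).1 (hD' _ hxg).2 hxg'.symm
          refine hside J (fun j hj => ?_) hne x (fun h => (hJR x h).2 rfl) (fun j hj y hy hjy => ?_)
            (Finset.mem_sdiff.1 hxR).2
          · rcases (hRm j).1 (hJR j hj).1 with h' | rfl | rfl <;> tauto
          · by_contra h'
            push Not at h'
            exact hcon j hj y (by rw [Finset.mem_erase, Finset.mem_union]; exact ⟨h'.2, Or.inl hy⟩) h'.1 hjy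
      by_cases hxD : x ∈ D
      · refine hRc.of_attach (fun y hy => ?_) fun J hJ hdJ hne => ?_
        · rw [Finset.mem_erase, Finset.mem_union]; exact ⟨by rintro rfl; exact hxR hy, Or.inl hy⟩
        · have hJD : ∀ j ∈ J, j ∈ D ∧ j ≠ x := fun j hj => by
            have := hJ hj; rw [Finset.mem_erase, Finset.mem_union] at this
            exact ⟨this.2.resolve_left (Finset.disjoint_left.1 hdJ hj), this.1⟩
          by_contra hcon
          push Not at hcon
          have hJn : ∀ j ∈ J, ∀ r ∈ S \ T1, ¬ G.Adj j r := fun j hj r hr h =>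
            hcon j hj r (by rw [Finset.mem_erase, Finset.mem_union]; exact ⟨by rintro rfl; exact hxR hr, Or.inl hr⟩)
              (fun h' => Finset.disjoint_left.1 hdJ h' hr) h
          have := hmin (D \ J) ⟨Finset.sdiff_subset.trans hDC, hDc.sdiff hxD (fun h => (hJD x h).2 rfl)
            fun j hj y hy hjy => by
              by_contra h'; push Not at h'
              exact hcon j hj y (by simp [h', hy]) h'.1 hjy, by
              obtain ⟨s, hs, t, ht, hst, ⟨x, hx, h1⟩, y, hy, h2⟩ := hDT
              exact ⟨s, hs, t, ht, hst, ⟨x, Finset.mem_sdiff.2 ⟨hx, fun h => hJn x h s hs h1⟩, h1⟩, y,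
                Finset.mem_sdiff.2 ⟨hy, fun h => hJn y h t ht h2⟩, h2⟩⟩
          have h4 := Finset.card_sdiff_add_card_eq_card (s := J) (t := D) (fun j hj => (hJD j hj).1)
          have := hne.card_pos
          omega
      · rw [Finset.erase_eq_of_notMem (by rw [Finset.mem_union]; tauto)]
        exact hRc.union_adj hDc ((hRm v).2 (by tauto)) hxv (Or.inr hxv'.symm)
    have := hno _ (Finset.union_subset Finset.sdiff_subset (hDC.trans (hC.trans hU))) hX u (hU hu) hua
    rw [Finset.mem_union] at this
    rcases this with h | h
    · exact absurd hu (Finset.mem_sdiff.1 h).2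
    · exact hDC h
  obtain ⟨u0, hu0, hu0a⟩ : ∃ u ∈ T1, Att G W u := by
    obtain ⟨x, hx, y, hy, hyv, hyg, h⟩ := hK T1 ⟨z1, hz1⟩ v g ⟨z2, fun h => hd _ h hz2,
      by rintro rfl; exact hv2 hz2, by rintro rfl; exact hg2 hz2⟩
    refine ⟨x, hx, y, ?_, h⟩
    by_contra hyW
    rcases (hmem y).1 ((hWS y).2 hyW) with h' | h' | h' | h'
    · exact hy h'
    · exact hE x hx y h' h
    · exact hyv h'
    · exact hyg h'
  have hatt := core_att hS hU hR2 hK hW hWS hC ⟨u0, hu0, hu0a⟩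
  have hM : ∀ C ⊆ T1, Cn G C → TwoNb G (S \ T1) C → C = T1 := fun C hCU hCc hT =>
    Finset.Subset.antisymm hCU fun u hu => hC C hCU hCc hT u hu (hatt u hu)
  have hcn := core_cn hS hU hR2 hM ⟨z1, hz1⟩
  obtain ⟨⟨xv, hxv, hxv'⟩, xg, hxg, hxg'⟩ := htwo T1 le_rfl (hS.twoNb_sub hU hR2 ⟨z1, hz1⟩)
  refine ⟨fun u hu => ⟨hatt u hu, fun a ha b hb c hc h1 h2 h3 => ?_⟩, hcn, ?_⟩
  · by_contra hcon
    push Not at hcon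
    have := core_deg hS hU hR2 hM hcn hu ha hb hc hcon.1 hcon.2.1 hcon.2.2 h1 h2 h3
    have key : ∀ a ∈ S, G.Adj u a → a = v ∨ a = g := fun a ha h => hnbR u hu a (Finset.mem_sdiff.2
      ⟨ha, fun h' => by rw [this] at h'; simp at h'; exact h.ne h'.symm⟩) h
    have := key a ha h1
    have := key b hb h2
    have := key c hc h3
    grind
  · have hvR : v ∈ S \ T1 := (hRm v).2 (by tauto)
    have hgR : g ∈ S \ T1 := (hRm g).2 (by tauto)
    by_cases h2 : 2 ≤ T1.card
    · obtain ⟨p, hp, q, hq, s, hs, t, ht, hpq, hst, hps, hqt, hends⟩ := core_ends hS hU hR2 hM hcn h2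
      constructor
      · refine ⟨xv, hxv, fun y hy => ⟨fun h => ?_, fun h => h ▸ hxv'.symm⟩⟩
        have := hends y hy v hvR h.symm
        have := hends xv hxv v hvR hxv'
        grind
      · refine ⟨xg, hxg, fun y hy => ⟨fun h => ?_, fun h => h ▸ hxg'.symm⟩⟩
        have := hends y hy g hgR h.symm
        have := hends xg hxg g hgR hxg'
        grind
    · have : T1.card = 1 := by have := Finset.card_pos.2 ⟨z1, hz1⟩; omega
      obtain ⟨w, rfl⟩ := Finset.card_eq_one.1 this
      simp at hxv hxg
      rw [hxv] at hxv'; rw [hxg] at hxg'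
      exact ⟨⟨w, by simp, by simp [hxv'.symm]⟩, ⟨w, by simp, by simp [hxg'.symm]⟩⟩

lemma leaves_or_cycle (hK : K3 G) (hW : W.Nonempty) (hWS : ∀ v, v ∈ S ↔ v ∉ W) (hS : TC G S)
    (h4 : 4 ≤ S.card) (hn : Nonext G W S) :
    (∃ U1 U2, Leaf G W S U1 ∧ Leaf G W S U2 ∧ Disjoint U1 U2) ∨ ∀ x ∈ S, Att G W x ∧ D2 G S x := by
  by_cases hno : ∃ R ⊆ S, TC G R ∧ ∃ v ∈ S, Att G W v ∧ v ∉ R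
  · obtain ⟨R, hRS, hR, hv⟩ := hno
    obtain ⟨U, hU, -⟩ := exists_leaf hK hW hWS hS hn hR hRS hv
    obtain ⟨U', hU', hd⟩ := exists_second_leaf hK hW hWS hS hn hU
    exact Or.inl ⟨U', U, hU', hU, hd⟩
  right
  replace hno : ∀ R ⊆ S, TC G R → ∀ v ∈ S, Att G W v → v ∈ R := by
    intro R hRS hR v hv hva
    by_contra h
    exact hno ⟨R, hRS, hR, v, hv, hva, h⟩
  obtain ⟨v, hv, hva⟩ : ∃ v ∈ S, Att G W v := by
    obtain ⟨w, hw⟩ := hW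
    obtain ⟨z, hz⟩ := hS.cn.1
    have hwS : w ∉ S := fun h => (hWS w).1 h hw
    obtain ⟨x, hx, y, hy, -, -, hxy⟩ := hK S ⟨z, hz⟩ z z ⟨w, hwS, by rintro rfl; exact hwS hz,
      by rintro rfl; exact hwS hz⟩
    refine ⟨x, hx, y, ?_, hxy⟩
    by_contra h; exact hy ((hWS y).2 h)
  obtain ⟨g, hg⟩ : ∃ g, ¬ Cn G ((S.erase v).erase g) := by
    by_contra hcon
    push Not at hcon
    exact hn v hv hva (TC.of_erase (by rw [Finset.card_erase_of_mem hv]; omega) hcon)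
  have hgS : g ∈ S.erase v := by
    by_contra h; rw [Finset.erase_eq_of_notMem h] at hg; exact hg (hS.erase_cn v)
  obtain ⟨T1, hT1s, hT1n, hcl, y, hy, hyT⟩ : ∃ J ⊆ (S.erase v).erase g, J.Nonempty ∧
      (∀ x ∈ J, ∀ y ∈ (S.erase v).erase g, G.Adj x y → y ∈ J) ∧ ∃ y ∈ (S.erase v).erase g, y ∉ J := by
    by_contra hcon
    push Not at hcon
    refine hg ⟨Finset.card_pos.1 ?_, hcon⟩
    rw [Finset.card_erase_of_mem hgS, Finset.card_erase_of_mem hv]; omega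
  set T2 := (S.erase v).erase g \ T1 with hT2
  simp at hgS
  obtain ⟨hgv, hgS⟩ := hgS
  replace hgv : g ≠ v := hgv
  have hmem1 : ∀ x, x ∈ T1 → x ∈ S ∧ x ≠ v ∧ x ≠ g := fun x hx => by
    have := hT1s hx; simp at this; tauto
  have hmem2 : ∀ x, x ∈ T2 ↔ x ∈ S ∧ x ≠ v ∧ x ≠ g ∧ x ∉ T1 := fun x => by simp [hT2]; tauto
  have hT2n : T2.Nonempty := ⟨y, by simp only [hT2, Finset.mem_sdiff]; exact ⟨hy, hyT⟩⟩
  have hE : ∀ x ∈ T1, ∀ y ∈ T2, ¬ G.Adj x y := fun x hx y hy h => by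
    have := (hmem2 y).1 hy
    exact this.2.2.2 (hcl x hx y (by simp [this]) h)
  have hv1 : v ∉ T1 := fun h => (hmem1 v h).2.1 rfl
  have hg1 : g ∉ T1 := fun h => (hmem1 g h).2.2 rfl
  have hv2 : v ∉ T2 := fun h => ((hmem2 v).1 h).2.1 rfl
  have hg2 : g ∉ T2 := fun h => ((hmem2 g).1 h).2.2.1 rfl
  have hmem : ∀ x, x ∈ S ↔ x ∈ T1 ∨ x ∈ T2 ∨ x = v ∨ x = g := fun x => by
    constructor
    · intro hx; rw [hmem2]; tauto
    · rintro (h | h | rfl | rfl)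
      · exact (hmem1 x h).1
      · exact ((hmem2 x).1 h).1
      · exact hv
      · exact hgS
  obtain ⟨hA1, hc1, ⟨a1, ha1, hva1⟩, b1, hb1, hgb1⟩ := cut_side hK hW hWS hS hno hv hgS hgv.symm hT1n hT2n
    hmem (fun x h h' => ((hmem2 x).1 h').2.2.2 h) hv1 hv2 hg1 hg2 hE
  obtain ⟨hA2, hc2, ⟨a2, ha2, hva2⟩, b2, hb2, hgb2⟩ := cut_side hK hW hWS hS hno hv hgS hgv.symm hT2n hT1n
    (fun x => by rw [hmem]; tauto) (fun x h' h => ((hmem2 x).1 h').2.2.2 h) hv2 hv1 hg2 hg1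
    (fun x hx y hy h => hE y hy x hx h.symm)
  have hnvg : ¬ G.Adj v g := by
    intro hvg
    have hX : TC G (insert v (insert g T1)) := by
      have hve : v ∉ insert g T1 := by simp [hv1, hgv.symm]
      refine TC.of_erase ?_ fun x => ?_
      · rw [Finset.card_insert_of_notMem hve, Finset.card_insert_of_notMem hg1]
        have := hT1n.card_pos; omega
      by_cases hxv : x = v
      · rw [hxv, Finset.erase_insert hve]
        exact hc1.insert_adj hb1 ((hgb1 b1 hb1).2 rfl).symm
      by_cases hxg : x = g
      · rw [hxg, Finset.insert_comm, Finset.erase_insert (by simp [hg1, hgv])]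
        exact hc1.insert_adj ha1 ((hva1 a1 ha1).2 rfl).symm
      refine (Cn.pair hvg).of_attach (by intro z hz; simp at hz ⊢; grind) fun J hJ hdJ hne => ?_
      have hvJ : v ∉ J := fun h => Finset.disjoint_left.1 hdJ h (by simp)
      have hgJ : g ∉ J := fun h => Finset.disjoint_left.1 hdJ h (by simp)
      have hJT : ∀ j ∈ J, j ∈ T1 ∧ j ≠ x := fun j hj => by have := hJ hj; simp at this; grind
      by_contra hcon
      push Not at hcon
      obtain ⟨z2, hz2⟩ := hT2n
      by_cases hxT : x ∈ T1
      · rcases hS.2 J (fun j hj => (hmem1 j (hJT j hj).1).1) hne x (fun h => (hJT x h).2 rfl)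
          (fun j hj z hz hjz => by
            by_contra h'; push Not at h'
            rcases (hmem z).1 hz with h'' | h'' | rfl | rfl
            · exact hcon j hj z (by simp [*]) h'.1 hjz
            · exact hE j (hJT j hj).1 z h'' hjz
            · exact hcon j hj z (by simp [h'.2]) h'.1 hjz
            · exact hcon j hj z (by simp [h'.2]) h'.1 hjz) v hv with h' | h'
        · exact hvJ h'
        · exact hxv h'.symm
      · have := hS.cn.2 J (fun j hj => (hmem1 j (hJT j hj).1).1) hne
          (fun j hj z hz hjz => by
            by_contra h'
            have hzx : z ≠ x := by
              rintro rfl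
              rcases (hmem z).1 hz with h'' | h'' | rfl | rfl
              · exact hxT h''
              · exact hE j (hJT j hj).1 z h'' hjz
              · exact hxv rfl
              · exact hxg rfl
            rcases (hmem z).1 hz with h'' | h'' | rfl | rfl
            · exact hcon j hj z (by simp [*]) h' hjz
            · exact hE j (hJT j hj).1 z h'' hjz
            · exact hcon j hj z (by simp [hzx]) h' hjz
            · exact hcon j hj z (by simp [hzx]) h' hjz) v hv
        exact hvJ this
    have h2S := ((hmem2 a2).1 ha2)
    have := hno _ (by
      intro z hz; simp at hz
      rcases hz with rfl | rfl | hz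
      · exact hv
      · exact hgS
      · exact (hmem1 z hz).1) hX a2 h2S.1 (hA2 a2 ha2).1
    simp [h2S] at this
  have key : ∀ x, (x ∈ T1 ∨ x ∈ T2 ∨ x = v ∨ x = g) → G.Adj v x → x = a1 ∨ x = a2 := by
    rintro x (h | h | rfl | rfl) h'
    · exact Or.inl ((hva1 x h).1 h')
    · exact Or.inr ((hva2 x h).1 h')
    · exact absurd h' (G.irrefl)
    · exact absurd h' hnvg
  have key' : ∀ x, (x ∈ T1 ∨ x ∈ T2 ∨ x = v ∨ x = g) → G.Adj g x → x = b1 ∨ x = b2 := by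
    rintro x (h | h | rfl | rfl) h'
    · exact Or.inl ((hgb1 x h).1 h')
    · exact Or.inr ((hgb2 x h).1 h')
    · exact absurd h'.symm hnvg
    · exact absurd h' (G.irrefl)
  intro x hx
  rcases (hmem x).1 hx with h | h | rfl | rfl
  · exact hA1 x h
  · exact hA2 x h
  · refine ⟨hva, fun a ha b hb c hc h1 h2 h3 => ?_⟩
    have := key a ((hmem a).1 ha) h1
    have := key b ((hmem b).1 hb) h2
    have := key c ((hmem c).1 hc) h3
    grind
  · refine ⟨?_, fun a ha b hb c hc h1 h2 h3 => ?_⟩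
    · obtain ⟨z, hz, y, hy, hyb1, hyb2, h⟩ := hK {x} (by simp) b1 b2 ⟨v, by simpa using hgv.symm,
        by rintro rfl; exact hv1 hb1, by rintro rfl; exact hv2 hb2⟩
      simp at hz; subst hz
      refine ⟨y, ?_, h⟩
      by_contra hyW
      rcases key' y ((hmem y).1 ((hWS y).2 hyW)) h with h' | h' <;> tauto
    have := key' a ((hmem a).1 ha) h1
    have := key' b ((hmem b).1 hb) h2
    have := key' c ((hmem c).1 hc) h3
    grind

end

/-- `G` has no `4`-contractible set. -/
def N4 (G : SimpleGraph V) : Prop :=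
  ∀ W S : Finset V, W.card = 4 → Cn G W → (∀ v, v ∈ S ↔ v ∉ W) → ¬ TC G S

/-- `G` is triangle-free. -/
def TF (G : SimpleGraph V) : Prop := ∀ a b c, G.Adj a b → G.Adj b c → G.Adj a c → False

lemma D2.mono {S T : Finset V} {x : V} (h : D2 G S x) (hTS : T ⊆ S) : D2 G T x :=
  fun a ha b hb c hc => h a (hTS ha) b (hTS hb) c (hTS hc)

lemma K3.exists_nbr [Fintype V] (hK : K3 G) (hV : 4 ≤ Fintype.card V) (x a b : V) :
    ∃ y, y ≠ a ∧ y ≠ b ∧ G.Adj x y := by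
  obtain ⟨z, hz⟩ : ∃ z, z ∉ ({x, a, b} : Finset V) := by
    by_contra hcon
    push Not at hcon
    have h1 := Finset.card_le_card (show (Finset.univ : Finset V) ⊆ {x, a, b} from fun z _ => hcon z)
    have h2 := Finset.card_le_three (a := x) (b := a) (c := b)
    rw [Finset.card_univ] at h1; omega
  simp at hz
  obtain ⟨x', hx', y, hy, hya, hyb, h⟩ := hK {x} (by simp) a b ⟨z, by simp [hz], hz.2.1, hz.2.2⟩
  simp at hx'; subst hx'
  exact ⟨y, hya, hyb, h⟩

lemma exists_mem_avoid {B : Finset V} (hB : 3 ≤ B.card) (a b : V) : ∃ y ∈ B, y ≠ a ∧ y ≠ b := by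
  by_contra hcon
  push Not at hcon
  have h1 := Finset.card_le_card (show B ⊆ {a, b} from fun z hz => by
    have := hcon z hz; simp; tauto)
  have := h1.trans Finset.card_le_two
  omega

/-- In a `3`-connected graph a set has two neighbours besides a given vertex `c`. -/
lemma K3.twoNb (hK : K3 G) {J S B : Finset V} (hne : J.Nonempty) (hB : 3 ≤ B.card)
    (hBJ : Disjoint B J) (c : V) (hcl : ∀ x ∈ J, ∀ y, y ∉ J → G.Adj x y → y ∈ S ∨ y = c) :
    TwoNb G (S \ J) J := by
  obtain ⟨y, hy, hya, hyb⟩ := exists_mem_avoid hB c c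
  obtain ⟨x1, hx1, y1, hy1, h1c, -, h1⟩ := hK J hne c c ⟨y, Finset.disjoint_left.1 hBJ hy, hya, hyb⟩
  obtain ⟨y', hy', hya', hyb'⟩ := exists_mem_avoid hB c y1
  obtain ⟨x2, hx2, y2, hy2, h2c, h21, h2⟩ :=
    hK J hne c y1 ⟨y', Finset.disjoint_left.1 hBJ hy', hya', hyb'⟩
  exact ⟨y1, Finset.mem_sdiff.2 ⟨(hcl x1 hx1 y1 hy1 h1).resolve_right h1c, hy1⟩, y2,
    Finset.mem_sdiff.2 ⟨(hcl x2 hx2 y2 hy2 h2).resolve_right h2c, hy2⟩, h21.symm, ⟨x1, hx1, h1⟩, x2, hx2, h2⟩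

lemma N4.nonext (h4 : N4 G) {W S : Finset V} (hW : Cn G W) (h3 : W.card = 3)
    (hWS : ∀ v, v ∈ S ↔ v ∉ W) : Nonext G W S := by
  rintro v hv ⟨w, hw, hvw⟩ hT
  refine h4 (insert v W) (S.erase v) ?_ (hW.insert_adj hw hvw.symm) (fun x => ?_) hT
  · rw [Finset.card_insert_of_notMem ((hWS v).1 hv)]; omega
  · simp [hWS]

lemma Leaf.disjoint_chain {W S U P : Finset V} (hU : Leaf G W S U) (hP : Cn G P) (hPS : P ⊆ S)
    (hd : ∀ x ∈ P, D2 G S x) (h : ¬ Disjoint U P) : P ⊆ U := by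
  rw [Finset.not_disjoint_iff] at h
  obtain ⟨x, hxU, hxP⟩ := h
  intro y hy
  have := hP.2 (P ∩ U) Finset.inter_subset_left ⟨x, by simp [*]⟩ (fun a ha b hb hab => by
    simp at ha ⊢
    exact ⟨hb, hU.mem_of_adj ha.2 (hPS hb) hab (hd b hb)⟩) y hy
  simp at this; exact this.2

/-- Of two disjoint leaves one avoids a given chain of vertices of degree two. -/
lemma exists_leaf_disjoint {W S P U1 U2 : Finset V} (h1 : Leaf G W S U1) (h2 : Leaf G W S U2)
    (hd12 : Disjoint U1 U2) (hP : Cn G P) (hPS : P ⊆ S) (hd : ∀ x ∈ P, D2 G S x) :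
    ∃ U, Leaf G W S U ∧ Disjoint U P := by
  by_cases hU1 : Disjoint U1 P
  · exact ⟨U1, h1, hU1⟩
  · exact ⟨U2, h2, (Finset.disjoint_of_subset_left (h1.disjoint_chain hP hPS hd hU1) hd12).symm⟩

lemma TC.triangle {a b c : V} (hab : G.Adj a b) (hbc : G.Adj b c) (hac : G.Adj a c) :
    TC G {a, b, c} := by
  refine TC.of_erase ?_ fun x => ?_
  · rw [Finset.card_eq_three.2 ⟨a, b, c, hab.ne, hac.ne, hbc.ne, rfl⟩]
  have h1 := hab.ne
  have h2 := hbc.ne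
  have h3 := hac.ne
  have e := (Cn.pair hab).insert_adj (y := c) (x := b) (by simp) hbc
  by_cases hx : x = a
  · rw [show ({a, b, c} : Finset V).erase x = {b, c} by ext z; simp; grind]; exact Cn.pair hbc
  by_cases hx' : x = b
  · rw [show ({a, b, c} : Finset V).erase x = {a, c} by ext z; simp; grind]; exact Cn.pair hac
  by_cases hx'' : x = c
  · rw [show ({a, b, c} : Finset V).erase x = {a, b} by ext z; simp; grind]; exact Cn.pair hab
  rw [show ({a, b, c} : Finset V).erase x = insert c {a, b} by ext z; simp; grind]; exact e

lemma Cn.path3 {a b c : V} (hab : G.Adj a b) (hbc : G.Adj b c) : Cn G {a, b, c} :=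
  (Cn.pair hbc).insert_adj (by simp) hab.symm

lemma Cn.path4 {a b c d : V} (hab : G.Adj a b) (hbc : G.Adj b c) (hcd : G.Adj c d) :
    Cn G {a, b, c, d} :=
  (Cn.path3 hbc hcd).insert_adj (by simp) hab.symm

lemma Cn.path5 {a b c d e : V} (hab : G.Adj a b) (hbc : G.Adj b c) (hcd : G.Adj c d)
    (hde : G.Adj d e) : Cn G {a, b, c, d, e} :=
  (Cn.path4 hbc hcd hde).insert_adj (by simp) hab.symm

lemma Cn.path6 {a b c d e f : V} (hab : G.Adj a b) (hbc : G.Adj b c) (hcd : G.Adj c d)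
    (hde : G.Adj d e) (hef : G.Adj e f) : Cn G {a, b, c, d, e, f} :=
  (Cn.path5 hbc hcd hde hef).insert_adj (by simp) hab.symm

lemma TC.cycle4 {a b c d : V} (hab : G.Adj a b) (hbc : G.Adj b c) (hcd : G.Adj c d)
    (hda : G.Adj d a) (hac : a ≠ c) (hbd : b ≠ d) : TC G {a, b, c, d} := by
  have := hab.ne
  have := hbc.ne
  have := hcd.ne
  have := hda.ne
  refine TC.of_erase ?_ fun x => ?_
  · rw [Finset.card_insert_of_notMem (by simp; grind), Finset.card_eq_three.2 ⟨b, c, d, by grind, hbd, by grind, rfl⟩]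
    omega
  by_cases h : x ∈ ({a, b, c, d} : Finset V)
  · simp only [Finset.mem_insert, Finset.mem_singleton] at h
    rcases h with rfl | rfl | rfl | rfl
    · convert Cn.path3 hbc hcd using 1; ext z; simp; grind
    · convert Cn.path3 hcd hda using 1; ext z; simp; grind
    · convert Cn.path3 hda hab using 1; ext z; simp; grind
    · convert Cn.path3 hab hbc using 1; ext z; simp; grind
  · rw [Finset.erase_eq_of_notMem h]; exact Cn.path4 hab hbc hcd

lemma TC.cycle5 {a b c d e : V} (hab : G.Adj a b) (hbc : G.Adj b c) (hcd : G.Adj c d)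
    (hde : G.Adj d e) (hea : G.Adj e a) (hn : [a, b, c, d, e].Nodup) : TC G {a, b, c, d, e} := by
  simp at hn
  refine TC.of_erase ?_ fun x => ?_
  · refine le_trans ?_ (Finset.card_le_card (show ({a, b, c} : Finset V) ⊆ _ from fun z hz => by
      simp at hz ⊢; tauto))
    rw [Finset.card_eq_three.2 ⟨a, b, c, by grind, by grind, by grind, rfl⟩]
  by_cases h : x ∈ ({a, b, c, d, e} : Finset V)
  · simp only [Finset.mem_insert, Finset.mem_singleton] at h
    rcases h with rfl | rfl | rfl | rfl | rfl
    · convert Cn.path4 hbc hcd hde using 1; ext z; simp; grind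
    · convert Cn.path4 hcd hde hea using 1; ext z; simp; grind
    · convert Cn.path4 hde hea hab using 1; ext z; simp; grind
    · convert Cn.path4 hea hab hbc using 1; ext z; simp; grind
    · convert Cn.path4 hab hbc hcd using 1; ext z; simp; grind
  · rw [Finset.erase_eq_of_notMem h]; exact Cn.path5 hab hbc hcd hde

lemma TC.cycle6 {a b c d e f : V} (hab : G.Adj a b) (hbc : G.Adj b c) (hcd : G.Adj c d)
    (hde : G.Adj d e) (hef : G.Adj e f) (hfa : G.Adj f a) (hn : [a, b, c, d, e, f].Nodup) :
    TC G {a, b, c, d, e, f} := by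
  simp at hn
  refine TC.of_erase ?_ fun x => ?_
  · refine le_trans ?_ (Finset.card_le_card (show ({a, b, c} : Finset V) ⊆ _ from fun z hz => by
      simp at hz ⊢; tauto))
    rw [Finset.card_eq_three.2 ⟨a, b, c, by grind, by grind, by grind, rfl⟩]
  by_cases h : x ∈ ({a, b, c, d, e, f} : Finset V)
  · simp only [Finset.mem_insert, Finset.mem_singleton] at h
    rcases h with rfl | rfl | rfl | rfl | rfl | rfl
    · convert Cn.path5 hbc hcd hde hef using 1; ext z; simp; grind
    · convert Cn.path5 hcd hde hef hfa using 1; ext z; simp; grind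
    · convert Cn.path5 hde hef hfa hab using 1; ext z; simp; grind
    · convert Cn.path5 hef hfa hab hbc using 1; ext z; simp; grind
    · convert Cn.path5 hfa hab hbc hcd using 1; ext z; simp; grind
    · convert Cn.path5 hab hbc hcd hde using 1; ext z; simp; grind
  · rw [Finset.erase_eq_of_notMem h]; exact Cn.path6 hab hbc hcd hde hef

/-- A vertex of degree at most two in `S` blocks deleting its neighbours. -/
lemma D2.not_tc_erase {S : Finset V} {x y : V} (hx : D2 G S x) (hxS : x ∈ S) (hy : y ∈ S)
    (hxy : G.Adj x y) : ¬ TC G (S.erase y) := by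
  intro hT
  obtain ⟨a, ha, b, hb, hab, h1, h2⟩ := hT.two_nbrs (x := x) (by simp [hxS, hxy.ne])
  simp at ha hb
  have := hx a ha.2 b hb.2 y hy h1 h2 hxy
  grind

lemma univ_tc_erase [Fintype V] (hK : K3 G) (hV : 4 ≤ Fintype.card V) (v : V) :
    TC G (Finset.univ.erase v) := by
  refine ⟨by rw [Finset.card_erase_of_mem (by simp), Finset.card_univ]; omega,
    fun J hJ hne x hx hcl y hy => ?_⟩
  by_contra hcon
  push Not at hcon
  obtain ⟨a, ha, z, hz, hzv, hzx, h⟩ := hK J hne v x ⟨y, hcon.1, by simpa using hy, hcon.2⟩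
  rcases hcl a ha z (by simp [hzv]) h with h' | h' <;> tauto

/-- A leaf of a single vertex yields a triangle. -/
lemma Leaf.exists_edge {W S U : Finset V} (h : Leaf G W S U) : ∃ x ∈ U, ∃ y ∈ U, G.Adj x y := by
  obtain ⟨x, hx⟩ := h.cn.1
  obtain ⟨y, hy, hxy⟩ := h.cn.exists_nbr hx h.two
  exact ⟨x, hx, y, hy, hxy⟩

lemma TC.other_nbr {S : Finset V} (hS : TC G S) {x : V} (hx : x ∈ S) (a : V) :
    ∃ y ∈ S, y ≠ a ∧ G.Adj x y := by
  obtain ⟨y, hy, z, hz, hyz, h1, h2⟩ := hS.two_nbrs hx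
  by_cases h : y = a
  · exact ⟨z, hz, fun h' => hyz (h.trans h'.symm), h2⟩
  · exact ⟨y, hy, h, h1⟩

lemma Cn.adj_of_card_two {W : Finset V} (hW : Cn G W) (h2 : W.card = 2) :
    ∃ a b, W = {a, b} ∧ G.Adj a b := by
  obtain ⟨a, b, hab, rfl⟩ := Finset.card_eq_two.1 h2
  obtain ⟨y, hy, h⟩ := hW.exists_nbr (x := a) (by simp) (by omega)
  simp at hy
  rcases hy with rfl | rfl
  · exact absurd h (G.loopless.irrefl _)
  · exact ⟨_, _, rfl, h⟩

lemma Cn.path_of_card_three {W : Finset V} (hW : Cn G W) (h3 : W.card = 3) :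
    ∃ a b c, W = {a, b, c} ∧ G.Adj a b ∧ G.Adj b c ∧ a ≠ c := by
  obtain ⟨a, b, c, hab, hac, hbc, rfl⟩ := Finset.card_eq_three.1 h3
  obtain ⟨y, hy, h⟩ := hW.exists_nbr (x := a) (by simp) (by omega)
  obtain ⟨z, hz, h'⟩ := hW.exists_nbr (x := b) (by simp) (by omega)
  obtain ⟨t, ht, h''⟩ := hW.exists_nbr (x := c) (by simp) (by omega)
  simp at hy hz ht
  have e1 : ({a, b, c} : Finset V) = {b, a, c} := Finset.insert_comm _ _ _
  have e2 : ({a, b, c} : Finset V) = {a, c, b} := by rw [Finset.pair_comm]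
  have y' := h.ne'
  have z' := h'.ne'
  have t' := h''.ne'
  by_cases h1 : G.Adj a b
  · by_cases h2 : G.Adj b c
    · exact ⟨a, b, c, rfl, h1, h2, hac⟩
    · refine ⟨b, a, c, e1, h1.symm, ?_, hbc⟩
      rcases ht with rfl | rfl | rfl
      · exact h''.symm
      · exact absurd h''.symm h2
      · exact absurd rfl t'
  · have hac' : G.Adj a c := by
      rcases hy with rfl | rfl | rfl
      · exact absurd rfl y'
      · exact absurd h h1
      · exact h
    refine ⟨a, c, b, e2, hac', ?_, hab⟩
    rcases hz with rfl | rfl | rfl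
    · exact absurd h'.symm h1
    · exact absurd rfl z'
    · exact h'.symm

lemma disjoint_of_nodup {l1 l2 : List V} (h : (l1 ++ l2).Nodup) :
    Disjoint l2.toFinset l1.toFinset := by
  rw [Finset.disjoint_left]
  intro x hx hx'
  simp at hx hx'
  exact (List.nodup_append.1 h).2.2 x hx' x hx rfl

lemma exists_max_contractible [Fintype V] (hK : K3 G) (h4 : N4 G) (hV : 4 ≤ Fintype.card V) :
    ∃ W S, Cn G W ∧ W.card ≤ 3 ∧ (∀ v, v ∈ S ↔ v ∉ W) ∧ TC G S ∧ Nonext G W S := by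
  have hne : Nonempty V := Fintype.card_pos_iff.1 (by omega)
  obtain ⟨v⟩ := hne
  obtain ⟨W, hW, hmax⟩ := Finset.exists_max_image
    (Finset.univ.filter fun W : Finset V => Cn G W ∧ W.card ≤ 3 ∧ TC G Wᶜ) Finset.card
    ⟨{v}, by
      have := univ_tc_erase hK hV v
      rw [← Finset.compl_singleton] at this
      simp [Cn.singleton, this]⟩
  simp only [Finset.mem_filter, Finset.mem_univ, true_and] at hW hmax
  obtain ⟨hW, h3, hT⟩ := hW
  refine ⟨W, Wᶜ, hW, h3, by simp, hT, ?_⟩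
  by_cases h : W.card = 3
  · exact h4.nonext hW h (by simp)
  rintro x hx ⟨w, hw, hxw⟩ hT'
  simp at hx
  have := hmax (insert x W) ⟨hW.insert_adj hw hxw.symm, by
    rw [Finset.card_insert_of_notMem hx]; omega, by
    rwa [Finset.compl_insert]⟩
  rw [Finset.card_insert_of_notMem hx] at this
  omega

/-- Removing three consecutive vertices of a cycle. -/
lemma cycle_sdiff_cn (hT : TF G) {S : Finset V} (hS : TC G S) (hd : ∀ x ∈ S, D2 G S x)
    {h0 h1 h2 : V} (m0 : h0 ∈ S) (m1 : h1 ∈ S) (m2 : h2 ∈ S) (h02 : h0 ≠ h2)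
    (a0 : G.Adj h1 h0) (a2 : G.Adj h1 h2) : Cn G (S \ {h0, h1, h2}) := by
  obtain ⟨x, hx, hx1, hx0⟩ := hS.other_nbr m0 h1
  obtain ⟨y, hy, hy1, hy2⟩ := hS.other_nbr m2 h1
  have e0 : Cn G (S.erase h1 \ {h0}) := by
    refine (hS.erase_cn h1).sdiff (x := x) (by simp [hx, hx1]) (by simpa using hx0.ne') ?_
    intro j hj z hz hjz
    simp at hj hz; subst hj
    have := hd j m0 z hz.2 x hx h1 m1 hjz hx0 a0.symm
    tauto
  have e1 : Cn G ((S.erase h1 \ {h0}) \ {h2}) := by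
    refine e0.sdiff (x := y) ?_ (by simpa using hy2.ne') ?_
    · simp [hy, hy1]; rintro rfl
      exact hT _ _ _ a0 hy2.symm a2
    intro j hj z hz hjz
    simp at hj hz; subst hj
    have := hd j m2 z hz.1.2 y hy h1 m1 hjz hy2 a2.symm
    tauto
  convert e1 using 1
  ext z; simp; tauto

lemma four_le_card {Z : Finset V} {a b c d : V} (hn : [a, b, c, d].Nodup)
    (h : ∀ x, x = a ∨ x = b ∨ x = c ∨ x = d → x ∈ Z) : 4 ≤ Z.card := by
  have h1 := Finset.card_le_card (show [a, b, c, d].toFinset ⊆ Z from fun x hx => h x (by simpa using hx))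
  rw [List.toFinset_card_of_nodup hn] at h1
  simpa using h1

lemma card_sdiff_triple_ge {S : Finset V} {k : ℕ} (h : k + 3 ≤ S.card) (a b c : V) :
    k ≤ (S \ {a, b, c}).card := by
  have h1 := Finset.le_card_sdiff ({a, b, c} : Finset V) S
  have h2 := Finset.card_le_three (a := a) (b := b) (c := c)
  omega

lemma exists_block [Fintype V] (hK : K3 G) (hT : TF G) (h4 : N4 G) (hV : 8 ≤ Fintype.card V) :
    ∃ B Z, TC G B ∧ Cn G Z ∧ Disjoint Z B ∧ 4 ≤ Z.card := by
  obtain ⟨W, S, hW, h3, hWS, hS, hn⟩ := exists_max_contractible hK h4 (by omega)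
  have hcard : W.card + S.card = Fintype.card V := by
    have : S = Wᶜ := by ext; simp [hWS]
    rw [this, Finset.card_add_card_compl]
  have hW1 : 2 ≤ W.card ∨ ∃ w, W = {w} := by
    have := Finset.card_pos.2 hW.1
    rcases (by omega : 2 ≤ W.card ∨ W.card = 1) with h | h
    · exact Or.inl h
    · exact Or.inr (Finset.card_eq_one.1 h)
  have hone : ∀ w, W = {w} → ∀ x y, Att G W x → Att G W y → ¬ G.Adj x y := by
    rintro w rfl x y ⟨a, ha, hx⟩ ⟨b, hb, hy⟩ hxy
    simp at ha hb; subst ha; subst hb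
    exact hT _ _ _ hxy hy hx
  rcases leaves_or_cycle hK hW.1 hWS hS (by omega) hn with ⟨F, -, hF, -, -⟩ | hc
  · rcases hW1 with hW1 | ⟨w, rfl⟩
    · have hd : Disjoint W F := Finset.disjoint_left.2 fun x hx hx' => (hWS x).1 (hF.sub hx') hx
      refine ⟨S \ F, W ∪ F, hF.tcR, ?_, ?_, ?_⟩
      · obtain ⟨x, hx⟩ := hF.cn.1
        obtain ⟨w, hw, hxw⟩ := hF.att x hx
        exact hW.union_adj hF.cn hw hx (Or.inr hxw.symm)
      · rw [Finset.disjoint_left]; intro x hx hx'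
        simp [hWS] at hx hx'; tauto
      · rw [Finset.card_union_of_disjoint hd]; have := hF.two; omega
    · obtain ⟨x, hx, y, hy, hxy⟩ := hF.exists_edge
      exact absurd hxy (hone w rfl x y (hF.att x hx) (hF.att y hy))
  have hd : ∀ x ∈ S, D2 G S x := fun x hx => (hc x hx).2
  obtain ⟨h1, m1⟩ := hS.cn.1
  rcases hW1 with hW1 | ⟨w, rfl⟩
  swap
  · obtain ⟨y, hy, h⟩ := hS.cn.exists_nbr m1 (by have := hS.1; omega)
    exact absurd h (hone w rfl h1 y (hc h1 m1).1 (hc y hy).1)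
  rcases (by omega : W.card = 2 ∨ W.card = 3) with hc2 | hc3
  · have key : ∀ w w' : V, W = {w, w'} → G.Adj h1 w → ∃ B Z, TC G B ∧ Cn G Z ∧ Disjoint Z B ∧ 4 ≤ Z.card := by
      rintro w w' rfl hw1
      obtain ⟨h0, m0, h2, m2, h02, a0, a2⟩ := hS.two_nbrs m1
      have hlab : ∀ x ∈ S, G.Adj h1 x → G.Adj x w' := fun x hx hx1 => by
        obtain ⟨a, ha, hxa⟩ := (hc x hx).1
        simp at ha; rcases ha with rfl | rfl
        · exact absurd hw1 (fun h => hT _ _ _ hx1 hxa h)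
        · exact hxa
      have l0 := hlab h0 m0 a0
      have l2 := hlab h2 m2 a2
      have hP := cycle_sdiff_cn hT hS hd m0 m1 m2 h02 a0 a2
      have hPc := card_sdiff_triple_ge (k := 3) (by omega : 3 + 3 ≤ S.card) h0 h1 h2
      have hwS : w ∉ S := by simp [hWS]
      have hwS' : w' ∉ S := by simp [hWS]
      have hww : w ≠ w' := by rintro rfl; simp at hc2
      refine ⟨{w', h0, h1, h2}, insert w (S \ {h0, h1, h2}), TC.cycle4 l0.symm a0.symm a2 l2 (by rintro rfl; exact hwS' m1) h02, ?_, ?_, ?_⟩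
      · obtain ⟨x, hx⟩ := hP.1
        obtain ⟨y, hy, hxy⟩ := hP.exists_nbr hx (by omega)
        obtain ⟨a, ha, hxa⟩ := (hc x (Finset.mem_sdiff.1 hx).1).1
        obtain ⟨b, hb, hyb⟩ := (hc y (Finset.mem_sdiff.1 hy).1).1
        simp at ha hb
        rcases ha with rfl | rfl
        · exact hP.insert_adj hx hxa
        rcases hb with rfl | rfl
        · exact hP.insert_adj hy hyb
        exact absurd hxy fun h => hT _ _ _ h hyb hxa
      · rw [Finset.disjoint_left]; intro x hx hx'
        simp at hx hx'
        have g1 : w ≠ h1 := by rintro rfl; exact hwS m1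
        have g0 : w ≠ h0 := by rintro rfl; exact hwS m0
        have g2 : w ≠ h2 := by rintro rfl; exact hwS m2
        rcases hx' with rfl | rfl | rfl | rfl
        · exact hx.elim (fun h => hww h.symm) (fun h => hwS' h.1)
        all_goals simp_all
      · rw [Finset.card_insert_of_notMem (by simp [hwS])]; omega
    obtain ⟨w, hw, hh⟩ := (hc h1 m1).1
    obtain ⟨a, b, rfl, hab⟩ := hW.adj_of_card_two hc2
    simp at hw
    rcases hw with rfl | rfl
    · exact key w b rfl hh
    · exact key w a (by ext; simp; tauto) hh
  obtain ⟨w1, w2, w3, rfl, h12, h23, h13⟩ := hW.path_of_card_three hc3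
  have hn13 : ¬ G.Adj w1 w3 := fun h => hT _ _ _ h12 h23 h
  have s1 : w1 ∉ S := by simp [hWS]
  have s2 : w2 ∉ S := by simp [hWS]
  have s3 : w3 ∉ S := by simp [hWS]
  by_cases hcom : ∃ h0 ∈ S, ∃ h1 ∈ S, ∃ h2 ∈ S, h0 ≠ h2 ∧ G.Adj h1 h0 ∧ G.Adj h1 h2 ∧
      ∃ w ∈ ({w1, w2, w3} : Finset V), G.Adj h0 w ∧ G.Adj h2 w
  · clear h1 m1
    obtain ⟨h0, m0, h1, m1, h2, m2, h02, a0, a2, w, hw, l0, l2⟩ := hcom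
    have hP := cycle_sdiff_cn hT hS hd m0 m1 m2 h02 a0 a2
    have hPc := card_sdiff_triple_ge (k := 2) (by omega : 2 + 3 ≤ S.card) h0 h1 h2
    have hwS : w ∉ S := by simp at hw; rcases hw with rfl | rfl | rfl <;> assumption
    have hB : TC G {w, h0, h1, h2} := TC.cycle4 l0.symm a0.symm a2 l2 (by rintro rfl; exact hwS m1) h02
    have key : ∀ u v : V, u ∉ S → v ∉ S → (∀ x, x ∈ S ∨ x = u ∨ x = v ∨ x = w) → u ≠ v → u ≠ w → v ≠ w →
        Cn G (insert u (insert v (S \ {h0, h1, h2}))) → ∃ B Z, TC G B ∧ Cn G Z ∧ Disjoint Z B ∧ 4 ≤ Z.card := by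
      intro u v hu hv hall huv huw hvw hZ
      refine ⟨_, _, hB, hZ, ?_, ?_⟩
      · rw [Finset.disjoint_left]; intro x hx hx'
        simp at hx hx'
        rcases hx with rfl | rfl | ⟨hxS, hxn⟩
        · rcases hx' with rfl | rfl | rfl | rfl
          exacts [huw rfl, hu m0, hu m1, hu m2]
        · rcases hx' with rfl | rfl | rfl | rfl
          exacts [hvw rfl, hv m0, hv m1, hv m2]
        · rcases hx' with rfl | h
          · exact hwS hxS
          · tauto
      · rw [Finset.card_insert_of_notMem (by simp [hu, huv]), Finset.card_insert_of_notMem (by simp [hv])]; omega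
    have hall : ∀ x, x ∈ S ∨ x = w1 ∨ x = w2 ∨ x = w3 := fun x => by
      by_cases hx : x ∈ S
      · exact Or.inl hx
      · simp [hWS] at hx; tauto
    have hatt : ∀ x ∈ S, G.Adj x w1 ∨ G.Adj x w2 ∨ G.Adj x w3 := fun x hx => by
      obtain ⟨a, ha, h⟩ := (hc x hx).1
      simp at ha; rcases ha with rfl | rfl | rfl <;> tauto
    have hend : ∀ u v : V, u ∉ S → v ∉ S → (∀ x, x ∈ S ∨ x = u ∨ x = v ∨ x = w) → u ≠ v → u ≠ w → v ≠ w →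
        G.Adj u v → (∀ x ∈ S, G.Adj x u ∨ G.Adj x v ∨ G.Adj x w) → ∃ B Z, TC G B ∧ Cn G Z ∧ Disjoint Z B ∧ 4 ≤ Z.card := by
      intro u v hu hv hall huv huw hvw h hat
      refine key u v hu hv hall huv huw hvw ?_
      obtain ⟨x, hx⟩ := hP.1
      obtain ⟨y, hy, hxy⟩ := hP.exists_nbr hx (by omega)
      have go : ∀ z ∈ S \ {h0, h1, h2}, G.Adj z u ∨ G.Adj z v → Cn G (insert u (insert v (S \ {h0, h1, h2}))) := by
        intro z hz hzz
        rcases hzz with hzz | hzz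
        · rw [Finset.insert_comm]
          exact (hP.insert_adj hz hzz).insert_adj (Finset.mem_insert_self _ _) h
        · exact (hP.insert_adj hz hzz).insert_adj (Finset.mem_insert_self _ _) h.symm
      rcases hat x (Finset.mem_sdiff.1 hx).1 with h' | h' | h'
      · exact go x hx (Or.inl h')
      · exact go x hx (Or.inr h')
      rcases hat y (Finset.mem_sdiff.1 hy).1 with h'' | h'' | h''
      · exact go y hy (Or.inl h'')
      · exact go y hy (Or.inr h'')
      exact absurd hxy fun h => hT _ _ _ h h'' h'
    simp at hw
    rcases hw with rfl | rfl | rfl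
    · exact hend w2 w3 s2 s3 (fun x => by have := hall x; tauto) h23.ne h12.ne' h13.symm h23
        (fun x hx => by have := hatt x hx; tauto)
    · refine key w1 w3 s1 s3 (fun x => by have := hall x; tauto) h13 h12.ne h23.ne' ?_
      have att1 : ∀ u u' : V, (∀ x, x ∈ S ∨ x = u ∨ x = w ∨ x = u') → G.Adj u w → ¬ G.Adj u u' →
          ∃ y ∈ S \ {h0, h1, h2}, G.Adj y u := by
        intro u u' hall huw huu
        obtain ⟨y, hy1, hy2, hy⟩ := hK.exists_nbr (by omega) u w h1
        refine ⟨y, ?_, hy.symm⟩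
        have hyS : y ∈ S := by
          rcases hall y with h | h | h | h
          · exact h
          · exact absurd h hy.ne'
          · exact absurd h hy1
          · exact absurd (h ▸ hy) huu
        simp [hyS, hy2]
        refine ⟨?_, ?_⟩
        · rintro rfl; exact hT _ _ _ hy l0 huw
        · rintro rfl; exact hT _ _ _ hy l2 huw
      obtain ⟨y, hy, hy1⟩ := att1 w1 w3 hall h12 hn13
      obtain ⟨z, hz, hz1⟩ := att1 w3 w1 (fun x => by have := hall x; tauto) h23.symm (fun h => hn13 h.symm)
      exact (hP.insert_adj hz hz1).insert_adj (Finset.mem_insert_of_mem hy) hy1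
    · exact hend w1 w2 s1 s2 (fun x => by have := hall x; tauto) h12.ne h13 h23.ne h12
        (fun x hx => by have := hatt x hx; tauto)
  · clear h1 m1
    push Not at hcom
    have hall : ∀ x, x ∈ S ∨ x = w1 ∨ x = w2 ∨ x = w3 := fun x => by
      by_cases hx : x ∈ S
      · exact Or.inl hx
      · simp [hWS] at hx; tauto
    have hatt : ∀ x ∈ S, G.Adj x w1 ∨ G.Adj x w2 ∨ G.Adj x w3 := fun x hx => by
      obtain ⟨a, ha, h⟩ := (hc x hx).1
      simp at ha; rcases ha with rfl | rfl | rfl <;> tauto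
    obtain ⟨h0, hh0, -, l0⟩ := hK.exists_nbr (by omega) w1 w2 w2
    have m0 : h0 ∈ S := by
      rcases hall h0 with h | h | h | h
      · exact h
      · exact absurd h l0.ne'
      · exact absurd h hh0
      · exact absurd (h ▸ l0) hn13
    obtain ⟨h1, m1, -, a01⟩ := hS.other_nbr m0 h0
    obtain ⟨h2, m2, n20, a12⟩ := hS.other_nbr m1 h0
    obtain ⟨h3, m3, n31, a23⟩ := hS.other_nbr m2 h1
    obtain ⟨h4, m4, n42, a34⟩ := hS.other_nbr m3 h2
    obtain ⟨h5, m5, n53, a45⟩ := hS.other_nbr m4 h3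
    have c02 := hcom h0 m0 h1 m1 h2 m2 n20.symm a01.symm a12
    have c13 := hcom h1 m1 h2 m2 h3 m3 n31.symm a12.symm a23
    have c35 := hcom h3 m3 h4 m4 h5 m5 n53.symm a34.symm a45
    simp only [Finset.mem_insert, Finset.mem_singleton, forall_eq_or_imp, forall_eq] at c02 c13 c35
    have t : ∀ x y w, G.Adj x y → G.Adj x w → ¬ G.Adj y w := fun x y w h h' h'' => hT _ _ _ h h'' h'
    have f1 : ¬ G.Adj h1 w1 := t _ _ _ a01 l0.symm
    have f2 : ¬ G.Adj h2 w1 := c02.1 l0.symm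
    have l3 : G.Adj h3 w1 := by
      rcases hatt h3 m3 with h | h | h
      · exact h
      · have g2 : G.Adj h2 w3 := ((hatt h2 m2).resolve_left f2).resolve_left fun h' => t _ _ _ a23 h' h
        have g1 : G.Adj h1 w3 := ((hatt h1 m1).resolve_left f1).resolve_left fun h' => c13.2.1 h' h
        exact absurd g2 (t _ _ _ a12 g1)
      · have g2 : G.Adj h2 w2 := ((hatt h2 m2).resolve_left f2).resolve_right fun h' => t _ _ _ a23 h' h
        have g1 : G.Adj h1 w2 := ((hatt h1 m1).resolve_left f1).resolve_right fun h' => c13.2.2 h' h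
        exact absurd g2 (t _ _ _ a12 g1)
    have f4 : ¬ G.Adj h4 w1 := t _ _ _ a34 l3
    have f5 : ¬ G.Adj h5 w1 := c35.1 l3
    have n30 : h3 ≠ h0 := by rintro rfl; exact hT _ _ _ a12 a23 a01.symm
    have n41 : h4 ≠ h1 := by rintro rfl; exact hT _ _ _ a23 a34 a12.symm
    have n40 : h4 ≠ h0 := by rintro rfl; exact f4 l0.symm
    have n52 : h5 ≠ h2 := by rintro rfl; exact hT _ _ _ a34 a45 a23.symm
    have n50 : h5 ≠ h0 := by rintro rfl; exact f5 l0.symm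
    have n51 : h5 ≠ h1 := by
      rintro rfl
      rcases hd h5 m1 h0 m0 h2 m2 h4 m4 a01.symm a12 a45.symm with h | h | h
      · exact n20 h.symm
      · exact n40 h.symm
      · exact n42 h.symm
    have ne : ∀ x ∈ S, x ≠ w1 ∧ x ≠ w2 ∧ x ≠ w3 := fun x hx => by
      refine ⟨?_, ?_, ?_⟩ <;> rintro rfl <;> contradiction
    have hN : [w1, h0, h1, h2, h3, w2, w3, h4, h5].Nodup := by
      obtain ⟨_, _, _⟩ := ne h0 m0
      obtain ⟨_, _, _⟩ := ne h1 m1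
      obtain ⟨_, _, _⟩ := ne h2 m2
      obtain ⟨_, _, _⟩ := ne h3 m3
      obtain ⟨_, _, _⟩ := ne h4 m4
      obtain ⟨_, _, _⟩ := ne h5 m5
      have := h12.ne
      have := h23.ne
      have := a01.ne
      have := a12.ne
      have := a23.ne
      have := a34.ne
      have := a45.ne
      simp only [List.nodup_cons, List.mem_cons, not_or, List.not_mem_nil, not_false_eq_true,
        List.nodup_nil, and_true]
      clear ne hcom hatt hall hd hc hK hT hn hone
      repeat' apply And.intro
      all_goals first | assumption | (apply Ne.symm; assumption)
    have hN1 : [w1, h0, h1, h2, h3].Nodup :=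
      List.Nodup.sublist (List.sublist_append_left _ [w2, w3, h4, h5]) hN
    have hN2 : [w2, w3, h4, h5].Nodup :=
      List.Nodup.sublist (List.sublist_append_right [w1, h0, h1, h2, h3] _) hN
    refine ⟨{w1, h0, h1, h2, h3}, {w2, w3, h4, h5}, TC.cycle5 l0 a01 a12 a23 l3 hN1, ?_, ?_, ?_⟩
    · have h45 : Cn G {h4, h5} := Cn.pair a45
      have hw : G.Adj h4 w2 ∨ G.Adj h4 w3 := (hatt h4 m4).resolve_left f4
      rcases hw with hw | hw
      · rw [Finset.insert_comm]
        exact (h45.insert_adj (by simp) hw).insert_adj (Finset.mem_insert_self _ _) h23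
      · exact (h45.insert_adj (by simp) hw).insert_adj (Finset.mem_insert_self _ _) h23.symm
    · simpa using disjoint_of_nodup (l1 := [w1, h0, h1, h2, h3]) (l2 := [w2, w3, h4, h5]) hN
    · exact four_le_card (a := w2) (b := w3) (c := h4) (d := h5) hN2 (by simp)

/-- A largest `2`-connected set whose complement contains a connected set of four vertices;
`Y` is its complement. -/
structure MaxBlock (G : SimpleGraph V) (B Y : Finset V) : Prop where
  tc : TC G B
  mem : ∀ v, v ∈ Y ↔ v ∉ B
  ex : ∃ Z ⊆ Y, Cn G Z ∧ 4 ≤ Z.card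
  max : ∀ B' Z, TC G B' → Cn G Z → Disjoint Z B' → 4 ≤ Z.card → B'.card ≤ B.card

lemma exists_maxBlock [Fintype V] (hK : K3 G) (hT : TF G) (h4 : N4 G) (hV : 8 ≤ Fintype.card V) :
    ∃ B Y, MaxBlock G B Y := by
  obtain ⟨B0, Z0, h0⟩ := exists_block hK hT h4 hV
  obtain ⟨B, hB, hmax⟩ := Finset.exists_max_image
    (Finset.univ.filter fun B : Finset V => TC G B ∧ ∃ Z, Cn G Z ∧ Disjoint Z B ∧ 4 ≤ Z.card) Finset.card
    ⟨B0, by simp only [Finset.mem_filter, Finset.mem_univ, true_and]; exact ⟨h0.1, Z0, h0.2⟩⟩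
  simp only [Finset.mem_filter, Finset.mem_univ, true_and] at hB hmax
  obtain ⟨hB, Z, hZ, hd, h4⟩ := hB
  exact ⟨B, Bᶜ, hB, by simp, ⟨Z, fun z hz => by simpa using Finset.disjoint_left.1 hd hz, hZ, h4⟩,
    fun B' Z' h1 h2 h3 h4 => hmax B' ⟨h1, Z', h2, h3, h4⟩⟩

namespace MaxBlock
variable {B Y : Finset V}

lemma disj (h : MaxBlock G B Y)
    : Disjoint B Y := Finset.disjoint_left.2 fun v hv hv' => (h.mem v).1 hv' hv

lemma no_ext (h : MaxBlock G B Y)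
    {D Z : Finset V} (hD : D ⊆ Y) (hne : D.Nonempty) (hT : TC G (B ∪ D)) (hZY : Z ⊆ Y)
    (hd : Disjoint Z D) (hZ : Cn G Z) : Z.card ≤ 3 := by
  by_contra hcon
  have h1 := h.max _ Z hT hZ (Finset.disjoint_union_right.2
    ⟨(Finset.disjoint_of_subset_right hZY h.disj).symm, hd⟩) (by omega)
  rw [Finset.card_union_of_disjoint (Finset.disjoint_of_subset_right hD h.disj)] at h1
  have := Finset.card_pos.2 hne
  omega

lemma no_ear (h : MaxBlock G B Y)
    {C Z : Finset V} (hC : C ⊆ Y) (hCc : Cn G C) (h2 : TwoNb G B C) (hZY : Z ⊆ Y)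
    (hd : Disjoint Z C) (hZ : Cn G Z) : Z.card ≤ 3 := by
  obtain ⟨D, hDC, hD, -, hT⟩ := h.tc.exists_ear hCc (Finset.disjoint_of_subset_right hC h.disj).symm h2
  exact h.no_ext (hDC.trans hC) hD.1 hT hZY (Finset.disjoint_of_subset_right hDC hd) hZ

lemma twoNb (h : MaxBlock G B Y) (hK : K3 G) {J : Finset V} (hJ : J ⊆ Y) (hne : J.Nonempty) (c : V)
    (hcl : ∀ x ∈ J, ∀ y ∈ Y, G.Adj x y → y ∈ J ∨ y = c) : TwoNb G B J := by
  have hd : Disjoint B J := Finset.disjoint_of_subset_right hJ h.disj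
  have := hK.twoNb (S := B) hne h.tc.1 hd c (fun x hx y hyJ hxy => by
    by_cases hy : y ∈ Y
    · exact Or.inr ((hcl x hx y hy hxy).resolve_left hyJ)
    · left; by_contra hyB; exact hy ((h.mem y).2 hyB))
  rwa [Finset.sdiff_eq_self_of_disjoint hd] at this

lemma cnY (h : MaxBlock G B Y) (hK : K3 G) : Cn G Y := by
  obtain ⟨Z, hZY, hZ, h4⟩ := h.ex
  obtain ⟨z, hz⟩ := hZ.1
  have hzY := hZY hz
  suffices cmp G Y z = Y by rw [← this]; exact cmp_cn hzY
  refine (cmp_subset _ _).antisymm fun y hy => ?_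
  by_contra hyz
  have hZc : Z ⊆ cmp G Y z := cmp_max hzY hZY hZ hz (mem_cmp_self hzY)
  have h2 := h.twoNb hK (cmp_subset Y y) ⟨y, mem_cmp_self hy⟩ y
    (fun a ha b hb hab => Or.inl (cmp_closed hy ha hb hab))
  have := h.no_ear (cmp_subset Y y) (cmp_cn hy) h2 hZY (by
    rw [Finset.disjoint_left]; intro a ha ha'
    exact hyz (cmp_max hzY (cmp_subset Y y) (cmp_cn hy) ha' (hZc ha) (mem_cmp_self hy))) hZ
  omega

lemma five (h : MaxBlock G B Y) (hK : K3 G) (h4 : N4 G) : 5 ≤ Y.card := by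
  obtain ⟨Z, hZY, hZ, hc⟩ := h.ex
  have h1 := Finset.card_le_card hZY
  by_contra hcon
  refine h4 Y B (by omega) (h.cnY hK) (fun v => ?_) h.tc
  rw [h.mem]; tauto

lemma one_of_cn (h : MaxBlock G B Y)
    (hc : 5 ≤ Y.card) {x : V} (hx : x ∈ Y) (hcn : Cn G (Y.erase x)) {s t : V}
    (hs : s ∈ B) (ht : t ∈ B) (h1 : G.Adj x s) (h2 : G.Adj x t) : s = t := by
  by_contra hst
  have := h.no_ear (C := {x}) (by simpa using hx) (Cn.singleton x)
    ⟨s, hs, t, ht, hst, ⟨x, by simp, h1⟩, x, by simp, h2⟩ (Finset.erase_subset x Y) (by simp) hcn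
  rw [Finset.card_erase_of_mem hx] at this
  omega

lemma tcY (h : MaxBlock G B Y) [Fintype V] (hK : K3 G) (hT : TF G) (h4 : N4 G) : TC G Y := by
  have h5 := h.five hK h4
  have hY := h.cnY hK
  refine TC.of_erase (by omega) fun y => ?_
  by_cases hy : y ∈ Y
  swap
  · rwa [Finset.erase_eq_of_notMem hy]
  by_contra hcon
  obtain ⟨J, hJ, hne, hcl, z, hz, hzJ⟩ : ∃ J ⊆ Y.erase y, J.Nonempty ∧
      (∀ x ∈ J, ∀ z ∈ Y.erase y, G.Adj x z → z ∈ J) ∧ ∃ z ∈ Y.erase y, z ∉ J := by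
    by_contra hc
    push Not at hc
    exact hcon ⟨Finset.card_pos.1 (by rw [Finset.card_erase_of_mem hy]; omega), hc⟩
  have side : ∀ J ⊆ Y.erase y, J.Nonempty → (∀ x ∈ J, ∀ z ∈ Y.erase y, G.Adj x z → z ∈ J) →
      Cn G (Y \ J) ∧ (Y \ J).card ≤ 3 := by
    intro J hJ hne hcl
    have hyJ : y ∉ J := fun h => by simpa using hJ h
    have hJY : J ⊆ Y := hJ.trans (Finset.erase_subset _ _)
    have hcl' : ∀ x ∈ J, ∀ z ∈ Y, G.Adj x z → z ∈ J ∨ z = y := fun x hx z hz hxz => by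
      by_cases hzy : z = y
      · exact Or.inr hzy
      · exact Or.inl (hcl x hx z (by simp [hz, hzy]) hxz)
    have hcn : Cn G (Y \ J) := hY.sdiff hy hyJ hcl'
    refine ⟨hcn, ?_⟩
    obtain ⟨x, hx⟩ := hne
    have h2 := h.twoNb hK ((cmp_subset J x).trans hJY) ⟨x, mem_cmp_self hx⟩ y (fun a ha b hb hab => by
      rcases hcl' a (cmp_subset _ _ ha) b hb hab with h' | h'
      · exact Or.inl (cmp_closed hx ha h' hab)
      · exact Or.inr h')
    exact h.no_ear ((cmp_subset J x).trans hJY) (cmp_cn hx) h2 Finset.sdiff_subset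
      (Finset.disjoint_of_subset_right (cmp_subset J x) Finset.sdiff_disjoint) hcn
  obtain ⟨-, hc1⟩ := side J hJ hne hcl
  have hyJ : y ∉ J := fun h => by simpa using hJ h
  obtain ⟨hcn2, hc2⟩ := side ((Y.erase y) \ J) Finset.sdiff_subset ⟨z, by simp at hz; simp [hz, hzJ]⟩
    (fun a ha b hb hab => by
      refine Finset.mem_sdiff.2 ⟨hb, fun hbJ => ?_⟩
      exact (Finset.mem_sdiff.1 ha).2 (hcl b hbJ a (Finset.mem_sdiff.1 ha).1 hab.symm))
  have hJy : Y \ ((Y.erase y) \ J) = insert y J := by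
    ext v; have := @hJ v
    simp at this ⊢
    by_cases hv : v = y
    · subst hv; simp [hy]
    · simp [hv]; constructor
      · rintro ⟨a, b⟩; exact b a
      · intro a; exact ⟨(this a).2, fun _ => a⟩
  rw [hJy] at hcn2 hc2
  have hcard : (insert y J).card = 3 := by
    have := Finset.card_sdiff_add_card_eq_card (hJ.trans (Finset.erase_subset y Y))
    rw [Finset.card_insert_of_notMem hyJ] at hc2 ⊢
    omega
  -- the end of the path different from `y`
  have fin : ∀ a b : V, a ∈ J → b ∈ insert y J → G.Adj a b →
      (∀ z ∈ insert y J, G.Adj a z → z = b) → False := by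
    intro a b ha hb hab huniq
    have haY : a ∈ Y := Finset.mem_of_mem_erase (hJ ha)
    have hbY : b ∈ Y := by
      rcases Finset.mem_insert.1 hb with rfl | hb
      exacts [hy, Finset.mem_of_mem_erase (hJ hb)]
    have huniq' : ∀ z ∈ Y, G.Adj a z → z = b := fun z hz haz => by
      refine huniq z ?_ haz
      by_cases hzy : z = y
      · simp [hzy]
      · exact Finset.mem_insert_of_mem (hcl a ha z (by simp [hz, hzy]) haz)
    have hcn : Cn G (Y.erase a) := by
      rw [Finset.erase_eq]
      refine hY.sdiff hbY (by simpa using hab.ne') ?_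
      intro j hj z hz hjz
      simp at hj; subst hj
      exact Or.inr (huniq' z hz hjz)
    have hV : 4 ≤ Fintype.card V := by
      have := Finset.card_le_univ Y; omega
    obtain ⟨s, hsb, -, has⟩ := hK.exists_nbr hV a b b
    obtain ⟨t, htb, hts, hat⟩ := hK.exists_nbr hV a b s
    have inB : ∀ s, s ≠ b → G.Adj a s → s ∈ B := fun s hs has => by
      by_contra hsB; exact hs (huniq' s ((h.mem s).2 hsB) has)
    exact hts (h.one_of_cn h5 haY hcn (inB t htb hat) (inB s hsb has) hat has)
  obtain ⟨a, b, c, habc, hab, hbc, hac⟩ := hcn2.path_of_card_three hcard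
  have hnac : ¬ G.Adj a c := fun h' => hT _ _ _ hab hbc h'
  have ha : a ∈ insert y J := by rw [habc]; simp
  have hb : b ∈ insert y J := by rw [habc]; simp
  have hc : c ∈ insert y J := by rw [habc]; simp
  by_cases hay : a = y
  · refine fin c b ((Finset.mem_insert.1 hc).resolve_left (fun h => hac (hay.trans h.symm))) hb hbc.symm ?_
    rw [habc]; intro z hz hcz
    simp at hz; rcases hz with rfl | rfl | rfl
    · exact absurd hcz.symm hnac
    · rfl
    · exact absurd hcz (G.loopless.irrefl _)
  · refine fin a b ((Finset.mem_insert.1 ha).resolve_left hay) hb hab ?_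
    rw [habc]; intro z hz hcz
    simp at hz; rcases hz with rfl | rfl | rfl
    · exact absurd hcz (G.loopless.irrefl _)
    · rfl
    · exact absurd hcz hnac

lemma one (h : MaxBlock G B Y)
    [Fintype V] (hK : K3 G) (hT : TF G) (h4 : N4 G) {x : V} (hx : x ∈ Y) {s t : V}
    (hs : s ∈ B) (ht : t ∈ B) (h1 : G.Adj x s) (h2 : G.Adj x t) : s = t :=
  h.one_of_cn (h.five hK h4) hx ((h.tcY hK hT h4).erase_cn x) hs ht h1 h2

lemma exit (h : MaxBlock G B Y)
    (hK : K3 G) (hne : Y.Nonempty) (s t : V) : ∃ y ∈ Y, ∃ b ∈ B, b ≠ s ∧ b ≠ t ∧ G.Adj y b := by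
  obtain ⟨z, hz, hzs, hzt⟩ := exists_mem_avoid h.tc.1 s t
  obtain ⟨y, hy, b, hb, hbs, hbt, hyb⟩ := hK Y hne s t ⟨z, fun h' => (h.mem z).1 h' hz, hzs, hzt⟩
  refine ⟨y, hy, b, ?_, hbs, hbt, hyb⟩
  by_contra h'; exact hb ((h.mem b).2 h')

end MaxBlock

/-- A maximal block together with a largest connected set `W` leaving an ear `P`. -/
structure Stuck (G : SimpleGraph V) (B Y W P S : Finset V) : Prop where
  blk : MaxBlock G B Y
  sub : W ⊆ Y
  cnW : Cn G W
  le : W.card ≤ 3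
  mx : ∀ C ⊆ Y, Cn G C → TwoNb G B C → ∀ Z ⊆ Y, Disjoint Z C → Cn G Z → Z.card ≤ W.card
  memS : ∀ v, v ∈ S ↔ v ∉ W
  memP : ∀ v, v ∈ P ↔ v ∈ Y ∧ v ∉ W
  leaf : Leaf G W S P
  sdiff : S \ P = B

lemma MaxBlock.exists_stuck [Fintype V] {B Y : Finset V} (h : MaxBlock G B Y) (hK : K3 G) (hT : TF G)
    (h4 : N4 G) : ∃ W P S, Stuck G B Y W P S := by
  have h5 := h.five hK h4
  have hY := h.tcY hK hT h4
  obtain ⟨y0, hy0⟩ := hY.cn.1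
  obtain ⟨W, hW, hmax⟩ := Finset.exists_max_image
    (Y.powerset.filter fun W => Cn G W ∧ ∃ C ⊆ Y, Disjoint W C ∧ Cn G C ∧ TwoNb G B C) Finset.card
    ⟨{y0}, by
      simp only [Finset.mem_filter, Finset.mem_powerset]
      refine ⟨by simpa using hy0, Cn.singleton y0, Y.erase y0, Finset.erase_subset _ _, by simp,
        hY.erase_cn y0, h.twoNb hK (Finset.erase_subset _ _) (hY.erase_cn y0).1 y0 ?_⟩
      intro x hx y hy _
      simp [hy]; tauto⟩
  simp only [Finset.mem_filter, Finset.mem_powerset] at hW hmax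
  obtain ⟨hWY, hW, C, hCY, hWC, hC, hCB⟩ := hW
  have mx : ∀ C ⊆ Y, Cn G C → TwoNb G B C → ∀ Z ⊆ Y, Disjoint Z C → Cn G Z → Z.card ≤ W.card :=
    fun C hC hCc h2 Z hZ hd hZc => hmax Z ⟨hZ, hZc, C, hC, hd, hCc, h2⟩
  have hno : ∀ C ⊆ Y, Cn G C → TwoNb G B C → Disjoint W C → ∀ u ∈ Y, Att G W u → u ∉ W → u ∈ C := by
    intro C hCY hC hCB hd u hu ⟨w, hw, huw⟩ huW
    by_contra huC
    have := mx C hCY hC hCB (insert u W) (Finset.insert_subset hu hWY)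
      (Finset.disjoint_insert_left.2 ⟨huC, hd⟩) (hW.insert_adj hw huw.symm)
    rw [Finset.card_insert_of_notMem huW] at this
    omega
  have hle := h.no_ear hCY hC hCB hWY hWC hW
  obtain ⟨D, hDC, hD, hDB, hDT⟩ := h.tc.exists_ear hC (Finset.disjoint_of_subset_right hCY h.disj).symm hCB
  have hWD : Disjoint W D := Finset.disjoint_of_subset_right hDC hWC
  have hDY := hDC.trans hCY
  have hBW : ∀ v ∈ B, v ∉ W := fun v hv hvW => (h.mem v).1 (hWY hvW) hv
  have hS : TC G Wᶜ := by
    refine hDT.extend ?_ fun J hJ hd hne => ?_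
    · intro v hv
      rcases Finset.mem_union.1 hv with hv | hv
      · simpa using hBW v hv
      · simpa using Finset.disjoint_right.1 hWD hv
    rw [Finset.disjoint_union_right] at hd
    obtain ⟨hdB, hdD⟩ := hd
    refine hK.twoNb hne h.tc.1 hdB.symm hne.choose fun x hx y hy hxy => ?_
    left
    simp; intro hyW
    have hxY : x ∈ Y := (h.mem x).2 (Finset.disjoint_left.1 hdB hx)
    have hxW : x ∉ W := by simpa using hJ hx
    exact Finset.disjoint_left.1 hdD hx (hno D hDY hD hDB hWD x hxY ⟨y, hyW, hxy⟩ hxW)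
  have hP : ∀ v, v ∈ Y \ W ↔ v ∈ Y ∧ v ∉ W := fun v => Finset.mem_sdiff
  have hSP : Wᶜ \ (Y \ W) = B := by
    ext v
    have := hBW v
    simp [h.mem]; tauto
  have hPS : Y \ W ⊆ Wᶜ := fun v hv => by simpa using (Finset.mem_sdiff.1 hv).2
  have hCP : C ⊆ Y \ W := fun v hv => Finset.mem_sdiff.2 ⟨hCY hv, Finset.disjoint_right.1 hWC hv⟩
  have hPW : ∀ C ⊆ Y \ W, Disjoint W C := fun C hC =>
    Finset.disjoint_right.2 fun v hv => (Finset.mem_sdiff.1 (hC hv)).2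
  have h2 : 2 ≤ (Wᶜ \ (Y \ W)).card := by rw [hSP]; have := h.tc.1; omega
  have hatt : ∀ u ∈ Y \ W, Att G W u := by
    refine core_att hS hPS h2 hK hW.1 (by simp) ?_ ?_
    · rw [hSP]
      intro C hC hCc hCT u hu hua
      exact hno C (hC.trans Finset.sdiff_subset) hCc hCT (hPW C hC) u (Finset.mem_sdiff.1 hu).1 hua
        (Finset.mem_sdiff.1 hu).2
    · obtain ⟨c, hc⟩ := hC.1
      obtain ⟨w, hw, u, hu, huW, hwu⟩ := hY.cn.exists_adj hWY hW.1 ⟨c, hCY hc, (Finset.mem_sdiff.1 (hCP hc)).2⟩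
      exact ⟨u, Finset.mem_sdiff.2 ⟨hu, huW⟩, w, hw, hwu.symm⟩
  refine ⟨W, Y \ W, Wᶜ, h, hWY, hW, hle, mx, by simp, hP, ⟨hS, hPS, hatt, ?_, by rw [hSP]; exact h.tc, ?_⟩, hSP⟩
  · obtain ⟨s, hs, t, ht, hst, ⟨x, hx, hxs⟩, y, hy, hyt⟩ := hCB.mono hCP
    have : x ≠ y := by
      rintro rfl
      exact hst (h.one hK hT h4 (Finset.mem_sdiff.1 hx).1 hs ht hxs hyt)
    exact Finset.one_lt_card.2 ⟨x, hx, y, hy, this⟩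
  · rw [hSP]
    intro C hC hCc hCT
    refine hC.antisymm fun u hu => ?_
    exact hno C (hC.trans Finset.sdiff_subset) hCc hCT (hPW C hC) u (Finset.mem_sdiff.1 hu).1 (hatt u hu)
      (Finset.mem_sdiff.1 hu).2

/-- Removing an end of an ear leaves a connected set. -/
lemma Leaf.erase_end {W S P : Finset V} (h : Leaf G W S P) {p s : V} (hp : p ∈ P) (hs : s ∈ S \ P)
    (hps : G.Adj p s) : Cn G (P.erase p) := by
  obtain ⟨x, hx, hpx⟩ := h.cn.exists_nbr hp h.two
  rw [Finset.erase_eq]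
  refine h.cn.sdiff hx (by simpa using hpx.ne') ?_
  intro j hj z hz hjz
  simp at hj; subst hj
  simp at hs
  rcases h.d2 hp z (h.sub hz) x (h.sub hx) s hs.1 hjz hpx hps with h' | h' | h'
  · exact Or.inr h'
  · exact absurd (h' ▸ hz) hs.2
  · exact absurd (h' ▸ hx) hs.2

namespace Stuck
variable {B Y W P S : Finset V}

lemma mem_W (h : Stuck G B Y W P S) {y : V} (hy : y ∈ Y) (hyP : y ∉ P) : y ∈ W := by
  by_contra hW
  exact hyP ((h.memP y).2 ⟨hy, hW⟩)

lemma mem_Y (h : Stuck G B Y W P S) {y : V} (hy : y ∈ P) : y ∈ Y := ((h.memP y).1 hy).1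

lemma notMem_W (h : Stuck G B Y W P S) {y : V} (hy : y ∈ P) : y ∉ W := ((h.memP y).1 hy).2

lemma notMem_B (h : Stuck G B Y W P S) {y : V} (hy : y ∈ Y) : y ∉ B := (h.blk.mem y).1 hy

lemma memS_iff (h : Stuck G B Y W P S) (v : V) : v ∈ S ↔ v ∈ B ∨ v ∈ P := by
  have h1 := @h.leaf.sub v
  rw [← h.sdiff]; simp; tauto

lemma card_W_ne_one (h : Stuck G B Y W P S) (hT : TF G) : W.card ≠ 1 := by
  intro h1
  obtain ⟨w, rfl⟩ := Finset.card_eq_one.1 h1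
  obtain ⟨x, hx, y, hy, hxy⟩ := h.leaf.exists_edge
  obtain ⟨a, ha, hxa⟩ := h.leaf.att x hx
  obtain ⟨b, hb, hyb⟩ := h.leaf.att y hy
  simp at ha hb; subst ha; subst hb
  exact hT _ _ _ hxy hyb hxa

section
variable {w w' : V}

lemma att_two (h : Stuck G B Y {w, w'} P S) (hww : G.Adj w w')
    {x : V} (hx : x ∈ P) : G.Adj x w ∨ G.Adj x w' := by
  obtain ⟨a, ha, hxa⟩ := h.leaf.att x hx
  simp at ha
  rcases ha with rfl | rfl <;> simp [hxa]

lemma att_of_edge (h : Stuck G B Y {w, w'} P S) (hT : TF G) (hww : G.Adj w w')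
    {Q : Finset V} (hQ : Cn G Q) (h2 : 2 ≤ Q.card) (hQP : Q ⊆ P) :
    ∃ x ∈ Q, G.Adj x w' := by
  obtain ⟨x, hx⟩ := hQ.1
  obtain ⟨y, hy, hxy⟩ := hQ.exists_nbr hx h2
  rcases att_two h hww (hQP hx) with h1 | h1
  · rcases att_two h hww (hQP hy) with h2 | h2
    · exact absurd h1 fun h' => hT _ _ _ hxy h2 h'
    · exact ⟨y, hy, h2⟩
  · exact ⟨x, hx, h1⟩

lemma end_not_adj (h : Stuck G B Y {w, w'} P S) (hT : TF G) (hww : G.Adj w w')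
    (h3 : 3 ≤ P.card) {p s b : V} (hp : p ∈ P) (hs : s ∈ B) (hps : G.Adj p s)
    (hb : b ∈ B) (hbs : b ≠ s) (hwb : G.Adj w b) : ¬ G.Adj p w := by
  intro hpw
  have hwY : w ∈ Y := h.sub (by simp)
  have hwY' : w' ∈ Y := h.sub (by simp)
  have hPY : P ⊆ Y := fun x => h.mem_Y
  have hQ : Cn G (P.erase p) := h.leaf.erase_end hp (by rw [h.sdiff]; exact hs) hps
  have hQc : (P.erase p).card = P.card - 1 := Finset.card_erase_of_mem hp
  obtain ⟨x, hx, hxw⟩ := att_of_edge h hT hww hQ (by omega) (Finset.erase_subset _ _)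
  have hw' : w' ∉ P := fun h' => h.notMem_W h' (by simp)
  have hw : w ∉ P := fun h' => h.notMem_W h' (by simp)
  have := h.mx {p, w} (by intro z hz; simp at hz; rcases hz with rfl | rfl; exacts [hPY hp, hwY])
    (Cn.pair hpw) ⟨s, hs, b, hb, hbs.symm, ⟨p, by simp, hps⟩, w, by simp, hwb⟩
    (insert w' (P.erase p)) (Finset.insert_subset hwY' ((Finset.erase_subset _ _).trans hPY))
    (by
      rw [Finset.disjoint_left]; intro z hz hz'
      simp at hz hz'
      rcases hz' with rfl | rfl
      · rcases hz with rfl | hz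
        · exact hw' hp
        · exact hz.1 rfl
      · rcases hz with rfl | hz
        · exact hww.ne rfl
        · exact hw hz.2) (hQ.insert_adj hx hxw)
  rw [Finset.card_insert_of_notMem (by simp [hw'])] at this
  have := this.trans Finset.card_le_two
  omega

end

lemma card_W_ne_two [Fintype V] (h : Stuck G B Y W P S) (hK : K3 G) (hT : TF G) (h4 : N4 G) : W.card ≠ 2 := by
  intro hW2
  obtain ⟨u, u', hWe, huu⟩ := h.cnW.adj_of_card_two hW2
  obtain ⟨p, hp, q, hq, s, hs, t, ht, hpq, hst, hps, hqt, hends⟩ := h.leaf.ends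
  rw [h.sdiff] at hs ht hends
  obtain ⟨y, hy, b, hb, hbs, hbt, hyb⟩ := h.blk.exit hK ⟨p, h.mem_Y hp⟩ s t
  have hyW : y ∈ W := h.mem_W hy fun hyP => by rcases hends y hyP b hb hyb with h' | h' <;> tauto
  obtain ⟨w, w', rfl, hww, hwb⟩ : ∃ w w', W = {w, w'} ∧ G.Adj w w' ∧ G.Adj w b := by
    rw [hWe] at hyW; simp at hyW
    rcases hyW with rfl | rfl
    · exact ⟨y, u', hWe, huu, hyb⟩
    · exact ⟨y, u, by rw [hWe, Finset.pair_comm], huu.symm, hyb⟩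
  have hPY : P ⊆ Y := fun x => h.mem_Y
  have hcard : P.card + 2 = Y.card := by
    rw [← hW2, ← Finset.card_union_of_disjoint]
    · congr 1; ext v; have := @h.sub v; simp only [Finset.mem_union, h.memP]; tauto
    · rw [Finset.disjoint_left]; exact fun v => h.notMem_W
  have h5 := h.blk.five hK h4
  have h' : Stuck G B Y {w', w} P S := by rwa [Finset.pair_comm]
  have pw := (att_two h hww hp).resolve_left (end_not_adj h hT hww (by omega) hp hs hps hb hbs hwb)
  have qw := (att_two h hww hq).resolve_left (end_not_adj h hT hww (by omega) hq ht hqt hb hbt hwb)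
  have hw'B : ∀ c ∈ B, ¬ G.Adj w' c := by
    intro c hc hwc
    by_cases hcs : c = s
    · exact end_not_adj h' hT hww.symm (by omega) hq ht hqt hc (by rintro rfl; exact hst hcs.symm) hwc qw
    · exact end_not_adj h' hT hww.symm (by omega) hp hs hps hc hcs hwc pw
  have hw' : w' ∉ P := fun h' => h.notMem_W h' (by simp)
  have hw : w ∉ P := fun h' => h.notMem_W h' (by simp)
  have hwY : w ∈ Y := h.sub (by simp)
  have hwY' : w' ∈ Y := h.sub (by simp)
  have hPB : ∀ v ∈ P, v ∉ B := fun v hv => h.notMem_B (h.mem_Y hv)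
  have hwuniq : ∀ c ∈ B, G.Adj w c → c = b := fun c hc hwc => h.blk.one hK hT h4 hwY hc hb hwc hwb
  by_cases hP4 : 4 ≤ P.card
  · obtain ⟨p1, hp1, hpp1⟩ := h.leaf.cn.exists_nbr hp (by omega)
    have hp1w' : ¬ G.Adj p1 w' := fun h => hT _ _ _ hpp1 h pw
    have hp1w := (att_two h hww hp1).resolve_right hp1w'
    have hp1q : p1 ≠ q := by rintro rfl; exact hp1w' qw
    obtain ⟨p2, hp2, hp2p, hp12⟩ := h.leaf.tc.other_nbr (h.leaf.sub hp1) p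
    have hp2P : p2 ∈ P := by
      by_contra hc
      have hp2B : p2 ∈ B := by rw [← h.sdiff]; exact Finset.mem_sdiff.2 ⟨hp2, hc⟩
      rcases hends p1 hp1 p2 hp2B hp12 with h' | h'
      · exact hpp1.ne h'.1.symm
      · exact hp1q h'.1
    have hQ : Cn G (P \ {p, p1}) := by
      refine h.leaf.cn.sdiff hp2P (by simp [hp2p, hp12.ne']) ?_
      intro j hj z hz hjz
      simp at hj
      rcases hj with rfl | rfl
      · rcases h.leaf.d2 hp z (h.leaf.sub hz) p1 (h.leaf.sub hp1) s ((h.memS_iff s).2 (Or.inl hs)) hjz hpp1 hps with h' | h' | h'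
        · simp [h']
        · exact absurd hs (h' ▸ hPB z hz)
        · exact absurd hs (h' ▸ hPB p1 hp1)
      · rcases h.leaf.d2 hp1 z (h.leaf.sub hz) p (h.leaf.sub hp) p2 hp2 hjz hpp1.symm hp12 with h' | h' | h'
        · simp [h']
        · exact Or.inr h'
        · exact absurd h'.symm hp2p
    have hcard2 : P.card - 2 ≤ (P \ {p, p1}).card := by
      have := Finset.le_card_sdiff ({p, p1} : Finset V) P
      have := Finset.card_le_two (a := p) (b := p1)
      omega
    have hqm : q ∈ P \ {p, p1} := by simp [hq, hpq.symm, hp1q.symm]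
    have := h.mx {p, p1, w} (by
        intro z hz; simp at hz; rcases hz with rfl | rfl | rfl; exacts [hPY hp, hPY hp1, hwY])
      (Cn.path3 hpp1 hp1w) ⟨s, hs, b, hb, hbs.symm, ⟨p, by simp, hps⟩, w, by simp, hwb⟩
      (insert w' (P \ {p, p1})) (Finset.insert_subset hwY' (Finset.sdiff_subset.trans hPY))
      (by
        rw [Finset.disjoint_left]; intro z hz hz'
        simp at hz hz'
        rcases hz with rfl | hz
        · rcases hz' with rfl | rfl | rfl
          exacts [hw' hp, hw' hp1, hww.ne rfl]
        · rcases hz' with rfl | rfl | rfl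
          · exact hz.2.1 rfl
          · exact hz.2.2 rfl
          · exact hw hz.1) (hQ.insert_adj hqm qw)
    rw [Finset.card_insert_of_notMem (by simp [hw'])] at this
    have := this.trans Finset.card_le_two
    omega
  have hB3 := h.blk.tc.1
  have hSc : 6 ≤ S.card := by
    have h1 := Finset.card_sdiff_add_card_eq_card h.leaf.sub
    rw [h.sdiff] at h1; omega
  have leafB : ∀ W' S' F, Leaf G W' S' F → S' ⊆ S → Disjoint F P → F ⊆ B := by
    intro W' S' F hF hS' hd v hv
    exact ((h.memS_iff v).1 (hS' (hF.sub hv))).resolve_right (Finset.disjoint_left.1 hd hv)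
  have hsn : ∀ S', S' ⊆ S → TC G S' → P ⊆ S' → s ∈ S' → D2 G S' s → ∃ y ∈ S', y ∈ B ∧ G.Adj s y := by
    intro S' hS' hT' hPS' hs' _
    obtain ⟨y, hy, hyp, hsy⟩ := hT'.other_nbr hs' p
    refine ⟨y, hy, ?_, hsy⟩
    refine ((h.memS_iff y).1 (hS' hy)).resolve_right fun hyP => ?_
    rcases hends y hyP s hs hsy.symm with h' | h'
    · exact hyp h'.1
    · exact hst h'.2
  by_cases hn : Nonext G {w, w'} S
  · rcases leaves_or_cycle hK h.cnW.1 h.memS h.leaf.tc (by omega) hn with ⟨U1, U2, hU1, hU2, hd⟩ | hc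
    · obtain ⟨F, hF, hFP⟩ := exists_leaf_disjoint hU1 hU2 hd h.leaf.cn h.leaf.sub (fun x hx => h.leaf.d2 hx)
      have hFB := leafB _ _ F hF le_rfl hFP
      have hFb : F ⊆ {b} := fun v hv => by
        obtain ⟨a, ha, hva⟩ := hF.att v hv
        simp at ha ⊢
        rcases ha with rfl | rfl
        · exact hwuniq v (hFB hv) hva.symm
        · exact absurd hva.symm (hw'B v (hFB hv))
      have h1 := Finset.card_le_card hFb
      have := hF.two
      rw [Finset.card_singleton] at h1; omega
    · obtain ⟨x, hx, y, hy, hxy, h1, h2⟩ := h.blk.tc.two_nbrs hs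
      have hsub : ∀ v ∈ B, v ∈ S := fun v hv => (h.memS_iff v).2 (Or.inl hv)
      rcases (hc s (hsub s hs)).2 x (hsub x hx) y (hsub y hy) p (h.leaf.sub hp) h1 h2 hps.symm with h' | h' | h'
      · exact hxy h'
      · exact hPB p hp (h' ▸ hx)
      · exact hPB p hp (h' ▸ hy)
  · unfold Nonext at hn
    push Not at hn
    obtain ⟨v, hvS, hva, hvT⟩ := hn
    have hvB : v ∈ B := by
      refine ((h.memS_iff v).1 hvS).resolve_right fun hvP => ?_
      obtain ⟨x, hx, hvx⟩ := h.leaf.cn.exists_nbr hvP (by omega)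
      exact (h.leaf.d2 hx).not_tc_erase (h.leaf.sub hx) hvS hvx.symm hvT
    have hvb : v = b := by
      obtain ⟨a, ha, hva⟩ := hva
      simp at ha
      rcases ha with rfl | rfl
      · exact hwuniq v hvB hva.symm
      · exact absurd hva.symm (hw'B v hvB)
    subst hvb
    have hW3 : Cn G (insert v {w, w'}) := h.cnW.insert_adj (x := w) (by simp) hwb
    have hc3 : (insert v ({w, w'} : Finset V)).card = 3 := by
      rw [Finset.card_insert_of_notMem ((h.memS v).1 hvS), hW2]
    have hWS3 : ∀ x, x ∈ S.erase v ↔ x ∉ insert v ({w, w'} : Finset V) := fun x => by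
      simp only [Finset.mem_erase, h.memS, Finset.mem_insert, not_or, ne_eq]
    have hPS3 : P ⊆ S.erase v := fun x hx => Finset.mem_erase.2 ⟨fun h' => hPB x hx (h' ▸ hb), h.leaf.sub hx⟩
    have hattB : ∀ x ∈ B, Att G (insert v {w, w'}) x → x ≠ v → G.Adj x v := by
      rintro x hx ⟨a, ha, hxa⟩ hxv
      simp at ha
      rcases ha with rfl | rfl | rfl
      · exact hxa
      · exact absurd (hwuniq x hx hxa.symm) hxv
      · exact absurd hxa.symm (hw'B x hx)
    rcases leaves_or_cycle hK hW3.1 hWS3 hvT (by rw [Finset.card_erase_of_mem hvS]; omega)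
        (h4.nonext hW3 hc3 hWS3) with ⟨U1, U2, hU1, hU2, hd⟩ | hc
    · obtain ⟨F, hF, hFP⟩ := exists_leaf_disjoint hU1 hU2 hd h.leaf.cn hPS3
        (fun x hx => (h.leaf.d2 hx).mono (Finset.erase_subset _ _))
      have hFB := leafB _ _ F hF (Finset.erase_subset _ _) hFP
      obtain ⟨x, hx, y, hy, hxy⟩ := hF.exists_edge
      have := hattB x (hFB hx) (hF.att x hx) (Finset.mem_erase.1 (hF.sub hx)).1
      have := hattB y (hFB hy) (hF.att y hy) (Finset.mem_erase.1 (hF.sub hy)).1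
      exact hT _ _ _ hxy ‹G.Adj y v› ‹G.Adj x v›
    · have hsS : s ∈ S.erase v := Finset.mem_erase.2 ⟨hbs.symm, (h.memS_iff s).2 (Or.inl hs)⟩
      obtain ⟨y, hy, hyB, hsy⟩ := hsn _ (Finset.erase_subset _ _) hvT hPS3 hsS (hc s hsS).2
      exact hT _ _ _ hsy (hattB y hyB (hc y hy).1 (Finset.mem_erase.1 hy).1)
        (hattB s hs (hc s hsS).1 hbs.symm)

end Stuck

lemma not_d2_of_tc {R S : Finset V} (hR : TC G R) (hRS : R ⊆ S) {v y : V} (hv : v ∈ R) (hy : y ∈ S)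
    (hyR : y ∉ R) (h : G.Adj v y) : ¬ D2 G S v := by
  intro hd
  obtain ⟨a, ha, b, hb, hab, h1, h2⟩ := hR.two_nbrs hv
  rcases hd a (hRS ha) b (hRS hb) y hy h1 h2 h with e | e | e
  · exact hab e
  · exact hyR (e ▸ ha)
  · exact hyR (e ▸ hb)

/-- If the complement of a path `i j k` is a `2`-connected set `R` with an ear `x y`, then there is a
leaf inside `R`. -/
lemma exists_leaf_in (hK : K3 G) (h4 : N4 G) {R : Finset V} (hR : TC G R) {x y u v i j k : V}
    (hx : x ∉ R) (hy : y ∉ R) (hu : u ∈ R) (hv : v ∈ R) (huv : u ≠ v) (hxu : G.Adj x u)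
    (hxy : G.Adj x y) (hyv : G.Adj y v) (hxR : ∀ z ∈ R, G.Adj x z → z = u)
    (hyR : ∀ z ∈ R, G.Adj y z → z = v) (hij : G.Adj i j) (hjk : G.Adj j k) (hik : i ≠ k)
    (hWS : ∀ a, a ∈ insert x (insert y R) ↔ a ∉ ({i, j, k} : Finset V)) :
    ∃ U, Leaf G {i, j, k} (insert x (insert y R)) U ∧ U ⊆ R ∧ u ∉ U ∧ v ∉ U := by
  have hS : TC G (insert x (insert y R)) := hR.add_two hx hy hu hv huv hxu hxy hyv
  have hRS : R ⊆ insert x (insert y R) :=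
    (Finset.subset_insert _ _).trans (Finset.subset_insert _ _)
  have hxS : x ∈ insert x (insert y R) := by simp
  have hyS : y ∈ insert x (insert y R) := by simp
  have hW : Cn G {i, j, k} := Cn.path3 hij hjk
  have hW3 : ({i, j, k} : Finset V).card = 3 :=
    Finset.card_eq_three.2 ⟨i, j, k, hij.ne, hik, hjk.ne, rfl⟩
  have hdu := not_d2_of_tc hR hRS hu hxS hx hxu.symm
  have hdv := not_d2_of_tc hR hRS hv hyS hy hyv.symm
  have dx : D2 G (insert x (insert y R)) x := by
    have key : ∀ z ∈ insert x (insert y R), G.Adj x z → z = u ∨ z = y := fun z hz h => by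
      simp at hz
      rcases hz with rfl | rfl | hz
      · exact absurd h (G.loopless.irrefl _)
      · exact Or.inr rfl
      · exact Or.inl (hxR z hz h)
    intro a ha b hb c hc h1 h2 h3
    have := key a ha h1
    have := key b hb h2
    have := key c hc h3
    grind
  have dy : D2 G (insert x (insert y R)) y := by
    have key : ∀ z ∈ insert x (insert y R), G.Adj y z → z = v ∨ z = x := fun z hz h => by
      simp at hz
      rcases hz with rfl | rfl | hz
      · exact Or.inr rfl
      · exact absurd h (G.loopless.irrefl _)
      · exact Or.inl (hyR z hz h)
    intro a ha b hb c hc h1 h2 h3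
    have := key a ha h1
    have := key b hb h2
    have := key c hc h3
    grind
  rcases leaves_or_cycle hK hW.1 hWS hS
      (by rw [Finset.card_insert_of_notMem (by simp [hx, hxy.ne])]
          have := hR.1; have := Finset.card_le_card (Finset.subset_insert y R); omega)
      (h4.nonext hW hW3 hWS) with ⟨U1, U2, hU1, hU2, hd⟩ | hc
  · obtain ⟨U, hU, hUd⟩ := exists_leaf_disjoint (P := {x, y}) hU1 hU2 hd (Cn.pair hxy)
      (by intro a ha; simp at ha; rcases ha with rfl | rfl <;> simp)
      (by intro a ha; simp at ha; rcases ha with rfl | rfl <;> assumption)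
    refine ⟨U, hU, fun a ha => ?_, fun h => hdu (hU.d2 h), fun h => hdv (hU.d2 h)⟩
    have h1 := hU.sub ha
    have h2 := Finset.disjoint_left.1 hUd ha
    simp at h1 h2; tauto
  · exact absurd (hc u (hRS hu)).2 hdu

lemma exists_edge_in (hK : K3 G) (h4 : N4 G) {R : Finset V} (hR : TC G R) {x y u v i j k : V}
    (hx : x ∉ R) (hy : y ∉ R) (hu : u ∈ R) (hv : v ∈ R) (huv : u ≠ v) (hxu : G.Adj x u)
    (hxy : G.Adj x y) (hyv : G.Adj y v) (hxR : ∀ z ∈ R, G.Adj x z → z = u)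
    (hyR : ∀ z ∈ R, G.Adj y z → z = v) (hij : G.Adj i j) (hjk : G.Adj j k) (hik : i ≠ k)
    (hWS : ∀ a, a ∈ insert x (insert y R) ↔ a ∉ ({i, j, k} : Finset V)) :
    ∃ g ∈ R, ∃ e ∈ R, G.Adj g e ∧ g ≠ u ∧ g ≠ v ∧ e ≠ u ∧ e ≠ v ∧
      (G.Adj i g ∨ G.Adj j g ∨ G.Adj k g) ∧ (G.Adj i e ∨ G.Adj j e ∨ G.Adj k e) ∧
      D2 G (insert x (insert y R)) g ∧ D2 G (insert x (insert y R)) e := by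
  obtain ⟨U, hU, hUR, hu, hv⟩ :=
    exists_leaf_in hK h4 hR hx hy hu hv huv hxu hxy hyv hxR hyR hij hjk hik hWS
  obtain ⟨g, hg, e, he, hge⟩ := hU.exists_edge
  have att : ∀ g ∈ U, G.Adj i g ∨ G.Adj j g ∨ G.Adj k g := fun g hg => by
    obtain ⟨a, ha, h⟩ := hU.att g hg
    simp at ha; rcases ha with rfl | rfl | rfl <;> simp [h.symm]
  refine ⟨g, hUR hg, e, hUR he, hge, ?_, ?_, ?_, ?_, att g hg, att e he, hU.d2 hg, hU.d2 he⟩ <;>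
    (rintro rfl; contradiction)

/-- The configuration left when all ears have two vertices. -/
structure Conf (G : SimpleGraph V) (M : Finset V) (w1 w2 w3 p1 p2 q1 q2 a1 b1 a2 b2 : V) : Prop where
  cov : ∀ v, v ∈ M ∨ v = w1 ∨ v = w2 ∨ v = w3 ∨ v = p1 ∨ v = p2 ∨ v = q1 ∨ v = q2
  nd : [w1, w2, w3, p1, p2, q1, q2].Nodup
  nm : ∀ v ∈ M, v ∉ [w1, w2, w3, p1, p2, q1, q2]
  w12 : G.Adj w1 w2
  w23 : G.Adj w2 w3
  pp : G.Adj p1 p2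
  qq : G.Adj q1 q2
  pa : G.Adj p1 a1
  pb : G.Adj p2 b1
  qa : G.Adj q1 a2
  qb : G.Adj q2 b2
  ma1 : a1 ∈ M
  mb1 : b1 ∈ M
  ma2 : a2 ∈ M
  mb2 : b2 ∈ M
  ab1 : a1 ≠ b1
  ab2 : a2 ≠ b2
  tcP : TC G (M ∪ {p1, p2})
  tcF : TC G (M ∪ {q1, q2})

namespace Conf
variable {M : Finset V} {w1 w2 w3 p1 p2 q1 q2 a1 b1 a2 b2 : V}

lemma swapPF (h : Conf G M w1 w2 w3 p1 p2 q1 q2 a1 b1 a2 b2) :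
    Conf G M w1 w2 w3 q1 q2 p1 p2 a2 b2 a1 b1 :=
  ⟨fun v => by have := h.cov v; tauto,
    (List.Perm.nodup_iff (((List.perm_append_comm (l₁ := [p1, p2]) (l₂ := [q1, q2])).append_left
      [w1, w2, w3]))).1 h.nd, fun v hv => by have := h.nm v hv; simp at this ⊢; tauto,
    h.w12, h.w23, h.qq, h.pp, h.qa, h.qb, h.pa, h.pb, h.ma2, h.mb2, h.ma1, h.mb1, h.ab2, h.ab1,
    h.tcF, h.tcP⟩

lemma swap13 (h : Conf G M w1 w2 w3 p1 p2 q1 q2 a1 b1 a2 b2) :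
    Conf G M w3 w2 w1 p2 p1 q2 q1 b1 a1 b2 a2 :=
  ⟨fun v => by have := h.cov v; tauto,
    (List.Perm.nodup_iff (((List.reverse_perm [w1, w2, w3]).append
      ((List.reverse_perm [p1, p2]).append (List.reverse_perm [q1, q2]))))).2 h.nd,
    fun v hv => by have := h.nm v hv; simp at this ⊢; tauto,
    h.w23.symm, h.w12.symm, h.pp.symm, h.qq.symm, h.pb, h.pa, h.qb, h.qa, h.mb1, h.ma1, h.mb2, h.ma2,
    h.ab1.symm, h.ab2.symm, by rw [Finset.pair_comm]; exact h.tcP, by rw [Finset.pair_comm]; exact h.tcF⟩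

lemma edge_ck (h : Conf G M w1 w2 w3 p1 p2 q1 q2 a1 b1 a2 b2) (hK : K3 G) (h4 : N4 G)
    (h1p : G.Adj w1 p1) (h3p : G.Adj w3 p2) (h3q : G.Adj w3 q1)
    (n1 : ∀ x, G.Adj w1 x → x = w2 ∨ x = p1 ∨ x = q1)
    (n2 : ∀ x, G.Adj w2 x → x = w1 ∨ x = w3 ∨ x = q2)
    (n3 : ∀ x, G.Adj w3 x → x = w2 ∨ x = p2 ∨ x = q1)
    (np1 : ∀ x, G.Adj p1 x → x = p2 ∨ x = a1 ∨ x = w1)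
    (np2 : ∀ x, G.Adj p2 x → x = p1 ∨ x = b1 ∨ x = w3)
    (nq2 : ∀ x, G.Adj q2 x → x = q1 ∨ x = b2 ∨ x = w2) : a1 = b2 := by
  have nd := h.nd
  have nm := h.nm
  simp at nd nm
  obtain ⟨g, hg, e, he, hge, hgu, hgv, heu, hev, hga, hea, -, -⟩ :=
    exists_edge_in hK h4 h.tcF (x := p2) (y := w3) (u := b1) (v := q1) (i := p1) (j := w1) (k := w2)
    (by simp; grind) (by simp; grind) (by simp [h.mb1]) (by simp) (by have := h.mb1; grind) h.pb h3p.symm h3q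
    (fun z hz hz' => by have := np2 z hz'; simp at hz; grind)
    (fun z hz hz' => by have := n3 z hz'; simp at hz; grind) h1p.symm h.w12 (by grind)
    (fun a => by have := h.cov a; simp; grind)
  simp at hg he
  have hg' : g = a1 ∨ g = q2 := by have := n1 g; have := n2 g; have := np1 g; grind
  have he' : e = a1 ∨ e = q2 := by have := n1 e; have := n2 e; have := np1 e; grind
  have := h.ma1
  have l := hge.ne
  rcases hg' with rfl | rfl <;> rcases he' with rfl | rfl
  · exact absurd rfl l
  · have := nq2 _ hge.symm; grind
  · have := nq2 _ hge; grind
  · exact absurd rfl l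

lemma not_ck (h : Conf G M w1 w2 w3 p1 p2 q1 q2 a1 b1 a2 b2) (hK : K3 G) (h4 : N4 G)
    (h1p : G.Adj w1 p1) (h3p : G.Adj w3 p2) (h1q : G.Adj w1 q1) (h3q : G.Adj w3 q1)
    (n1 : ∀ x, G.Adj w1 x → x = w2 ∨ x = p1 ∨ x = q1)
    (n2 : ∀ x, G.Adj w2 x → x = w1 ∨ x = w3 ∨ x = q2)
    (n3 : ∀ x, G.Adj w3 x → x = w2 ∨ x = p2 ∨ x = q1)
    (np1 : ∀ x, G.Adj p1 x → x = p2 ∨ x = a1 ∨ x = w1)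
    (np2 : ∀ x, G.Adj p2 x → x = p1 ∨ x = b1 ∨ x = w3)
    (nq2 : ∀ x, G.Adj q2 x → x = q1 ∨ x = b2 ∨ x = w2) : False := by
  have e1 := h.edge_ck hK h4 h1p h3p h3q n1 n2 n3 np1 np2 nq2
  have h' : Conf G M w3 w2 w1 p2 p1 q1 q2 b1 a1 a2 b2 :=
    ⟨fun v => by have := h.cov v; tauto,
    (List.Perm.nodup_iff (((List.reverse_perm [w1, w2, w3]).append
      ((List.reverse_perm [p1, p2]).append (List.Perm.refl [q1, q2]))))).2 h.nd,
    fun v hv => by have := h.nm v hv; simp at this ⊢; tauto,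
    h.w23.symm, h.w12.symm, h.pp.symm, h.qq, h.pb, h.pa, h.qa, h.qb, h.mb1, h.ma1, h.ma2, h.mb2,
    h.ab1.symm, h.ab2, by rw [Finset.pair_comm]; exact h.tcP, h.tcF⟩
  have e2 := h'.edge_ck hK h4 h3p h1p h1q n3 (fun x hx => by have := n2 x hx; tauto) n1 np2 np1 nq2
  exact h.ab1 (e1.trans e2.symm)

lemma not_kk (h : Conf G M w1 w2 w3 p1 p2 q1 q2 a1 b1 a2 b2) (hK : K3 G) (h4 : N4 G)
    (h1p : G.Adj w1 p1) (h3p : G.Adj w3 p1) (h1q : G.Adj w1 q1) (h3q : G.Adj w3 q1)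
    (h2p : G.Adj w2 p2) (h2q : G.Adj w2 q2)
    (n1 : ∀ x, G.Adj w1 x → x = w2 ∨ x = p1 ∨ x = q1)
    (n2 : ∀ x, G.Adj w2 x → x = w1 ∨ x = w3 ∨ x = p2 ∨ x = q2)
    (n3 : ∀ x, G.Adj w3 x → x = w2 ∨ x = p1 ∨ x = q1)
    (np1 : ∀ x, G.Adj p1 x → x = p2 ∨ x = a1 ∨ x = w1 ∨ x = w3)
    (np2 : ∀ x, G.Adj p2 x → x = p1 ∨ x = b1 ∨ x = w2)
    (nq1 : ∀ x, G.Adj q1 x → x = q2 ∨ x = a2 ∨ x = w1 ∨ x = w3)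
    (nq2 : ∀ x, G.Adj q2 x → x = q1 ∨ x = b2 ∨ x = w2) : False := by
  have nd := h.nd
  have nm := h.nm
  simp at nd nm
  have hb : b1 = b2 := by
    obtain ⟨g, hg, e, he, hge, hgu, hgv, heu, hev, hga, hea, -, -⟩ :=
      exists_edge_in hK h4 h.tcP (x := q1) (y := w1) (u := a2) (v := p1) (i := w3) (j := w2) (k := q2)
      (by simp; grind) (by simp; grind) (by simp [h.ma2]) (by simp) (by have := h.ma2; grind) h.qa h1q.symm h1p
      (fun z hz hz' => by have := nq1 z hz'; simp at hz; grind)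
      (fun z hz hz' => by have := n1 z hz'; simp at hz; grind) h.w23.symm h2q (by grind)
      (fun a => by have := h.cov a; simp; grind)
    simp at hg he
    have hg' : g = p2 ∨ g = b2 := by have := n3 g; have := n2 g; have := nq2 g; grind
    have he' : e = p2 ∨ e = b2 := by have := n3 e; have := n2 e; have := nq2 e; grind
    have := h.mb2
    have l := hge.ne
    rcases hg' with rfl | rfl <;> rcases he' with rfl | rfl
    · exact absurd rfl l
    · have := np2 _ hge; grind
    · have := np2 _ hge.symm; grind
    · exact absurd rfl l
  have ha : a1 = a2 := by
    obtain ⟨g, hg, e, he, hge, hgu, hgv, heu, hev, hga, hea, -, -⟩ :=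
      exists_edge_in hK h4 h.tcF (x := p2) (y := w2) (u := b1) (v := q2) (i := w1) (j := p1) (k := w3)
      (by simp; grind) (by simp; grind) (by simp [h.mb1]) (by simp) (by have := h.mb1; grind) h.pb h2p.symm h2q
      (fun z hz hz' => by have := np2 z hz'; simp at hz; grind)
      (fun z hz hz' => by have := n2 z hz'; simp at hz; grind) h1p h3p.symm (by grind)
      (fun a => by have := h.cov a; simp; grind)
    simp at hg he
    have hg' : g = a1 ∨ g = q1 := by have := n3 g; have := n1 g; have := np1 g; grind
    have he' : e = a1 ∨ e = q1 := by have := n3 e; have := n1 e; have := np1 e; grind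
    have := h.ma1
    have l := hge.ne
    rcases hg' with rfl | rfl <;> rcases he' with rfl | rfl
    · exact absurd rfl l
    · have := nq1 _ hge.symm; grind
    · have := nq1 _ hge; grind
    · exact absurd rfl l
  subst hb
  subst ha
  have hM : ∀ v ∈ M, v = a1 ∨ v = b1 := by
    by_contra hcon
    push Not at hcon
    obtain ⟨v, hv, hva, hvb⟩ := hcon
    obtain ⟨x, hx, y, hy, hya, hyb, hxy⟩ := hK (M \ {a1, b1}) ⟨v, by simp [hv, hva, hvb]⟩ a1 b1
      ⟨w1, by simp; intro h'; have := nm _ h'; grind, fun h' => by have := nm _ h.ma1; grind,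
        fun h' => by have := nm _ h.mb1; grind⟩
    simp at hx hy
    have := nm x hx.1
    have hyM : y ∉ M := fun h' => hyb (hy h' hya)
    rcases h.cov y with h' | rfl | rfl | rfl | rfl | rfl | rfl | rfl
    · exact hyM h'
    · have := n1 _ hxy.symm; grind
    · have := n2 _ hxy.symm; grind
    · have := n3 _ hxy.symm; grind
    · have := np1 _ hxy.symm; grind
    · have := np2 _ hxy.symm; grind
    · have := nq1 _ hxy.symm; grind
    · have := nq2 _ hxy.symm; grind
  have ma := nm _ h.ma1
  have mb := nm _ h.mb1
  have hT : TC G (insert w3 {p1, a1, q1, w1}) :=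
    (TC.cycle4 h.pa h.qa.symm h1q.symm h1p (by grind) (by grind)).add_one (u := p1) (v := q1) (by simp)
      (by simp) (by grind) h3p h3q
  refine h4 {b1, p2, w2, q2} _ ?_ (Cn.path4 h.pb.symm h2p.symm h2q) (fun v => ?_) hT
  · rw [Finset.card_insert_of_notMem (by simp; grind), Finset.card_eq_three.2 ⟨p2, w2, q2, by grind, by grind, by grind, rfl⟩]
  · have c := h.cov v
    have := hM v
    have := h.ab1
    simp; grind

end Conf

/-- Removing an ear parallel to an edge preserves `2`-connectedness. -/
lemma TC.drop_ear {R : Finset V} {x y u v : V} (h : TC G (insert x (insert y R))) (hx : x ∉ R)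
    (hy : y ∉ R) (hu : u ∈ R) (hv : v ∈ R) (huv : G.Adj u v)
    (hxR : ∀ z ∈ R, G.Adj x z → z = u) (hyR : ∀ z ∈ R, G.Adj y z → z = v) (h3 : 3 ≤ R.card) :
    TC G R := by
  have key : ∀ J ⊆ R, ∀ j ∈ J, ∀ w ∈ insert x (insert y R), G.Adj j w →
      w ∈ R ∨ (w = x ∧ j = u) ∨ (w = y ∧ j = v) := fun J hJ j hj w hw hjw => by
    simp at hw
    rcases hw with rfl | rfl | hw
    · exact Or.inr (Or.inl ⟨rfl, hxR j (hJ hj) hjw.symm⟩)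
    · exact Or.inr (Or.inr ⟨rfl, hyR j (hJ hj) hjw.symm⟩)
    · exact Or.inl hw
  have key2 : ∀ w ∈ insert x (insert y R), ∀ j ∈ ({x, y} : Finset V), G.Adj j w →
      w = x ∨ w = y ∨ w = u ∨ w = v := fun w hw j hj hjw => by
    simp at hw hj
    rcases hw with rfl | rfl | hw
    · simp
    · simp
    · rcases hj with rfl | rfl
      · simp [hxR w hw hjw]
      · simp [hyR w hw hjw]
  have big : ∀ J ⊆ R, J.Nonempty → ∀ c ∈ R, c ∉ J → (∀ j ∈ J, ∀ w ∈ R, G.Adj j w → w ∈ J ∨ w = c) →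
      (u ∈ J ∨ u = c) → (v ∈ J ∨ v = c) → ∀ w ∈ R, w ∈ J ∨ w = c := by
    intro J hJ hne c hc hcJ hcl hu' hv' w hw
    have := h.2 (J ∪ {x, y}) (by
        intro a ha
        simp at ha ⊢
        rcases ha with ha | ha | ha
        · exact Or.inl ha
        · exact Or.inr (Or.inl ha)
        · exact Or.inr (Or.inr (hJ ha))) (hne.mono Finset.subset_union_left) c
      (by simp; exact ⟨fun e => hx (e ▸ hc), fun e => hy (e ▸ hc), hcJ⟩) (fun j hj b hb hjb => by
        rcases Finset.mem_union.1 hj with hj | hj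
        · rcases key J hJ j hj b hb hjb with h' | h' | h'
          · rcases hcl j hj b h' hjb with h' | h' <;> simp [h']
          · simp [h'.1]
          · simp [h'.1]
        · rcases key2 b hb j hj hjb with rfl | rfl | rfl | rfl
          · simp
          · simp
          · rcases hu' with h' | h' <;> simp [h']
          · rcases hv' with h' | h' <;> simp [h']) w (by simp [hw])
    simp at this
    rcases this with (rfl | rfl | h') | h'
    · exact absurd hw hx
    · exact absurd hw hy
    · exact Or.inl h'
    · exact Or.inr h'
  refine ⟨h3, fun J hJ hne c hcJ hcl w hw => ?_⟩
  by_cases hc : c ∈ R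
  · by_cases huJ : u ∈ J
    · exact big J hJ hne c hc hcJ hcl (Or.inl huJ) (hcl u huJ v hv huv) w hw
    · by_cases hvJ : v ∈ J
      · exact big J hJ hne c hc hcJ hcl (hcl v hvJ u hu huv.symm) (Or.inl hvJ) w hw
      · refine h.2 J (hJ.trans fun a ha => by simp [ha]) hne c hcJ (fun j hj b hb hjb => ?_) w
          (by simp [hw])
        rcases key J hJ j hj b hb hjb with h' | h' | h'
        · exact hcl j hj b h' hjb
        · exact absurd (h'.2 ▸ hj) huJ
        · exact absurd (h'.2 ▸ hj) hvJ
  · have hcl' : ∀ j ∈ J, ∀ w ∈ R, G.Adj j w → w ∈ J := fun j hj b hb hjb =>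
      (hcl j hj b hb hjb).resolve_right fun e => hc (e ▸ hb)
    by_contra hcon
    push Not at hcon
    by_cases huJ : u ∈ J
    · have hvJ := hcl' u huJ v hv huv
      have h2 := h.cn.2 (J ∪ {x, y}) (by
        intro a ha
        simp at ha ⊢
        rcases ha with ha | ha | ha
        · exact Or.inl ha
        · exact Or.inr (Or.inl ha)
        · exact Or.inr (Or.inr (hJ ha))) (hne.mono Finset.subset_union_left) (fun j hj b hb hjb => by
          rcases Finset.mem_union.1 hj with hj | hj
          · rcases key J hJ j hj b hb hjb with h' | h' | h'
            · simp [hcl' j hj b h' hjb]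
            · simp [h'.1]
            · simp [h'.1]
          · rcases key2 b hb j hj hjb with rfl | rfl | rfl | rfl <;> simp [huJ, hvJ]) w (by simp [hw])
      simp at h2
      rcases h2 with rfl | rfl | h'
      · exact hx hw
      · exact hy hw
      · exact hcon.1 h'
    · have hvJ : v ∉ J := fun h' => huJ (hcl' v h' u hu huv.symm)
      refine hcon.1 (h.cn.2 J (hJ.trans fun a ha => by simp [ha]) hne (fun j hj b hb hjb => ?_) w
        (by simp [hw]))
      rcases key J hJ j hj b hb hjb with h' | h' | h'
      · exact hcl' j hj b h' hjb
      · exact absurd (h'.2 ▸ hj) huJ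
      · exact absurd (h'.2 ▸ hj) hvJ

namespace Conf
variable {M : Finset V} {w1 w2 w3 p1 p2 q1 q2 a1 b1 a2 b2 z : V}

lemma edge_cc (h : Conf G M w1 w2 w3 p1 p2 q1 q2 a1 b1 a2 b2) (hK : K3 G) (h4 : N4 G)
    (h1p : G.Adj w1 p1) (h3p : G.Adj w3 p2) (h3q : G.Adj w3 q2) (hz : z ∈ M)
    (n1 : ∀ x, G.Adj w1 x → x = w2 ∨ x = p1 ∨ x = q1)
    (n2 : ∀ x, G.Adj w2 x → x = w1 ∨ x = w3 ∨ x = z)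
    (n3 : ∀ x, G.Adj w3 x → x = w2 ∨ x = p2 ∨ x = q2)
    (np1 : ∀ x, G.Adj p1 x → x = p2 ∨ x = a1 ∨ x = w1)
    (np2 : ∀ x, G.Adj p2 x → x = p1 ∨ x = b1 ∨ x = w3)
    (nq1 : ∀ x, G.Adj q1 x → x = q2 ∨ x = a2 ∨ x = w1) :
    a1 = a2 ∨ z = a2 ∨ (G.Adj a1 z ∧ D2 G (insert p2 (insert w3 (M ∪ {q1, q2}))) a1 ∧
      D2 G (insert p2 (insert w3 (M ∪ {q1, q2}))) z) := by
  have nd := h.nd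
  have nm := h.nm
  simp at nd nm
  obtain ⟨g, hg, e, he, hge, hgu, hgv, heu, hev, hga, hea, hgd, hed⟩ :=
    exists_edge_in hK h4 h.tcF (x := p2) (y := w3) (u := b1) (v := q2) (i := p1) (j := w1) (k := w2)
    (by simp; grind) (by simp; grind) (by simp [h.mb1]) (by simp) (by have := h.mb1; grind) h.pb h3p.symm h3q
    (fun z hz hz' => by have := np2 z hz'; simp at hz; grind)
    (fun z hz hz' => by have := n3 z hz'; simp at hz; grind) h1p.symm h.w12 (by grind)
    (fun a => by have := h.cov a; simp; grind)
  simp at hg he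
  have hg' : g = a1 ∨ g = q1 ∨ g = z := by have := n1 g; have := n2 g; have := np1 g; grind
  have he' : e = a1 ∨ e = q1 ∨ e = z := by have := n1 e; have := n2 e; have := np1 e; grind
  have := h.ma1
  have l := hge.ne
  rcases hg' with rfl | rfl | rfl <;> rcases he' with rfl | rfl | rfl
  · exact absurd rfl l
  · have := nq1 _ hge.symm; grind
  · exact Or.inr (Or.inr ⟨hge, hgd, hed⟩)
  · have := nq1 _ hge; grind
  · exact absurd rfl l
  · have := nq1 _ hge; grind
  · exact Or.inr (Or.inr ⟨hge.symm, hed, hgd⟩)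
  · have := nq1 _ hge.symm; grind
  · exact absurd rfl l

lemma edges_cc (h : Conf G M w1 w2 w3 p1 p2 q1 q2 a1 b1 a2 b2) (hK : K3 G) (h4 : N4 G)
    (h1p : G.Adj w1 p1) (h3p : G.Adj w3 p2) (h1q : G.Adj w1 q1) (h3q : G.Adj w3 q2) (hz : z ∈ M)
    (n1 : ∀ x, G.Adj w1 x → x = w2 ∨ x = p1 ∨ x = q1)
    (n2 : ∀ x, G.Adj w2 x → x = w1 ∨ x = w3 ∨ x = z)
    (n3 : ∀ x, G.Adj w3 x → x = w2 ∨ x = p2 ∨ x = q2)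
    (np1 : ∀ x, G.Adj p1 x → x = p2 ∨ x = a1 ∨ x = w1)
    (np2 : ∀ x, G.Adj p2 x → x = p1 ∨ x = b1 ∨ x = w3)
    (nq1 : ∀ x, G.Adj q1 x → x = q2 ∨ x = a2 ∨ x = w1)
    (nq2 : ∀ x, G.Adj q2 x → x = q1 ∨ x = b2 ∨ x = w3) (hne : a1 ≠ a2) :
    z ≠ a1 ∧ z ≠ a2 ∧ G.Adj a1 z ∧ G.Adj a2 z ∧
      D2 G (insert p2 (insert w3 (M ∪ {q1, q2}))) a1 ∧
      D2 G (insert p2 (insert w3 (M ∪ {q1, q2}))) z ∧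
      D2 G (insert q2 (insert w3 (M ∪ {p1, p2}))) a2 := by
  have e1 := h.edge_cc hK h4 h1p h3p h3q hz n1 n2 n3 np1 np2 nq1
  have e2 := h.swapPF.edge_cc hK h4 h1q h3q h3p hz (fun x hx => by have := n1 x hx; tauto) n2
    (fun x hx => by have := n3 x hx; tauto) nq1 nq2 np1
  have e1 := e1.resolve_left hne
  have e2 := e2.resolve_left hne.symm
  have z1 : z ≠ a1 := by
    rintro rfl
    exact G.loopless.irrefl _ (e1.resolve_left hne).1
  have z2 : z ≠ a2 := by
    rintro rfl
    exact G.loopless.irrefl _ (e2.resolve_left hne.symm).1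
  have e1 := e1.resolve_left z2
  have e2 := e2.resolve_left z1
  exact ⟨z1, z2, e1.1, e2.1, e1.2.1, e1.2.2, e2.2.1⟩

end Conf

lemma card_four {a b c d : V} (h : [a, b, c, d].Nodup) : ({a, b, c, d} : Finset V).card = 4 := by
  simp at h
  rw [Finset.card_insert_of_notMem (by simp; grind),
    Finset.card_eq_three.2 ⟨b, c, d, by grind, by grind, by grind, rfl⟩]

namespace Conf
variable {M : Finset V} {w1 w2 w3 p1 p2 q1 q2 a1 b1 a2 b2 z : V}

lemma not_cc_ne (h : Conf G M w1 w2 w3 p1 p2 q1 q2 a1 b1 a2 b2) (hK : K3 G) (h4 : N4 G)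
    (h1p : G.Adj w1 p1) (h3p : G.Adj w3 p2) (h1q : G.Adj w1 q1) (h3q : G.Adj w3 q2) (hz : z ∈ M)
    (n1 : ∀ x, G.Adj w1 x → x = w2 ∨ x = p1 ∨ x = q1)
    (n2 : ∀ x, G.Adj w2 x → x = w1 ∨ x = w3 ∨ x = z)
    (n3 : ∀ x, G.Adj w3 x → x = w2 ∨ x = p2 ∨ x = q2)
    (np1 : ∀ x, G.Adj p1 x → x = p2 ∨ x = a1 ∨ x = w1)
    (np2 : ∀ x, G.Adj p2 x → x = p1 ∨ x = b1 ∨ x = w3)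
    (nq1 : ∀ x, G.Adj q1 x → x = q2 ∨ x = a2 ∨ x = w1)
    (nq2 : ∀ x, G.Adj q2 x → x = q1 ∨ x = b2 ∨ x = w3) (ha : a1 ≠ a2) (hb : b1 ≠ b2) : False := by
  have nd := h.nd
  have nm := h.nm
  simp at nd nm
  obtain ⟨z1, z2, az1, az2, d1, dz, d2⟩ :=
    h.edges_cc hK h4 h1p h3p h1q h3q hz n1 n2 n3 np1 np2 nq1 nq2 ha
  obtain ⟨y1, y2, bz1, bz2, -⟩ :=
    h.swap13.edges_cc hK h4 h3p h1p h3q h1q hz n3 (fun x hx => by have := n2 x hx; tauto) n1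
      np2 np1 nq2 nq1 hb
  have mS : ∀ x ∈ M, x ∈ insert p2 (insert w3 (M ∪ {q1, q2})) := fun x hx => by simp [hx]
  have mS' : ∀ x ∈ M, x ∈ insert q2 (insert w3 (M ∪ {p1, p2})) := fun x hx => by simp [hx]
  have e1 : b1 = a2 := by
    have := dz a1 (mS _ h.ma1) a2 (mS _ h.ma2) b1 (mS _ h.mb1) az1.symm az2.symm bz1.symm
    have := h.ab1
    grind
  have e2 : b2 = a1 := by
    have := dz a1 (mS _ h.ma1) a2 (mS _ h.ma2) b2 (mS _ h.mb2) az1.symm az2.symm bz2.symm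
    have := h.ab2
    grind
  have qb := h.qb
  have pb := h.pb
  rw [e2] at qb
  rw [e1] at pb
  have m1 := nm _ h.ma1
  have m2 := nm _ h.ma2
  have mz := nm _ hz
  have hM : ∀ v ∈ M, v = a1 ∨ v = z ∨ v = a2 := by
    by_contra hcon
    push Not at hcon
    obtain ⟨v, hv, hva, hvb, hvc⟩ := hcon
    obtain ⟨x, hx, y, hy, -, -, hxy⟩ := hK (M \ {a1, z, a2}) ⟨v, by simp [hv, hva, hvb, hvc]⟩ a1 a1
      ⟨w1, fun h' => (nm _ (Finset.mem_sdiff.1 h').1).1 rfl, by grind, by grind⟩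
    simp at hx hy
    have mx := nm x hx.1
    rcases h.cov y with h' | rfl | rfl | rfl | rfl | rfl | rfl | rfl
    · by_cases i1 : y = a1
      · have := d1 x (mS _ hx.1) z (mS _ hz) q2 (by simp) (i1 ▸ hxy.symm) az1 qb.symm
        grind
      by_cases i2 : y = z
      · have := dz x (mS _ hx.1) a1 (mS _ h.ma1) a2 (mS _ h.ma2) (i2 ▸ hxy.symm) az1.symm az2.symm
        grind
      have i3 := hy h' i1 i2
      have := d2 x (mS' _ hx.1) z (mS' _ hz) p2 (by simp) (i3 ▸ hxy.symm) az2 pb.symm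
      grind
    · have := n1 _ hxy.symm; grind
    · have := n2 _ hxy.symm; grind
    · have := n3 _ hxy.symm; grind
    · have := np1 _ hxy.symm; grind
    · have := np2 _ hxy.symm; grind
    · have := nq1 _ hxy.symm; grind
    · have := nq2 _ hxy.symm; grind
  refine h4 {w2, q1, w1, p1} {a1, z, a2, p2, w3, q2} (card_four (by simp; grind))
    (((Cn.pair h1p).insert_adj (by simp) h1q).insert_adj (x := w1) (by simp) h.w12) (fun v => ?_)
    (TC.cycle6 az1 az2.symm pb.symm h3p.symm h3q qb (by simp; grind))
  have c := h.cov v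
  have := hM v
  simp; grind

set_option maxHeartbeats 1000000 in
lemma not_cc_eq_ne (h : Conf G M w1 w2 w3 p1 p2 q1 q2 a1 b1 a2 b2) (hK : K3 G) (h4 : N4 G)
    (h1p : G.Adj w1 p1) (h3p : G.Adj w3 p2) (h1q : G.Adj w1 q1) (h3q : G.Adj w3 q2) (hz : z ∈ M)
    (hwz : G.Adj w2 z)
    (n1 : ∀ x, G.Adj w1 x → x = w2 ∨ x = p1 ∨ x = q1)
    (n2 : ∀ x, G.Adj w2 x → x = w1 ∨ x = w3 ∨ x = z)
    (n3 : ∀ x, G.Adj w3 x → x = w2 ∨ x = p2 ∨ x = q2)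
    (np1 : ∀ x, G.Adj p1 x → x = p2 ∨ x = a1 ∨ x = w1)
    (np2 : ∀ x, G.Adj p2 x → x = p1 ∨ x = b1 ∨ x = w3)
    (nq1 : ∀ x, G.Adj q1 x → x = q2 ∨ x = a2 ∨ x = w1)
    (nq2 : ∀ x, G.Adj q2 x → x = q1 ∨ x = b2 ∨ x = w3) (ha : a1 = a2) (hb : b1 ≠ b2) : False := by
  subst ha
  have nd := h.nd
  have nm := h.nm
  simp at nd nm
  obtain ⟨y1, y2, bz1, bz2, -⟩ :=
    h.swap13.edges_cc hK h4 h3p h1p h3q h1q hz n3 (fun x hx => by have := n2 x hx; tauto) n1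
      np2 np1 nq2 nq1 hb
  have m1 := nm _ h.ma1
  have m2 := nm _ h.mb1
  have m3 := nm _ h.mb2
  have mz := nm _ hz
  obtain ⟨U, hU, hUR, hu, hv⟩ :=
    exists_leaf_in hK h4 h.tcF (x := p1) (y := w1) (u := a1) (v := q1) (i := p2) (j := w3) (k := w2)
    (by simp; grind) (by simp; grind) (by simp [h.ma1]) (by simp) (by grind) h.pa h1p.symm h1q
    (fun z hz hz' => by have := np1 z hz'; simp at hz; grind)
    (fun z hz hz' => by have := n1 z hz'; simp at hz; grind) h3p.symm h.w23.symm (by grind)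
    (fun a => by have := h.cov a; simp; grind)
  set R := M ∪ {q1, q2} with hR
  have mR : ∀ x, x ∈ R ↔ x ∈ M ∨ x = q1 ∨ x = q2 := fun x => by simp [hR]; tauto
  have hU1 : ∀ x ∈ U, x = b1 ∨ x = q2 ∨ x = z := fun x hx => by
    obtain ⟨a, ha, hax⟩ := hU.att x hx
    have := (mR x).1 (hUR hx)
    simp at ha
    rcases ha with rfl | rfl | rfl
    · have := np2 _ hax.symm; grind
    · have := n3 _ hax.symm; grind
    · have := n2 _ hax.symm; grind
  have hq2 : q2 ∉ U := fun hq => by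
    obtain ⟨p, hp, q, hq', s, hs, t, ht, hpq, hst, -, -, hends⟩ := hU.ends
    have i1 := hends q2 hq q1 (by simp [(mR q1).2 (by simp), hv]) h.qq.symm
    have i2 := hends q2 hq b2 (by
      simp [(mR b2).2 (by simp [h.mb2])]; intro h'; have := hU1 _ h'; grind) h.qb
    grind
  have hU2 : ∀ x ∈ U, x = b1 ∨ x = z := fun x hx => by
    have := hU1 x hx; grind
  obtain ⟨g, hg, e, he, hge⟩ := hU.exists_edge
  have hbU : b1 ∈ U ∧ z ∈ U := by
    have l := hge.ne
    have := hU2 g hg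
    have := hU2 e he
    grind
  have hUm : ∀ x, x ∈ U ↔ x = b1 ∨ x = z := fun x => ⟨hU2 x, by grind⟩
  have nU : ∀ x, x ∉ R → x ∉ U := fun x hx hxU => hx (hUR hxU)
  have hp1R : p1 ∉ R := by rw [mR]; grind
  have hw1R : w1 ∉ R := by rw [mR]; grind
  have heq : insert p1 (insert w1 R) \ U = insert p1 (insert w1 (R \ U)) := by
    rw [Finset.insert_sdiff_of_notMem _ (nU _ hp1R), Finset.insert_sdiff_of_notMem _ (nU _ hw1R)]
  have ht := hU.tcR
  rw [heq] at ht
  have mRU : ∀ x, x ∈ R \ U ↔ (x ∈ M ∨ x = q1 ∨ x = q2) ∧ x ≠ b1 ∧ x ≠ z := fun x => by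
    rw [Finset.mem_sdiff, mR, hUm]; tauto
  have ha1 : a1 ≠ b1 ∧ a1 ≠ z := by rw [hUm] at hu; tauto
  have hT : TC G (R \ U) := by
    refine ht.drop_ear (u := a1) (v := q1) (by rw [mRU]; grind) (by rw [mRU]; grind)
      (by rw [mRU]; exact ⟨Or.inl h.ma1, ha1⟩) (by rw [mRU]; grind) h.qa.symm (fun x hx hpx => ?_)
      (fun x hx hpx => ?_) ?_
    · rw [mRU] at hx; have := np1 x hpx; grind
    · rw [mRU] at hx; have := n1 x hpx; grind
    · rw [← Finset.card_eq_three.2 ⟨a1, q1, q2, by grind, by grind, by grind, rfl⟩]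
      refine Finset.card_le_card fun x hx => ?_
      have := h.ma1
      simp only [Finset.mem_insert, Finset.mem_singleton] at hx
      rw [mRU]; grind
  have hT' := hT.add_three (x := p1) (y := p2) (z := w3) (u := a1) (v := q2) (by rw [mRU]; grind)
    (by rw [mRU]; grind) (by rw [mRU]; grind) (by grind) (by rw [mRU]; exact ⟨Or.inl h.ma1, ha1⟩)
    (by rw [mRU]; grind) (by grind) h.pa h.pp h3p.symm h3q
  refine h4 {b1, z, w2, w1} _ (card_four (by simp; grind)) (Cn.path4 bz1 hwz.symm h.w12.symm)
    (fun v => ?_) hT'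
  have c := h.cov v
  simp only [Finset.mem_insert, Finset.mem_singleton, mRU]; grind

lemma not_cc_eq_eq (h : Conf G M w1 w2 w3 p1 p2 q1 q2 a1 b1 a2 b2) (hK : K3 G) (h4 : N4 G)
    (h1p : G.Adj w1 p1) (h3p : G.Adj w3 p2) (h1q : G.Adj w1 q1) (h3q : G.Adj w3 q2) (hz : z ∈ M)
    (hwz : G.Adj w2 z)
    (n1 : ∀ x, G.Adj w1 x → x = w2 ∨ x = p1 ∨ x = q1)
    (n2 : ∀ x, G.Adj w2 x → x = w1 ∨ x = w3 ∨ x = z)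
    (n3 : ∀ x, G.Adj w3 x → x = w2 ∨ x = p2 ∨ x = q2)
    (np1 : ∀ x, G.Adj p1 x → x = p2 ∨ x = a1 ∨ x = w1)
    (np2 : ∀ x, G.Adj p2 x → x = p1 ∨ x = b1 ∨ x = w3)
    (nq1 : ∀ x, G.Adj q1 x → x = q2 ∨ x = a2 ∨ x = w1)
    (nq2 : ∀ x, G.Adj q2 x → x = q1 ∨ x = b2 ∨ x = w3) (ha : a1 = a2) (hb : b1 = b2)
    (hza : z ≠ a1) : False := by
  subst ha hb
  have nd := h.nd
  have nm := h.nm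
  simp at nd nm
  have m1 := nm _ h.ma1
  have m2 := nm _ h.mb1
  have mz := nm _ hz
  have hab := h.ab1
  set T := M.erase a1 ∪ {w2, p2, w3, q2} with hTd
  have mT : ∀ x, x ∈ T ↔ (x ∈ M ∧ x ≠ a1) ∨ x = w2 ∨ x = p2 ∨ x = w3 ∨ x = q2 := fun x => by
    simp [hTd]; tauto
  have hT : TC G T := by
    refine (TC.cycle4 h.pb.symm h3p.symm h3q h.qb (by grind) (by grind)).extend (fun x hx => ?_)
      fun J hJ hd hne => ?_
    · have := h.mb1
      simp only [Finset.mem_insert, Finset.mem_singleton] at hx; rw [mT]; grind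
    have hJ' : ∀ x ∈ J, (x ∈ M ∧ x ≠ a1 ∧ x ≠ b1) ∨ x = w2 := fun x hx => by
      have i1 := (mT x).1 (hJ hx)
      have i2 := Finset.disjoint_left.1 hd hx
      simp only [Finset.mem_insert, Finset.mem_singleton] at i2; grind
    have out : ∀ x ∈ J, x ≠ w2 → ∀ y, G.Adj x y → y ∈ M ∨ y = w2 := fun x hx hx2 y hxy => by
      have hx' := (hJ' x hx).resolve_right hx2
      have := nm x hx'.1
      rcases h.cov y with h' | rfl | rfl | rfl | rfl | rfl | rfl | rfl
      · exact Or.inl h'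
      · have := n1 _ hxy.symm; grind
      · exact Or.inr rfl
      · have := n3 _ hxy.symm; grind
      · have := np1 _ hxy.symm; grind
      · have := np2 _ hxy.symm; grind
      · have := nq1 _ hxy.symm; grind
      · have := nq2 _ hxy.symm; grind
    have hw3J : w3 ∉ J := fun h' => by have := hJ' _ h'; grind
    have hp1J : p1 ∉ J := fun h' => by have := hJ' _ h'; grind
    have hw1J : w1 ∉ J := fun h' => by have := hJ' _ h'; grind
    have hp2J : p2 ∉ J := fun h' => by have := hJ' _ h'; grind
    by_cases hw2 : w2 ∈ J
    · obtain ⟨x, hx, y, hy, hyT, hyw, hxy⟩ : ∃ x ∈ J, ∃ y, y ∉ J ∧ y ∈ T ∧ y ≠ w3 ∧ G.Adj x y := by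
        by_cases hzJ : z ∈ J
        · obtain ⟨x, hx, y, hy, hya, hyw, hxy⟩ := hK (J.erase w2) ⟨z, by simp [hzJ]; grind⟩ a1 w2
            ⟨p1, by simp [hp1J], by grind, by grind⟩
          simp only [Finset.mem_erase] at hx hy
          have hyM := (out x hx.2 hx.1 y hxy).resolve_right hyw
          have := nm _ hyM
          exact ⟨x, hx.2, y, fun h' => hy ⟨hyw, h'⟩, (mT y).2 (Or.inl ⟨hyM, hya⟩), by grind, hxy⟩
        · exact ⟨w2, hw2, z, hzJ, (mT z).2 (Or.inl ⟨hz, hza⟩), by grind, hwz⟩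
      exact ⟨w3, Finset.mem_sdiff.2 ⟨(mT _).2 (by simp), hw3J⟩, y, Finset.mem_sdiff.2 ⟨hyT, hy⟩,
        hyw.symm, ⟨w2, hw2, h.w23⟩, x, hx, hxy⟩
    · refine hK.twoNb hne (B := {p1, w1, p2}) ?_ ?_ a1 fun x hx y hy hxy => ?_
      · rw [Finset.card_eq_three.2 ⟨p1, w1, p2, by grind, by grind, by grind, rfl⟩]
      · simp [hp1J, hw1J, hp2J]
      · by_cases hya : y = a1
        · exact Or.inr hya
        · have := out x hx (fun e => hw2 (e ▸ hx)) y hxy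
          rw [mT]; tauto
  refine h4 {q1, w1, p1, a1} T (card_four (by simp; grind)) (Cn.path4 h1q.symm h1p h.pa)
    (fun v => ?_) hT
  have c := h.cov v
  have := h.ma1
  simp only [Finset.mem_insert, Finset.mem_singleton, mT]; grind

lemma not_cc (h : Conf G M w1 w2 w3 p1 p2 q1 q2 a1 b1 a2 b2) (hK : K3 G) (h4 : N4 G)
    (h1p : G.Adj w1 p1) (h3p : G.Adj w3 p2) (h1q : G.Adj w1 q1) (h3q : G.Adj w3 q2) (hz : z ∈ M)
    (hwz : G.Adj w2 z)
    (n1 : ∀ x, G.Adj w1 x → x = w2 ∨ x = p1 ∨ x = q1)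
    (n2 : ∀ x, G.Adj w2 x → x = w1 ∨ x = w3 ∨ x = z)
    (n3 : ∀ x, G.Adj w3 x → x = w2 ∨ x = p2 ∨ x = q2)
    (np1 : ∀ x, G.Adj p1 x → x = p2 ∨ x = a1 ∨ x = w1)
    (np2 : ∀ x, G.Adj p2 x → x = p1 ∨ x = b1 ∨ x = w3)
    (nq1 : ∀ x, G.Adj q1 x → x = q2 ∨ x = a2 ∨ x = w1)
    (nq2 : ∀ x, G.Adj q2 x → x = q1 ∨ x = b2 ∨ x = w3) : False := by
  have n2' : ∀ x, G.Adj w2 x → x = w3 ∨ x = w1 ∨ x = z := fun x hx => by have := n2 x hx; tauto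
  by_cases ha : a1 = a2 <;> by_cases hb : b1 = b2
  · by_cases hza : z = a1
    · exact h.swap13.not_cc_eq_eq hK h4 h3p h1p h3q h1q hz hwz n3 n2' n1 np2 np1 nq2 nq1 hb ha
        (fun e => h.ab1 (hza.symm.trans e))
    · exact h.not_cc_eq_eq hK h4 h1p h3p h1q h3q hz hwz n1 n2 n3 np1 np2 nq1 nq2 ha hb hza
  · exact h.not_cc_eq_ne hK h4 h1p h3p h1q h3q hz hwz n1 n2 n3 np1 np2 nq1 nq2 ha hb
  · exact h.swap13.not_cc_eq_ne hK h4 h3p h1p h3q h1q hz hwz n3 n2' n1 np2 np1 nq2 nq1 hb ha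
  · exact h.not_cc_ne hK h4 h1p h3p h1q h3q hz n1 n2 n3 np1 np2 nq1 nq2 ha hb

end Conf

namespace Conf
variable {M : Finset V} {w1 w2 w3 p1 p2 q1 q2 a1 b1 a2 b2 z : V}

lemma side (h : Conf G M w1 w2 w3 p1 p2 q1 q2 a1 b1 a2 b2) (hT : TF G) (h1p : G.Adj w1 p1)
    (h1p2 : ¬ G.Adj w1 p2) (h3 : (G.Adj w3 p1 ∧ ¬ G.Adj w3 p2) ∨ (G.Adj w3 p2 ∧ ¬ G.Adj w3 p1))
    (np1 : ∀ x, G.Adj p1 x → x = p2 ∨ x = a1 ∨ x = w1 ∨ x = w2 ∨ x = w3)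
    (np2 : ∀ x, G.Adj p2 x → x = p1 ∨ x = b1 ∨ x = w1 ∨ x = w2 ∨ x = w3)
    (att : G.Adj w1 p2 ∨ G.Adj w2 p2 ∨ G.Adj w3 p2) :
    (G.Adj w3 p2 ∧ ¬ G.Adj w3 p1 ∧ ¬ G.Adj w2 p1 ∧ ¬ G.Adj w2 p2 ∧
      (∀ x, G.Adj p1 x → x = p2 ∨ x = a1 ∨ x = w1) ∧
      (∀ x, G.Adj p2 x → x = p1 ∨ x = b1 ∨ x = w3)) ∨
    (G.Adj w3 p1 ∧ ¬ G.Adj w3 p2 ∧ ¬ G.Adj w2 p1 ∧ G.Adj w2 p2 ∧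
      (∀ x, G.Adj p1 x → x = p2 ∨ x = a1 ∨ x = w1 ∨ x = w3) ∧
      (∀ x, G.Adj p2 x → x = p1 ∨ x = b1 ∨ x = w2)) := by
  have h21 : ¬ G.Adj w2 p1 := fun h' => hT _ _ _ h.w12 h' h1p
  rcases h3 with ⟨h3, h3'⟩ | ⟨h3, h3'⟩
  · have h22 := (att.resolve_left h1p2).resolve_right h3'
    refine Or.inr ⟨h3, h3', h21, h22, fun x hx => ?_, fun x hx => ?_⟩
    · rcases np1 x hx with h' | h' | h' | rfl | h'
      · simp [h']
      · simp [h']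
      · simp [h']
      · exact absurd hx.symm h21
      · simp [h']
    · rcases np2 x hx with h' | h' | rfl | h' | rfl
      · simp [h']
      · simp [h']
      · exact absurd hx.symm h1p2
      · simp [h']
      · exact absurd hx.symm h3'
  · have h22 : ¬ G.Adj w2 p2 := fun h' => hT _ _ _ h.w23 h3 h'
    refine Or.inl ⟨h3, h3', h21, h22, fun x hx => ?_, fun x hx => ?_⟩
    · rcases np1 x hx with h' | h' | h' | rfl | rfl
      · simp [h']
      · simp [h']
      · simp [h']
      · exact absurd hx.symm h21
      · exact absurd hx.symm h3'
    · rcases np2 x hx with h' | h' | rfl | rfl | h'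
      · simp [h']
      · simp [h']
      · exact absurd hx.symm h1p2
      · exact absurd hx.symm h22
      · simp [h']

set_option maxHeartbeats 1000000 in
lemma false (h : Conf G M w1 w2 w3 p1 p2 q1 q2 a1 b1 a2 b2) (hK : K3 G) (h4 : N4 G) (hT : TF G)
    (h1p : G.Adj w1 p1) (h1q : G.Adj w1 q1)
    (n1 : ∀ x, G.Adj w1 x → x = w2 ∨ x = p1 ∨ x = q1)
    (n3 : ∀ x, G.Adj w3 x → x = w2 ∨ x = p1 ∨ x = p2 ∨ x = q1 ∨ x = q2)
    (n2 : ∃ x, x ≠ w1 ∧ x ≠ w3 ∧ G.Adj w2 x)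
    (n2' : ∀ z ∈ M, G.Adj w2 z → ∀ x, G.Adj w2 x → x = w1 ∨ x = w3 ∨ x = z)
    (h3p : (G.Adj w3 p1 ∧ ¬ G.Adj w3 p2) ∨ (G.Adj w3 p2 ∧ ¬ G.Adj w3 p1))
    (h3q : (G.Adj w3 q1 ∧ ¬ G.Adj w3 q2) ∨ (G.Adj w3 q2 ∧ ¬ G.Adj w3 q1))
    (np1 : ∀ x, G.Adj p1 x → x = p2 ∨ x = a1 ∨ x = w1 ∨ x = w2 ∨ x = w3)
    (np2 : ∀ x, G.Adj p2 x → x = p1 ∨ x = b1 ∨ x = w1 ∨ x = w2 ∨ x = w3)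
    (nq1 : ∀ x, G.Adj q1 x → x = q2 ∨ x = a2 ∨ x = w1 ∨ x = w2 ∨ x = w3)
    (nq2 : ∀ x, G.Adj q2 x → x = q1 ∨ x = b2 ∨ x = w1 ∨ x = w2 ∨ x = w3)
    (attp : G.Adj w1 p2 ∨ G.Adj w2 p2 ∨ G.Adj w3 p2)
    (attq : G.Adj w1 q2 ∨ G.Adj w2 q2 ∨ G.Adj w3 q2) : False := by
  have nd := h.nd
  have nm := h.nm
  simp at nd nm
  have h1p2 : ¬ G.Adj w1 p2 := fun h' => by have := n1 _ h'; grind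
  have h1q2 : ¬ G.Adj w1 q2 := fun h' => by have := n1 _ h'; grind
  have n1' : ∀ x, G.Adj w1 x → x = w2 ∨ x = q1 ∨ x = p1 := fun x hx => by have := n1 x hx; tauto
  have n2M : ∀ y, y ∉ M → y ≠ w1 → y ≠ w3 → G.Adj w2 y → ∀ x, G.Adj w2 x →
      x = w1 ∨ x = w3 ∨ x = p1 ∨ x = p2 ∨ x = q1 ∨ x = q2 := fun y hy hy1 hy3 hwy x hx => by
    rcases h.cov x with h' | h' | rfl | h' | h' | h' | h' | h'
    · rcases n2' x h' hx y hwy with rfl | rfl | rfl <;> contradiction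
    · simp [h']
    · exact absurd hx (G.loopless.irrefl _)
    all_goals simp [h']
  have hpM : ∀ y, y = p2 ∨ y = q2 → y ∉ M ∧ y ≠ w1 ∧ y ≠ w3 := fun y hy =>
    ⟨fun h' => by have := nm y h'; grind, by grind, by grind⟩
  rcases h.side hT h1p h1p2 h3p np1 np2 attp with
    ⟨c1, c2, c3, c4, c5, c6⟩ | ⟨c1, c2, c3, c4, c5, c6⟩ <;>
  rcases h.swapPF.side hT h1q h1q2 h3q nq1 nq2 attq with
    ⟨d1, d2, d3, d4, d5, d6⟩ | ⟨d1, d2, d3, d4, d5, d6⟩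
  · obtain ⟨z, hz1, hz3, hz⟩ := n2
    have hzM : z ∈ M := by
      rcases h.cov z with h' | rfl | rfl | rfl | rfl | rfl | rfl | rfl
      · exact h'
      · exact absurd rfl hz1
      · exact absurd hz (G.loopless.irrefl _)
      · exact absurd rfl hz3
      all_goals contradiction
    refine h.not_cc hK h4 h1p c1 h1q d1 hzM hz n1 (n2' z hzM hz) (fun x hx => ?_) c5 c6 d5 d6
    rcases n3 x hx with h' | rfl | h' | rfl | h'
    · simp [h']
    · exact absurd hx c2
    · simp [h']
    · exact absurd hx d2
    · simp [h']
  · obtain ⟨e1, e2, e3⟩ := hpM q2 (by simp)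
    refine h.not_ck hK h4 h1p c1 h1q d1 n1 (fun x hx => ?_) (fun x hx => ?_) c5 c6 d6
    · rcases n2M q2 e1 e2 e3 d4 x hx with h' | h' | rfl | rfl | rfl | h'
      · simp [h']
      · simp [h']
      · exact absurd hx c3
      · exact absurd hx c4
      · exact absurd hx d3
      · simp [h']
    · rcases n3 x hx with h' | rfl | h' | h' | rfl
      · simp [h']
      · exact absurd hx c2
      · simp [h']
      · simp [h']
      · exact absurd hx d2
  · obtain ⟨e1, e2, e3⟩ := hpM p2 (by simp)
    refine h.swapPF.not_ck hK h4 h1q d1 h1p c1 n1' (fun x hx => ?_) (fun x hx => ?_) d5 d6 c6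
    · rcases n2M p2 e1 e2 e3 c4 x hx with h' | h' | rfl | h' | rfl | rfl
      · simp [h']
      · simp [h']
      · exact absurd hx c3
      · simp [h']
      · exact absurd hx d3
      · exact absurd hx d4
    · rcases n3 x hx with h' | h' | rfl | rfl | h'
      · simp [h']
      · simp [h']
      · exact absurd hx c2
      · exact absurd hx d2
      · simp [h']
  · obtain ⟨e1, e2, e3⟩ := hpM p2 (by simp)
    refine h.not_kk hK h4 h1p c1 h1q d1 c4 d4 n1 (fun x hx => ?_) (fun x hx => ?_) c5 c6 d5 d6
    · rcases n2M p2 e1 e2 e3 c4 x hx with h' | h' | rfl | h' | rfl | h'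
      · simp [h']
      · simp [h']
      · exact absurd hx c3
      · simp [h']
      · exact absurd hx d3
      · simp [h']
    · rcases n3 x hx with h' | h' | rfl | h' | rfl
      · simp [h']
      · simp [h']
      · exact absurd hx c2
      · simp [h']
      · exact absurd hx d2

end Conf

namespace Stuck
variable {B Y W P S : Finset V}

lemma exists_leaf_disj (h : Stuck G B Y W P S) (hK : K3 G) (h4 : N4 G) (hW : W.card = 3) :
    ∃ F, Leaf G W S F ∧ Disjoint F P := by
  rcases leaves_or_cycle hK h.cnW.1 h.memS h.leaf.tc (by
      have h1 := Finset.card_sdiff_add_card_eq_card h.leaf.sub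
      have h2 := h.leaf.tcR.1
      have h3 := h.leaf.two
      omega) (h4.nonext h.cnW hW h.memS) with ⟨U1, U2, hU1, hU2, hd⟩ | hc
  · exact exists_leaf_disjoint hU1 hU2 hd h.leaf.cn h.leaf.sub fun x hx => h.leaf.d2 hx
  · obtain ⟨p, hp, q, hq, s, hs, t, ht, hpq, hst, hps, hqt, hends⟩ := h.leaf.ends
    exact absurd (hc s (Finset.sdiff_subset hs)).2 (not_d2_of_tc h.leaf.tcR Finset.sdiff_subset hs
      (h.leaf.sub hp) (fun h' => (Finset.mem_sdiff.1 h').2 hp) hps.symm)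

lemma leaf_not_adj (h : Stuck G B Y W P S) {F : Finset V} (hF : Leaf G W S F) (hd : Disjoint F P)
    {f p : V} (hf : f ∈ F) (hp : p ∈ P) : ¬ G.Adj f p := fun hfp =>
  Finset.disjoint_left.1 hd (hF.mem_of_adj hf (h.leaf.sub hp) hfp (h.leaf.d2 hp)) hp

lemma leaf_subset (h : Stuck G B Y W P S) {F : Finset V} (hF : Leaf G W S F) (hd : Disjoint F P) :
    F ⊆ B := fun x hx => by
  rw [← h.sdiff]
  exact Finset.mem_sdiff.2 ⟨hF.sub hx, Finset.disjoint_left.1 hd hx⟩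

lemma leaf_cn (h : Stuck G B Y W P S) {F : Finset V} (hF : Leaf G W S F) : Cn G (W ∪ F) := by
  obtain ⟨f, hf⟩ := hF.cn.1
  obtain ⟨w, hw, hfw⟩ := hF.att f hf
  exact h.cnW.union_adj hF.cn hw hf (Or.inr hfw.symm)

lemma leaf_disjoint_W (h : Stuck G B Y W P S) {F : Finset V} (hF : Leaf G W S F) : Disjoint W F :=
  Finset.disjoint_right.2 fun x hx => (h.memS x).1 (hF.sub hx)

lemma leaf_card (h : Stuck G B Y W P S) (hW : W.card = 3) {F : Finset V} (hF : Leaf G W S F) :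
    P.card ≤ F.card := by
  have h1 := h.blk.max (S \ F) (W ∪ F) hF.tcR (h.leaf_cn hF) (Finset.disjoint_left.2 fun x hx hx' => by
    have := h.memS x
    simp at hx hx'; tauto) (by
      rw [Finset.card_union_of_disjoint (h.leaf_disjoint_W hF)]; have := hF.two; omega)
  have h2 := Finset.card_sdiff_add_card_eq_card h.leaf.sub
  have h3 := Finset.card_sdiff_add_card_eq_card hF.sub
  rw [h.sdiff] at h2
  omega

lemma leaf_inj [Fintype V] (h : Stuck G B Y W P S) (hK : K3 G) (hT : TF G) (h4 : N4 G)
    {F : Finset V} (hFB : F ⊆ B) {f f' w : V} (hf : f ∈ F) (hf' : f' ∈ F)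
    (hw : w ∈ W) (h1 : G.Adj f w) (h2 : G.Adj f' w) : f = f' :=
  h.blk.one hK hT h4 (h.sub hw) (hFB hf) (hFB hf') h1.symm h2.symm

lemma leaf_card_le [Fintype V] (h : Stuck G B Y W P S) (hK : K3 G) (hT : TF G) (h4 : N4 G)
    (hW : W.card = 3) {F : Finset V} (hF : Leaf G W S F) (hFB : F ⊆ B) : F.card ≤ 3 := by
  rw [← hW]
  have : ∀ f : V, ∃ w, f ∈ F → w ∈ W ∧ G.Adj f w := fun f => by
    by_cases hf : f ∈ F
    · obtain ⟨w, hw⟩ := hF.att f hf; exact ⟨w, fun _ => hw⟩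
    · exact ⟨f, fun h' => absurd h' hf⟩
  choose g hg using this
  exact Finset.card_le_card_of_injOn g (fun f hf => (hg f hf).1) fun f hf f' hf' e =>
    h.leaf_inj hK hT h4 hFB hf hf' (hg f hf).1 (hg f hf).2 (e ▸ (hg f' hf').2)

lemma not_adj_of_path (h : Stuck G B Y W P S) (hT : TF G) (h4 : N4 G)
    {f1 f2 f3 u1 u2 u3 : V} (hF : Leaf G W S {f1, f2, f3}) (hd : Disjoint {f1, f2, f3} P)
    (hWu : ∀ v, v ∈ W ↔ v = u1 ∨ v = u2 ∨ v = u3)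
    (hf : [f1, f2, f3].Nodup) (hu : [u1, u2, u3].Nodup) (h12 : G.Adj f1 f2) (h23 : G.Adj f2 f3)
    (hfu1 : G.Adj f1 u1) (hfu2 : G.Adj f2 u2) (hfu3 : G.Adj f3 u3) {p : V} (hp : p ∈ P) :
    ¬ G.Adj u3 p := by
  intro hup
  simp at hf hu
  obtain ⟨y, hy, hyf, h3y⟩ := hF.tc.other_nbr (x := f3) (hF.sub (by simp)) f2
  have hy1 : y ≠ f1 := by rintro rfl; exact hT _ _ _ h12 h23 h3y.symm
  have hyF : y ∉ ({f1, f2, f3} : Finset V) := by simp [hy1, hyf, h3y.ne']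
  have hpF := Finset.disjoint_right.1 hd hp
  have hyP : y ≠ p := by rintro rfl; exact h.leaf_not_adj hF hd (by simp) hp h3y
  have hFS : ∀ x ∈ ({f1, f2, f3} : Finset V), x ∉ W := fun x hx => (h.memS x).1 (hF.sub hx)
  have g1 := hFS f1 (by simp)
  have g2 := hFS f2 (by simp)
  have g3 := hFS f3 (by simp)
  rw [hWu] at g1 g2 g3
  have hT' := hF.tcR.add_two (x := f3) (y := u3) (u := y) (v := p) (by simp)
    (fun h' => (h.memS u3).1 (Finset.mem_sdiff.1 h').1 ((hWu _).2 (by simp)))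
    (Finset.mem_sdiff.2 ⟨hy, hyF⟩) (Finset.mem_sdiff.2 ⟨h.leaf.sub hp, hpF⟩) hyP h3y hfu3 hup
  refine h4 {u1, f1, f2, u2} _ (card_four (by simp; grind)) (Cn.path4 hfu1.symm h12 hfu2)
    (fun v => ?_) hT'
  have := h.memS v
  rw [hWu] at this
  simp only [Finset.mem_insert, Finset.mem_singleton, Finset.mem_sdiff]
  grind

lemma leaf_card_ne_three [Fintype V] (h : Stuck G B Y W P S) (hK : K3 G) (hT : TF G) (h4 : N4 G)
    (hW : W.card = 3) {F : Finset V} (hF : Leaf G W S F) (hd : Disjoint F P) : F.card ≠ 3 := by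
  intro h3
  have hFB := h.leaf_subset hF hd
  obtain ⟨f1, f2, f3, rfl, h12, h23, h13⟩ := hF.cn.path_of_card_three h3
  obtain ⟨u1, hu1, hfu1⟩ := hF.att f1 (by simp)
  obtain ⟨u2, hu2, hfu2⟩ := hF.att f2 (by simp)
  obtain ⟨u3, hu3, hfu3⟩ := hF.att f3 (by simp)
  have e12 : u1 ≠ u2 := by
    rintro rfl; exact h12.ne (h.leaf_inj hK hT h4 hFB (by simp) (by simp) hu1 hfu1 hfu2)
  have e23 : u2 ≠ u3 := by
    rintro rfl; exact h23.ne (h.leaf_inj hK hT h4 hFB (by simp) (by simp) hu2 hfu2 hfu3)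
  have e13 : u1 ≠ u3 := by
    rintro rfl; exact h13 (h.leaf_inj hK hT h4 hFB (by simp) (by simp) hu1 hfu1 hfu3)
  have hWu : W = {u1, u2, u3} := by
    symm
    apply Finset.eq_of_subset_of_card_le
    · intro x hx; simp at hx; rcases hx with rfl | rfl | rfl <;> assumption
    · rw [hW, Finset.card_eq_three.2 ⟨u1, u2, u3, e12, e13, e23, rfl⟩]
  have n3 : ∀ p ∈ P, ¬ G.Adj u3 p := fun p hp => h.not_adj_of_path hT h4 hF hd
    (fun v => by rw [hWu]; simp) (by simp; exact ⟨⟨h12.ne, h13⟩, h23.ne⟩)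
    (by simp; exact ⟨⟨e12, e13⟩, e23⟩) h12 h23 hfu1 hfu2 hfu3 hp
  have hF' : ({f1, f2, f3} : Finset V) = {f3, f2, f1} := by ext; simp; tauto
  have n1 : ∀ p ∈ P, ¬ G.Adj u1 p := fun p hp => h.not_adj_of_path (u1 := u3) (u2 := u2) hT h4
    (hF' ▸ hF) (hF' ▸ hd)
    (fun v => by rw [hWu]; simp; tauto) (by simp; exact ⟨⟨h23.ne', h13.symm⟩, h12.ne'⟩)
    (by simp; exact ⟨⟨e23.symm, e13.symm⟩, e12.symm⟩) h23.symm h12.symm hfu3 hfu2 hfu1 hp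
  have n2 : ∀ p ∈ P, G.Adj p u2 := fun p hp => by
    obtain ⟨w, hw, hpw⟩ := h.leaf.att p hp
    rw [hWu] at hw
    simp at hw
    rcases hw with rfl | rfl | rfl
    · exact absurd hpw.symm (n1 p hp)
    · exact hpw
    · exact absurd hpw.symm (n3 p hp)
  obtain ⟨x, hx, y, hy, hxy⟩ := h.leaf.exists_edge
  exact hT x y u2 hxy (n2 y hy) (n2 x hx)

end Stuck

lemma Leaf.exists_pair {W S U : Finset V} (h : Leaf G W S U) (h2 : U.card = 2) {p1 : V} (hp1 : p1 ∈ U) :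
    ∃ p2 a1 b1, U = {p1, p2} ∧ G.Adj p1 p2 ∧ a1 ≠ b1 ∧ a1 ∈ S \ U ∧ b1 ∈ S \ U ∧ G.Adj p1 a1 ∧
      G.Adj p2 b1 ∧ (∀ r ∈ S \ U, G.Adj p1 r → r = a1) ∧ (∀ r ∈ S \ U, G.Adj p2 r → r = b1) := by
  obtain ⟨p, hp, q, hq, s, hs, t, ht, hpq, hst, hps, hqt, hends⟩ := h.ends
  have hU : U = {p, q} := by
    symm
    apply Finset.eq_of_subset_of_card_le
    · intro x hx; simp at hx; rcases hx with rfl | rfl <;> assumption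
    · rw [h2, Finset.card_pair hpq]
  have hpq' : G.Adj p q := by
    obtain ⟨y, hy, hpy⟩ := h.cn.exists_nbr hp h.two
    rw [hU] at hy
    simp at hy
    rcases hy with rfl | rfl
    · exact absurd hpy (G.loopless.irrefl _)
    · exact hpy
  have e1 : ∀ r ∈ S \ U, G.Adj p r → r = s := fun r hr hpr => by
    rcases hends p hp r hr hpr with h' | h'
    · exact h'.2
    · exact absurd h'.1 hpq
  have e2 : ∀ r ∈ S \ U, G.Adj q r → r = t := fun r hr hpr => by
    rcases hends q hq r hr hpr with h' | h'
    · exact absurd h'.1.symm hpq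
    · exact h'.2
  rw [hU] at hp1
  simp at hp1
  rcases hp1 with rfl | rfl
  · exact ⟨q, s, t, hU, hpq', hst, hs, ht, hps, hqt, e1, e2⟩
  · exact ⟨p, t, s, by rw [hU, Finset.pair_comm], hpq'.symm, hst.symm, ht, hs, hqt, hps, e2, e1⟩

namespace Stuck
variable {B Y W P S : Finset V}

lemma maxBlock_leaf (h : Stuck G B Y W P S) (hW : W.card = 3) {F : Finset V} (hF : Leaf G W S F)
    (hPF : P.card = F.card) : MaxBlock G (S \ F) (W ∪ F) := by
  have h2 := Finset.card_sdiff_add_card_eq_card h.leaf.sub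
  have h3 := Finset.card_sdiff_add_card_eq_card hF.sub
  rw [h.sdiff] at h2
  refine ⟨hF.tcR, fun v => ?_, ⟨W ∪ F, le_rfl, h.leaf_cn hF, ?_⟩, fun B' Z h1 hZ hd hc => ?_⟩
  · have := h.memS v
    have := @hF.sub v
    simp; tauto
  · rw [Finset.card_union_of_disjoint (h.leaf_disjoint_W hF)]; have := hF.two; omega
  · have := h.blk.max B' Z h1 hZ hd hc; omega

set_option maxHeartbeats 1000000 in
lemma card_W_ne_three [Fintype V] (h : Stuck G B Y W P S) (hK : K3 G) (hT : TF G) (h4 : N4 G)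
    (hV : 4 ≤ Fintype.card V) : W.card ≠ 3 := by
  intro hW
  obtain ⟨F, hF, hd⟩ := h.exists_leaf_disj hK h4 hW
  have hFB := h.leaf_subset hF hd
  have hF2 : F.card = 2 := by
    have := h.leaf_card_le hK hT h4 hW hF hFB
    have := h.leaf_card_ne_three hK hT h4 hW hF hd
    have := hF.two
    omega
  have hP2 : P.card = 2 := by
    have := h.leaf_card hW hF
    have := h.leaf.two
    omega
  have blk' := h.maxBlock_leaf hW hF (hP2.trans hF2.symm)
  have oneB : ∀ w ∈ W, ∀ s ∈ B, ∀ t ∈ B, G.Adj w s → G.Adj w t → s = t := fun w hw s hs t ht h1 h2 =>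
    h.blk.one hK hT h4 (h.sub hw) hs ht h1 h2
  have oneF : ∀ w ∈ W, ∀ s ∈ S \ F, ∀ t ∈ S \ F, G.Adj w s → G.Adj w t → s = t :=
    fun w hw s hs t ht h1 h2 => blk'.one hK hT h4 (Finset.mem_union_left _ hw) hs ht h1 h2
  have hPS : ∀ x ∈ P, x ∈ S \ F := fun x hx => Finset.mem_sdiff.2
    ⟨h.leaf.sub hx, Finset.disjoint_right.1 hd hx⟩
  have hMS : ∀ x ∈ B \ F, x ∈ S \ F := fun x hx => by
    have := h.memS_iff x
    simp at hx ⊢; tauto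
  have hBP : ∀ x ∈ P, x ∉ B := fun x hx => h.notMem_B (h.mem_Y hx)
  have cov : ∀ v, v ∈ B \ F ∨ v ∈ W ∨ v ∈ P ∨ v ∈ F := fun v => by
    have := h.memS_iff v
    have := h.memS v
    simp; tauto
  have uniq : ∀ U, Leaf G W S U → U.card = 2 → ∀ w, ∀ x ∈ U, ∀ y ∈ U, G.Adj w x → G.Adj w y → x = y := by
    intro U hU h2 w x hx y hy hwx hwy
    obtain ⟨x', -, -, hUe, hxx', -⟩ := hU.exists_pair h2 hx
    rw [hUe] at hy
    simp at hy
    rcases hy with rfl | rfl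
    · rfl
    · exact absurd hwy fun h' => hT _ _ _ hwx hxx' h'
  have uP := uniq P h.leaf hP2
  have uF := uniq F hF hF2
  have noM : ∀ w ∈ W, ∀ z ∈ B \ F, G.Adj w z → ∀ x, G.Adj w x → x ∈ W ∨ x = z := by
    intro w hw z hz hwz x hwx
    rcases cov x with hx | hx | hx | hx
    · exact Or.inr (oneB w hw x (Finset.sdiff_subset hx) z (Finset.sdiff_subset hz) hwx hwz)
    · exact Or.inl hx
    · exact Or.inr (oneF w hw x (hPS x hx) z (hMS z hz) hwx hwz)
    · exact Or.inr (oneB w hw x (hFB hx) z (Finset.sdiff_subset hz) hwx hwz)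
  have hend : ∀ w ∈ W, ∀ w', (∀ x ∈ W, G.Adj w x → x = w') →
      ∃ p ∈ P, ∃ f ∈ F, G.Adj w p ∧ G.Adj w f ∧ ∀ x, G.Adj w x → x = w' ∨ x = p ∨ x = f := by
    intro w hw w' hw'
    obtain ⟨y1, h1, -, hy1⟩ := hK.exists_nbr hV w w' w'
    obtain ⟨y2, h2, h2', hy2⟩ := hK.exists_nbr hV w w' y1
    have n1 : y1 ∉ W := fun h' => h1 (hw' _ h' hy1)
    have n2 : y2 ∉ W := fun h' => h2 (hw' _ h' hy2)
    have m1 : y1 ∉ B \ F := fun h' => h2' ((noM w hw y1 h' hy1 y2 hy2).resolve_left n2)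
    have m2 : y2 ∉ B \ F := fun h' => h2' ((noM w hw y2 h' hy2 y1 hy1).resolve_left n1).symm
    obtain ⟨p, hp, f, hf, hwp, hwf⟩ : ∃ p ∈ P, ∃ f ∈ F, G.Adj w p ∧ G.Adj w f := by
      rcases (((cov y1).resolve_left m1).resolve_left n1) with i1 | i1 <;>
        rcases (((cov y2).resolve_left m2).resolve_left n2) with i2 | i2
      · exact absurd (uP w _ i2 _ i1 hy2 hy1) h2'
      · exact ⟨_, i1, _, i2, hy1, hy2⟩
      · exact ⟨_, i2, _, i1, hy2, hy1⟩
      · exact absurd (uF w _ i2 _ i1 hy2 hy1) h2'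
    refine ⟨p, hp, f, hf, hwp, hwf, fun x hx => ?_⟩
    rcases cov x with hx' | hx' | hx' | hx'
    · have := noM w hw x hx' hx p hwp
      rcases this with h' | rfl
      · exact absurd h' (h.notMem_W hp)
      · exact absurd (Finset.sdiff_subset hx') (hBP p hp)
    · exact Or.inl (hw' x hx' hx)
    · exact Or.inr (Or.inl (uP w _ hx' _ hp hx hwp))
    · exact Or.inr (Or.inr (uF w _ hx' _ hf hx hwf))
  obtain ⟨w1, w2, w3, hWe, h12, h23, h13⟩ := h.cnW.path_of_card_three hW
  have h13' : ¬ G.Adj w1 w3 := fun h' => hT _ _ _ h12 h23 h'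
  have mW : ∀ x, x ∈ W ↔ x = w1 ∨ x = w2 ∨ x = w3 := fun x => by rw [hWe]; simp
  obtain ⟨p1, hp1, q1, hq1, h1p, h1q, n1⟩ := hend w1 ((mW _).2 (by simp)) w2 fun x hx hwx => by
    rcases (mW x).1 hx with rfl | rfl | rfl
    · exact absurd hwx (G.loopless.irrefl _)
    · rfl
    · exact absurd hwx h13'
  obtain ⟨p3, hp3, q3, hq3, h3p, h3q, n3⟩ := hend w3 ((mW _).2 (by simp)) w2 fun x hx hwx => by
    rcases (mW x).1 hx with rfl | rfl | rfl
    · exact absurd hwx.symm h13'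
    · rfl
    · exact absurd hwx (G.loopless.irrefl _)
  obtain ⟨p2, a1, b1, hPe, hpp, hab1, ha1, hb1, hpa, hpb, up1, up2⟩ := h.leaf.exists_pair hP2 hp1
  obtain ⟨q2, a2, b2, hFe, hqq, hab2, ha2, hb2, hqa, hqb, uq1, uq2⟩ := hF.exists_pair hF2 hq1
  have hPF : ∀ p ∈ P, ∀ f ∈ F, ¬ G.Adj p f := fun p hp f hf h' => h.leaf_not_adj hF hd hf hp h'.symm
  have mP : ∀ x, x ∈ P ↔ x = p1 ∨ x = p2 := fun x => by rw [hPe]; simp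
  have mF : ∀ x, x ∈ F ↔ x = q1 ∨ x = q2 := fun x => by rw [hFe]; simp
  have hp2 : p2 ∈ P := (mP _).2 (by simp)
  have hq2 : q2 ∈ F := (mF _).2 (by simp)
  have dWP : ∀ x ∈ W, x ∉ P := fun x hx hx' => h.notMem_W hx' hx
  have dWF : ∀ x ∈ W, x ∉ F := fun x hx hx' => (h.memS x).1 (hF.sub hx') hx
  have dPF : ∀ x ∈ P, x ∉ F := fun x hx => Finset.disjoint_right.1 hd hx
  have dWM : ∀ x ∈ W, x ∉ B \ F := fun x hx hx' => h.notMem_B (h.sub hx) (Finset.sdiff_subset hx')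
  have dPM : ∀ x ∈ P, x ∉ B \ F := fun x hx hx' => hBP x hx (Finset.sdiff_subset hx')
  have dFM : ∀ x ∈ F, x ∉ B \ F := fun x hx hx' => (Finset.mem_sdiff.1 hx').2 hx
  have aM : ∀ p ∈ P, ∀ a ∈ S \ P, G.Adj p a → a ∈ B \ F := fun p hp a ha hpa => by
    rw [h.sdiff] at ha
    exact Finset.mem_sdiff.2 ⟨ha, fun h' => hPF p hp a h' hpa⟩
  have aM' : ∀ f ∈ F, ∀ a ∈ S \ F, G.Adj f a → a ∈ B \ F := fun f hf a ha hpa => by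
    have h1 := Finset.mem_sdiff.1 ha
    exact Finset.mem_sdiff.2 ⟨((h.memS_iff a).1 h1.1).resolve_right fun h' => hPF a h' f hf hpa.symm, h1.2⟩
  have MP : ∀ x ∈ B \ F, x ∈ S \ P := fun x hx => by rw [h.sdiff]; exact Finset.sdiff_subset hx
  have conf : Conf G (B \ F) w1 w2 w3 p1 p2 q1 q2 a1 b1 a2 b2 := by
    refine ⟨fun v => ?_, ?_, fun v hv => ?_, h12, h23, hpp, hqq, hpa, hpb, hqa, hqb,
      aM p1 hp1 _ ha1 hpa, aM p2 hp2 _ hb1 hpb, aM' q1 hq1 _ ha2 hqa, aM' q2 hq2 _ hb2 hqb, hab1, hab2,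
      ?_, ?_⟩
    · have := cov v; rw [mW, mP, mF] at this; clear * - this; tauto
    · have i1 := h12.ne; have i2 := h23.ne; have i3 := hpp.ne; have i4 := hqq.ne
      simp only [mW, mP, mF] at dWP dWF dPF
      clear * - i1 i2 i3 i4 h13 dWP dWF dPF
      simp; grind
    · have i1 := dWM v; have i2 := dPM v; have i3 := dFM v
      rw [mW] at i1; rw [mP] at i2; rw [mF] at i3
      simp only [List.mem_cons, List.not_mem_nil]; clear * - i1 i2 i3 hv; tauto
    · convert hF.tcR using 1
      ext x
      have i1 := mP x; have i2 := h.memS_iff x; have i3 := dPF x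
      simp only [Finset.mem_union, Finset.mem_insert, Finset.mem_singleton, Finset.mem_sdiff]; clear * - i1 i2 i3; tauto
    · convert h.blk.tc using 1
      ext x
      have i1 := mF x; have i2 := @hFB x
      simp only [Finset.mem_union, Finset.mem_insert, Finset.mem_singleton, Finset.mem_sdiff]; clear * - i1 i2; tauto
  have np : ∀ p ∈ P, ∀ a, (∀ r ∈ S \ P, G.Adj p r → r = a) → ∀ x, G.Adj p x →
      x ∈ P ∨ x = a ∨ x = w1 ∨ x = w2 ∨ x = w3 := fun p hp a hpa x hx => by
    rcases cov x with h' | h' | h' | h'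
    · exact Or.inr (Or.inl (hpa x (MP x h') hx))
    · exact Or.inr (Or.inr ((mW x).1 h'))
    · exact Or.inl h'
    · exact absurd hx (hPF p hp x h')
  have nf : ∀ f ∈ F, ∀ a, (∀ r ∈ S \ F, G.Adj f r → r = a) → ∀ x, G.Adj f x →
      x ∈ F ∨ x = a ∨ x = w1 ∨ x = w2 ∨ x = w3 := fun p hp a hpa x hx => by
    rcases cov x with h' | h' | h' | h'
    · exact Or.inr (Or.inl (hpa x (hMS x h') hx))
    · exact Or.inr (Or.inr ((mW x).1 h'))
    · exact absurd hx.symm (hPF x h' p hp)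
    · exact Or.inl h'
  have att : ∀ U, Leaf G W S U → ∀ x ∈ U, G.Adj w1 x ∨ G.Adj w2 x ∨ G.Adj w3 x := fun U hU x hx => by
    obtain ⟨w, hw, hxw⟩ := hU.att x hx
    rcases (mW w).1 hw with rfl | rfl | rfl <;> simp [hxw.symm]
  refine conf.false hK h4 hT h1p h1q n1 (fun x hx => ?_) ?_ (fun z hz hwz x hwx => ?_) ?_ ?_
    (fun x hx => ?_) (fun x hx => ?_) (fun x hx => ?_) (fun x hx => ?_) (att P h.leaf _ hp2)
    (att F hF _ hq2)
  · have i1 := (mP p3).1 hp3; have i2 := (mF q3).1 hq3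
    clear * - i1 i2 n3 hx
    rcases n3 x hx with h' | rfl | rfl <;> tauto
  · exact hK.exists_nbr hV w2 w1 w3
  · rcases noM w2 ((mW _).2 (by simp)) z hz hwz x hwx with h' | h'
    · rcases (mW x).1 h' with h' | rfl | h'
      · simp [h']
      · exact absurd hwx (G.loopless.irrefl _)
      · simp [h']
    · simp [h']
  · rcases (mP p3).1 hp3 with rfl | rfl
    · exact Or.inl ⟨h3p, fun h' => hpp.ne (uP w3 _ hp1 _ hp2 h3p h')⟩
    · exact Or.inr ⟨h3p, fun h' => hpp.ne (uP w3 _ hp1 _ hp2 h' h3p)⟩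
  · rcases (mF q3).1 hq3 with rfl | rfl
    · exact Or.inl ⟨h3q, fun h' => hqq.ne (uF w3 _ hq1 _ hq2 h3q h')⟩
    · exact Or.inr ⟨h3q, fun h' => hqq.ne (uF w3 _ hq1 _ hq2 h' h3q)⟩
  · have := np p1 hp1 a1 up1 x hx
    rcases this with h' | h'
    · rcases (mP x).1 h' with rfl | h'
      · exact absurd hx (G.loopless.irrefl _)
      · exact Or.inl h'
    · exact Or.inr h'
  · have := np p2 hp2 b1 up2 x hx
    rcases this with h' | h'
    · rcases (mP x).1 h' with h' | rfl
      · exact Or.inl h'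
      · exact absurd hx (G.loopless.irrefl _)
    · exact Or.inr h'
  · have := nf q1 hq1 a2 uq1 x hx
    rcases this with h' | h'
    · rcases (mF x).1 h' with rfl | h'
      · exact absurd hx (G.loopless.irrefl _)
      · exact Or.inl h'
    · exact Or.inr h'
  · have := nf q2 hq2 b2 uq2 x hx
    rcases this with h' | h'
    · rcases (mF x).1 h' with h' | rfl
      · exact Or.inl h'
      · exact absurd hx (G.loopless.irrefl _)
    · exact Or.inr h'

end Stuck

/-- A triangle-free `3`-connected graph on at least `8` vertices has a `4`-contractible set. -/
lemma not_triangleFree [Fintype V] (hK : K3 G) (hT : TF G) (h4 : N4 G) (hV : 8 ≤ Fintype.card V) :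
    False := by
  obtain ⟨B, Y, hB⟩ := exists_maxBlock hK hT h4 hV
  obtain ⟨W, P, S, h⟩ := hB.exists_stuck hK hT h4
  have h0 := Finset.card_pos.2 h.cnW.1
  have h1 := h.card_W_ne_one hT
  have h2 := h.card_W_ne_two hK hT h4
  have h3 := h.card_W_ne_three hK hT h4 (by omega)
  have := h.le
  omega

/-- `v` has degree at most `3`. -/
def Deg3 (G : SimpleGraph V) (v : V) : Prop :=
  ∃ a b c, ∀ x, G.Adj v x → x = a ∨ x = b ∨ x = c

/-- No edge can be deleted without destroying `3`-connectedness. -/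
def EdgeMinimal (G : SimpleGraph V) : Prop :=
  ∀ u v, G.Adj u v → ¬ K3 (G.deleteEdges {s(u, v)})

lemma exists_separation [Fintype V] (hK : K3 G) (hm : EdgeMinimal G) {u v t : V} (huv : G.Adj u v)
    (hut : G.Adj u t) (hvt : G.Adj v t) : ∃ (J : Finset V) (s : V), u ∈ J ∧ v ∉ J ∧ t ∉ J ∧ s ∉ J ∧
      v ≠ s ∧ ∀ x ∈ J, ∀ y, y ∉ J → y ≠ t → y ≠ s → G.Adj x y → x = u ∧ y = v := by
  have h := hm u v huv
  unfold K3 at h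
  push Not at h
  obtain ⟨J, hne, a, b, ⟨y0, hy0, hy0a, hy0b⟩, hcl⟩ := h
  have hcl' : ∀ x ∈ J, ∀ y, y ∉ J → y ≠ a → y ≠ b → G.Adj x y →
      (x = u ∧ y = v) ∨ (x = v ∧ y = u) := by
    intro x hx y hy hya hyb hxy
    by_contra hcon
    refine hcl x hx y hy hya hyb ?_
    simp only [deleteEdges_adj, Set.mem_singleton_iff, Sym2.eq_iff]
    exact ⟨hxy, hcon⟩
  have main : ∀ u v, G.Adj u v → G.Adj u t → G.Adj v t → u ∈ J → v ∉ J → v ≠ a → v ≠ b →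
      (∀ x ∈ J, ∀ y, y ∉ J → y ≠ a → y ≠ b → G.Adj x y → x = u ∧ y = v) →
      ∃ s, t ∉ J ∧ s ∉ J ∧ v ≠ s ∧ ∀ x ∈ J, ∀ y, y ∉ J → y ≠ t → y ≠ s → G.Adj x y → x = u ∧ y = v := by
    intro u v huv hut hvt hu hv hva hvb hcl
    have htJ : t ∉ J := fun h' => hut.ne (hcl t h' v hv hva hvb hvt.symm).1.symm
    have hts : t = a ∨ t = b := by
      by_contra hcon
      push Not at hcon
      exact hvt.ne (hcl u hu t htJ hcon.1 hcon.2 hut).2.symm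
    rcases hts with rfl | rfl
    · by_cases hb : b ∈ J
      · exact ⟨t, htJ, htJ, hva, fun x hx y hy hyt _ hxy =>
          hcl x hx y hy hyt (fun e => hy (e ▸ hb)) hxy⟩
      · exact ⟨b, htJ, hb, hvb, fun x hx y hy hyt hyb hxy => hcl x hx y hy hyt hyb hxy⟩
    · by_cases ha : a ∈ J
      · exact ⟨t, htJ, htJ, hvb, fun x hx y hy hyt _ hxy =>
          hcl x hx y hy (fun e => hy (e ▸ ha)) hyt hxy⟩
      · exact ⟨a, htJ, ha, hva, fun x hx y hy hyt hya hxy => hcl x hx y hy hya hyt hxy⟩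
  obtain ⟨x, hx, y, hy, hya, hyb, hxy⟩ := hK J hne a b ⟨y0, hy0, hy0a, hy0b⟩
  rcases hcl' x hx y hy hya hyb hxy with ⟨rfl, rfl⟩ | ⟨rfl, rfl⟩
  · obtain ⟨s, h1, h2, h3, h4⟩ := main x y huv hut hvt hx hy hya hyb fun x' hx' y' hy' ha hb h' => by
      rcases hcl' x' hx' y' hy' ha hb h' with h' | ⟨rfl, rfl⟩
      · exact h'
      · exact absurd hx' hy
    exact ⟨J, s, hx, hy, h1, h2, h3, h4⟩
  · obtain ⟨s, h1, h2, h3, h4⟩ := main x y huv.symm hvt hut hx hy hya hyb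
      fun x' hx' y' hy' ha hb h' => by
        rcases hcl' x' hx' y' hy' ha hb h' with ⟨rfl, rfl⟩ | h'
        · exact absurd hx' hy
        · exact h'
    refine ⟨Finset.univ.filter fun z => z ∉ J ∧ z ≠ t ∧ z ≠ s, s, ?_, ?_, ?_, ?_, ?_, ?_⟩
    · simp only [Finset.mem_filter, Finset.mem_univ, true_and]; exact ⟨hy, hut.ne, h3⟩
    · simp only [Finset.mem_filter, Finset.mem_univ, true_and]; tauto
    · simp
    · simp
    · rintro rfl; exact h2 hx
    · intro x' hx' y' hy' hyt hys hxy'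
      simp only [Finset.mem_filter, Finset.mem_univ, true_and] at hx' hy'
      have hyJ : y' ∈ J := by by_contra h'; exact hy' ⟨h', hyt, hys⟩
      have := h4 y' hyJ x' hx'.1 hx'.2.1 hx'.2.2 hxy'.symm
      exact ⟨this.2, this.1⟩

/-- In an edge-minimal `3`-connected graph every edge of a triangle has an end of degree `3`. -/
lemma deg3_of_triangle [Fintype V] (hK : K3 G) (hm : EdgeMinimal G) {u v t : V} (huv : G.Adj u v)
    (hut : G.Adj u t) (hvt : G.Adj v t) : Deg3 G u ∨ Deg3 G v := by
  obtain ⟨X, s, huX, hvX, htX, hsX, hvs, hX⟩ := exists_separation hK hm huv hut hvt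
  obtain ⟨X', s', huX', htX', hvX', hsX', hts', hX'⟩ := exists_separation hK hm hut huv hvt.symm
  by_cases hc : s ∈ X' ∧ s' ∈ X
  · right
    refine ⟨u, t, s, ?_⟩
    have empty : ∀ J : Finset V, ∀ a b z, (z ∉ J ∧ z ≠ a ∧ z ≠ b) →
        (∀ x ∈ J, ∀ y, y ∉ J → G.Adj x y → y = a ∨ y = b) → ∀ x, x ∉ J := by
      intro J a b z hz hJ x hx
      obtain ⟨x', hx', y, hy, hya, hyb, hxy⟩ := hK J ⟨x, hx⟩ a b ⟨z, hz⟩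
      rcases hJ x' hx' y hy hxy with h' | h' <;> contradiction
    have hR : ∀ x, ¬ (x ∉ X ∧ x ≠ t ∧ x ≠ s ∧ x ∈ X') := by
      have := empty (Finset.univ.filter fun x => x ∉ X ∧ x ≠ t ∧ x ≠ s ∧ x ∈ X') v s t
        (by simp; exact ⟨hvt.ne', fun e => htX' (e ▸ hc.1)⟩) (fun x hx y hy hxy => by
          simp only [Finset.mem_filter, Finset.mem_univ, true_and] at hx hy
          obtain ⟨x1, x2, x3, x4⟩ := hx
          have hxu : x ≠ u := fun e => x1 (e ▸ huX)
          by_contra hcon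
          push Not at hcon
          have hxv : x ≠ v := fun e => hvX' (e ▸ x4)
          have hyX : y ∉ X := fun h' => hxv (hX y h' x x1 x2 x3 hxy.symm).2
          have hyX' : y ∈ X' := by
            by_contra h'
            refine hxu (hX' x x4 y h' hcon.1 (fun e => hyX (e ▸ hc.2)) hxy).1
          exact hy ⟨hyX, fun e => htX' (e ▸ hyX'), hcon.2, hyX'⟩)
      intro x hx
      exact this x (by simpa using hx)
    have hR' : ∀ x, ¬ (x ∉ X ∧ x ≠ t ∧ x ≠ s ∧ x ∉ X' ∧ x ≠ v ∧ x ≠ s') := by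
      have := empty (Finset.univ.filter fun x => x ∉ X ∧ x ≠ t ∧ x ≠ s ∧ x ∉ X' ∧ x ≠ v ∧ x ≠ s') t v u
        (by simp [huX, hut.ne, huv.ne]) (fun x hx y hy hxy => by
          simp only [Finset.mem_filter, Finset.mem_univ, true_and] at hx hy
          obtain ⟨x1, x2, x3, x4, x5, x6⟩ := hx
          by_contra hcon
          push Not at hcon
          have hyX : y ∉ X := fun h' => x5 (hX y h' x x1 x2 x3 hxy.symm).2
          have hyX' : y ∉ X' := fun h' => x2 (hX' y h' x x4 x5 x6 hxy.symm).2
          exact hy ⟨hyX, hcon.1, fun e => hyX' (e ▸ hc.1), hyX', hcon.2, fun e => hyX (e ▸ hc.2)⟩)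
      intro x hx
      exact this x (by simpa using hx)
    have hY : ∀ x, x ∉ X → x ≠ t → x ≠ s → x = v := by
      intro x h1 h2 h3
      by_contra h4
      have h5 : x ∉ X' := fun h' => hR x ⟨h1, h2, h3, h'⟩
      exact hR' x ⟨h1, h2, h3, h5, h4, fun e => h1 (e ▸ hc.2)⟩
    intro x hvx
    by_cases h1 : x ∈ X
    · exact Or.inl (hX x h1 v hvX hvt.ne hvs hvx.symm).1
    · by_contra hcon
      push Not at hcon
      exact hvx.ne (hY x h1 hcon.2.1 hcon.2.2).symm
  · left
    have hQ : ∃ r, (r = s ∨ r = s') ∧ ∀ x, x ∈ X → x ∈ X' → ∀ y, ¬ (y ∈ X ∧ y ∈ X') → G.Adj x y →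
        y = r ∨ (x = u ∧ (y = v ∨ y = t)) := by
      have key : ∀ x, x ∈ X → x ∈ X' → ∀ y, ¬ (y ∈ X ∧ y ∈ X') → G.Adj x y →
        (y = s' ∧ s' ∈ X) ∨ (y = s ∧ (s ∈ X' ∨ s = s')) ∨ (x = u ∧ (y = v ∨ y = t)) := by
        intro x hx hx' y hy hxy
        by_cases h1 : y ∈ X
        · have h2 : y ∉ X' := fun h' => hy ⟨h1, h'⟩
          have := hX' x hx' y h2
          have h3 : y ≠ v := fun e => hvX (e ▸ h1)
          by_cases h4 : y = s'
          · exact Or.inl ⟨h4, h4 ▸ h1⟩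
          · have := this h3 h4 hxy; exact Or.inr (Or.inr ⟨this.1, Or.inr this.2⟩)
        · have h2 := hX x hx y h1
          by_cases h3 : y ∈ X'
          · have h4 : y ≠ t := fun e => htX' (e ▸ h3)
            by_cases h5 : y = s
            · exact Or.inr (Or.inl ⟨h5, Or.inl (h5 ▸ h3)⟩)
            · have := h2 h4 h5 hxy; exact Or.inr (Or.inr ⟨this.1, Or.inl this.2⟩)
          · have h4 := hX' x hx' y h3
            by_cases i1 : y = t
            · by_cases hts : t = s'
              · exact absurd hts hts'
              · have := h4 (i1 ▸ hvt.ne') (i1 ▸ hts) hxy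
                exact Or.inr (Or.inr ⟨this.1, Or.inr this.2⟩)
            by_cases i2 : y = s
            · by_cases i3 : y = s'
              · exact Or.inr (Or.inl ⟨i2, Or.inr (i2 ▸ i3)⟩)
              · have := h4 (i2 ▸ hvs.symm) i3 hxy
                exact absurd this.2 i1
            · have := h2 i1 i2 hxy
              exact Or.inr (Or.inr ⟨this.1, Or.inl this.2⟩)
      by_cases hs : s' ∈ X
      · refine ⟨s', Or.inr rfl, fun x hx hx' y hy hxy => ?_⟩
        rcases key x hx hx' y hy hxy with h' | ⟨h', h''⟩ | h'
        · exact Or.inl h'.1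
        · rcases h'' with h'' | h''
          · exact absurd ⟨h'', hs⟩ hc
          · exact Or.inl (h'.trans h'')
        · exact Or.inr h'
      · refine ⟨s, Or.inl rfl, fun x hx hx' y hy hxy => ?_⟩
        rcases key x hx hx' y hy hxy with h' | ⟨h', h''⟩ | h'
        · exact absurd h'.2 hs
        · exact Or.inl h'
        · exact Or.inr h'
    obtain ⟨r, hr, hQ⟩ := hQ
    have hQu : ∀ x, x ∈ X → x ∈ X' → x = u := by
      by_contra hcon
      push Not at hcon
      obtain ⟨x0, h1, h2, h3⟩ := hcon
      obtain ⟨z, hz, hzu, hzr⟩ : ∃ z, z ∉ X ∩ X' ∧ z ≠ u ∧ z ≠ r := by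
        rcases hr with rfl | rfl
        · exact ⟨v, by simp [hvX], huv.ne', hvs⟩
        · exact ⟨t, by simp [htX], hut.ne', hts'⟩
      obtain ⟨x, hx, y, hy, hyu, hyr, hxy⟩ := hK ((X ∩ X').erase u) ⟨x0, by simp [h1, h2, h3]⟩ u r
        ⟨z, fun h' => hz (Finset.mem_of_mem_erase h'), hzu, hzr⟩
      simp at hx hy
      rcases hQ x hx.2.1 hx.2.2 y (fun h' => hy hyu h'.1 h'.2) hxy with h' | h'
      · exact hyr h'
      · exact hx.1 h'.1
    refine ⟨r, v, t, fun x hx => ?_⟩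
    have := hQ u huX huX' x (fun h' => hx.ne (hQu x h'.1 h'.2).symm) hx
    tauto

lemma Deg3.cover {v p q r : V} (h : Deg3 G v) (hp : G.Adj v p) (hq : G.Adj v q) (hr : G.Adj v r)
    (hpq : p ≠ q) (hpr : p ≠ r) (hqr : q ≠ r) : ∀ x, G.Adj v x → x = p ∨ x = q ∨ x = r := by
  obtain ⟨a, b, c, h⟩ := h
  intro x hx
  have h1 := h p hp
  have h2 := h q hq
  have h3 := h r hr
  have h4 := h x hx
  grind

lemma exists_unique_outer [Fintype V] {v q r : V} {S : Finset V} (h : Deg3 G v)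
    (hq : G.Adj v q) (hr : G.Adj v r) (hqr : q ≠ r) (hqS : q ∉ S) (hrS : r ∉ S) :
    ∃ α, ∀ x ∈ S, G.Adj v x → x = α := by
  by_cases hx : ∃ x ∈ S, G.Adj v x
  · obtain ⟨α, hα, hva⟩ := hx
    refine ⟨α, fun x hx hvx => ?_⟩
    rcases h.cover hva hq hr (by rintro rfl; exact hqS hα) (by rintro rfl; exact hrS hα) hqr x hvx
      with h' | h' | h'
    · exact h'
    · exact absurd (h' ▸ hx) hqS
    · exact absurd (h' ▸ hx) hrS
  · push Not at hx
    exact ⟨v, fun x h1 h2 => absurd h2 (hx x h1)⟩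

lemma K3.two_of_three (hK : K3 G) {J S : Finset V} {x a b c y0 : V} (hne : J.Nonempty)
    (hS : ∀ v, v ∈ S ↔ v ≠ a ∧ v ≠ b ∧ v ≠ c) (hcl : ∀ j ∈ J, ∀ y ∈ S, G.Adj j y → y ∈ J ∨ y = x)
    (hy0 : y0 ∈ S) (hyJ : y0 ∉ J) (hyx : y0 ≠ x) :
    ((∃ j ∈ J, G.Adj j a) ∨ ∃ j ∈ J, G.Adj j b) ∧ ((∃ j ∈ J, G.Adj j a) ∨ ∃ j ∈ J, G.Adj j c) ∧
      ((∃ j ∈ J, G.Adj j b) ∨ ∃ j ∈ J, G.Adj j c) := by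
  have hy := (hS y0).1 hy0
  have key : ∀ d, y0 ≠ d → ∃ j ∈ J, ∃ y, (y = a ∨ y = b ∨ y = c) ∧ y ≠ d ∧ G.Adj j y := by
    intro d hd
    obtain ⟨j, hj, y, h1, h2, h3, h4⟩ := hK J hne x d ⟨y0, hyJ, hyx, hd⟩
    refine ⟨j, hj, y, ?_, h3, h4⟩
    by_contra hcon
    push Not at hcon
    rcases hcl j hj y ((hS y).2 hcon) h4 with h | h
    · exact h1 h
    · exact h2 h
  obtain ⟨j1, hj1, y1, h1, h1', h1''⟩ := key a hy.1
  obtain ⟨j2, hj2, y2, h2, h2', h2''⟩ := key b hy.2.1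
  obtain ⟨j3, hj3, y3, h3, h3', h3''⟩ := key c hy.2.2
  grind

lemma triangle_compl_tc (hK : K3 G) {S : Finset V} {a b c : V} (hab : G.Adj a b) (hbc : G.Adj b c)
    (hac : G.Adj a c) (ha : Deg3 G a) (hb : Deg3 G b) (hc : Deg3 G c) (h3 : 3 ≤ S.card)
    (hS : ∀ v, v ∈ S ↔ v ≠ a ∧ v ≠ b ∧ v ≠ c) : TC G S := by
  refine ⟨h3, fun J hJS hne x hxJ hcl y0 hy0 => ?_⟩
  by_contra hcon
  push Not at hcon
  have h1 := hK.two_of_three hne hS hcl hy0 hcon.1 hcon.2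
  have hclK : ∀ k ∈ (S \ J).erase x, ∀ y ∈ S, G.Adj k y → y ∈ (S \ J).erase x ∨ y = x := by
    intro k hk y hy hky
    simp only [Finset.mem_erase, Finset.mem_sdiff] at hk ⊢
    by_cases hyx : y = x
    · exact Or.inr hyx
    · refine Or.inl ⟨hyx, hy, fun hyJ => ?_⟩
      rcases hcl y hyJ k hk.2.1 hky.symm with h | h
      · exact hk.2.2 h
      · exact hk.1 h
  obtain ⟨j0, hj0⟩ := hne
  have h2 := hK.two_of_three (J := (S \ J).erase x) (y0 := j0)
    ⟨y0, by simp only [Finset.mem_erase, Finset.mem_sdiff]; exact ⟨hcon.2, hy0, hcon.1⟩⟩ hS hclK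
    (hJS hj0) (by simp [hj0]) (by rintro rfl; exact hxJ hj0)
  have key : ∀ v p q, Deg3 G v → G.Adj v p → G.Adj v q → p ≠ q → p ∉ S → q ∉ S →
      (∃ j ∈ J, G.Adj j v) → (∃ j ∈ (S \ J).erase x, G.Adj j v) → False := by
    rintro v p q hv hp hq hpq hpS hqS ⟨j, hj, hjv⟩ ⟨k, hk, hkv⟩
    simp only [Finset.mem_erase, Finset.mem_sdiff] at hk
    have hjS := hJS hj
    rcases hv.cover hp hq hjv.symm hpq (by rintro rfl; exact hpS hjS)
      (by rintro rfl; exact hqS hjS) k hkv.symm with rfl | rfl | rfl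
    · exact hpS hk.2.1
    · exact hqS hk.2.1
    · exact hk.2.2 hj
  have haS : a ∉ S := fun h => ((hS a).1 h).1 rfl
  have hbS : b ∉ S := fun h => ((hS b).1 h).2.1 rfl
  have hcS : c ∉ S := fun h => ((hS c).1 h).2.2 rfl
  have k1 := key a b c ha hab hac hbc.ne hbS hcS
  have k2 := key b a c hb hab.symm hbc hac.ne haS hcS
  have k3 := key c a b hc hac.symm hbc.symm hab.ne haS hbS
  clear * - k1 k2 k3 h1 h2
  revert k1 k2 k3 h1 h2
  generalize (∃ j ∈ J, G.Adj j a) = A, (∃ j ∈ J, G.Adj j b) = B, (∃ j ∈ J, G.Adj j c) = C,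
    (∃ j ∈ (S \ J).erase x, G.Adj j a) = A', (∃ j ∈ (S \ J).erase x, G.Adj j b) = B',
    (∃ j ∈ (S \ J).erase x, G.Adj j c) = C'
  grind

lemma no_cubic_triangle [Fintype V] (hK : K3 G) (h4 : N4 G) (hV : 7 ≤ Fintype.card V) {a b c : V}
    (hab : G.Adj a b) (hbc : G.Adj b c) (hac : G.Adj a c) (ha : Deg3 G a) (hb : Deg3 G b)
    (hc : Deg3 G c) : False := by
  set S : Finset V := Finset.univ \ {a, b, c} with hSdef
  have hS : ∀ v, v ∈ S ↔ v ≠ a ∧ v ≠ b ∧ v ≠ c := by intro v; simp [S]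
  have hcard : 4 ≤ S.card := card_sdiff_triple_ge (by simpa using hV) a b c
  have hTC := triangle_compl_tc hK hab hbc hac ha hb hc (by omega) hS
  have hW3 : ({a, b, c} : Finset V).card = 3 := Finset.card_eq_three.2
    ⟨a, b, c, hab.ne, hac.ne, hbc.ne, rfl⟩
  have hWS : ∀ v, v ∈ S ↔ v ∉ ({a, b, c} : Finset V) := by intro v; simp [S]
  have hn := h4.nonext (Cn.path3 hab hbc) hW3 hWS
  have haS : a ∉ S := fun h => ((hS a).1 h).1 rfl
  have hbS : b ∉ S := fun h => ((hS b).1 h).2.1 rfl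
  have hcS : c ∉ S := fun h => ((hS c).1 h).2.2 rfl
  obtain ⟨α, hα⟩ := exists_unique_outer ha hab hac hbc.ne hbS hcS
  obtain ⟨β, hβ⟩ := exists_unique_outer hb hab.symm hbc hac.ne haS hcS
  obtain ⟨γ, hγ⟩ := exists_unique_outer hc hac.symm hbc.symm hab.ne haS hbS
  have hatt : ∀ X ⊆ S, (∀ x ∈ X, Att G {a, b, c} x) → X.card ≤ 3 := by
    intro X hX hA
    have : X ⊆ {α, β, γ} := by
      intro x hx
      obtain ⟨w, hw, hxw⟩ := hA x hx
      simp only [Finset.mem_insert, Finset.mem_singleton] at hw ⊢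
      rcases hw with rfl | rfl | rfl
      · exact Or.inl (hα x (hX hx) hxw.symm)
      · exact Or.inr (Or.inl (hβ x (hX hx) hxw.symm))
      · exact Or.inr (Or.inr (hγ x (hX hx) hxw.symm))
    exact (Finset.card_le_card this).trans Finset.card_le_three
  rcases leaves_or_cycle hK ⟨a, by simp⟩ hWS hTC hcard hn with ⟨U1, U2, h1, h2, hd⟩ | h
  · have := hatt (U1 ∪ U2) (Finset.union_subset h1.sub h2.sub) (by
      intro x hx
      rcases Finset.mem_union.1 hx with h | h
      · exact h1.att x h
      · exact h2.att x h)
    rw [Finset.card_union_of_disjoint hd] at this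
    have := h1.two
    have := h2.two
    omega
  · have := hatt S subset_rfl fun x hx => (h x hx).1
    omega

/-- `J` and `K` partition `S \ {x}` into two nonempty sides without edges between them. -/
structure Sep (G : SimpleGraph V) (S : Finset V) (x : V) (J K : Finset V) : Prop where
  subJ : J ⊆ S
  subK : K ⊆ S
  neJ : J.Nonempty
  neK : K.Nonempty
  xJ : x ∉ J
  xK : x ∉ K
  dis : ∀ v ∈ J, v ∉ K
  cov : ∀ v ∈ S, v ∈ J ∨ v ∈ K ∨ v = x
  no : ∀ j ∈ J, ∀ k ∈ K, ¬ G.Adj j k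

lemma Sep.symm {S J K : Finset V} {x : V} (h : Sep G S x J K) : Sep G S x K J :=
  ⟨h.subK, h.subJ, h.neK, h.neJ, h.xK, h.xJ, fun v hK hJ => h.dis v hJ hK,
    fun v hv => by rcases h.cov v hv with h | h | h <;> simp [h],
    fun k hk j hj hkj => h.no j hj k hk hkj.symm⟩

lemma exists_sep {S : Finset V} (h3 : 3 ≤ S.card) (h : ¬ TC G S) : ∃ x J K, Sep G S x J K := by
  unfold TC at h
  push Not at h
  obtain ⟨J, hJS, hne, x, hxJ, hcl, y, hy, hyJ, hyx⟩ := h h3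
  refine ⟨x, J, (S \ J).erase x, hJS, ?_, hne, ⟨y, ?_⟩, hxJ, by simp, ?_, ?_, ?_⟩
  · intro v hv
    simp only [Finset.mem_erase, Finset.mem_sdiff] at hv
    exact hv.2.1
  · simp only [Finset.mem_erase, Finset.mem_sdiff]
    exact ⟨hyx, hy, hyJ⟩
  · intro v hv
    simp [hv]
  · intro v hv
    simp only [Finset.mem_erase, Finset.mem_sdiff]
    by_cases h1 : v ∈ J <;> by_cases h2 : v = x <;> simp [h1, h2, hv]
  · intro j hj k hk hjk
    simp only [Finset.mem_erase, Finset.mem_sdiff] at hk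
    rcases hcl j hj k hk.2.1 hjk with h | h
    · exact hk.2.2 h
    · exact hk.1 h

/-- A triangle `p q c` with `p`, `q` of degree three and `c` of larger degree. -/
structure Tri (G : SimpleGraph V) (p q c a b : V) : Prop where
  pq : G.Adj p q
  pc : G.Adj p c
  qc : G.Adj q c
  pa : G.Adj p a
  qb : G.Adj q b
  np : ∀ x, G.Adj p x → x = q ∨ x = c ∨ x = a
  nq : ∀ x, G.Adj q x → x = p ∨ x = c ∨ x = b
  ab : a ≠ b
  aq : a ≠ q
  ac : a ≠ c
  bp : b ≠ p
  bc : b ≠ c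
  nc : ¬ Deg3 G c

lemma Tri.symm {p q c a b : V} (h : Tri G p q c a b) : Tri G q p c b a :=
  ⟨h.pq.symm, h.qc, h.pc, h.qb, h.pa, h.nq, h.np, h.ab.symm, h.bp, h.bc, h.aq, h.ac, h.nc⟩

lemma exists_tri [Fintype V] (hK : K3 G) (hV : 7 ≤ Fintype.card V) {p q c : V} (hpq : G.Adj p q)
    (hpc : G.Adj p c) (hqc : G.Adj q c) (hp : Deg3 G p) (hq : Deg3 G q) (hc : ¬ Deg3 G c) :
    ∃ a b, Tri G p q c a b := by
  obtain ⟨a, haq, hac, hpa⟩ := hK.exists_nbr (by omega) p q c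
  obtain ⟨b, hbp, hbc, hqb⟩ := hK.exists_nbr (by omega) q p c
  have np := hp.cover hpq hpc hpa hqc.ne haq.symm hac.symm
  have nq := hq.cover hpq.symm hqc hqb hpc.ne hbp.symm hbc.symm
  refine ⟨a, b, hpq, hpc, hqc, hpa, hqb, np, nq, ?_, haq, hac, hbp, hbc, hc⟩
  rintro rfl
  obtain ⟨z, hz⟩ : ∃ z, z ∉ ({p, q, c, a} : Finset V) := by
    by_contra hcon
    push Not at hcon
    have := Finset.card_le_card (fun z _ => hcon z : Finset.univ ⊆ ({p, q, c, a} : Finset V))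
    have := Finset.card_le_four (a := p) (b := q) (c := c) (d := a)
    simp only [Finset.card_univ] at *
    omega
  simp only [Finset.mem_insert, Finset.mem_singleton, not_or] at hz
  obtain ⟨j, hj, y, h1, h2, h3, h4⟩ := hK {p, q} ⟨p, by simp⟩ c a ⟨z, by simp [hz], hz.2.2.1, hz.2.2.2⟩
  simp only [Finset.mem_insert, Finset.mem_singleton, not_or] at hj h1
  rcases hj with rfl | rfl
  · rcases np y h4 with h | h | h <;> tauto
  · rcases nq y h4 with h | h | h <;> tauto

namespace Tri
variable {p q c a b : V}

lemma c_side (h : Tri G p q c a b) (hK : K3 G) {J : Finset V} {x z : V} (hcJ : c ∈ J)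
    (hcl : ∀ j ∈ J, ∀ y, y ∉ J → G.Adj j y → y = x ∨ (j = c ∧ (y = p ∨ y = q)))
    (hz : z ∉ J) (hzx : z ≠ x) : False := by
  by_cases hne : (J.erase c).Nonempty
  · obtain ⟨j, hj, y, h1, h2, h3, h4⟩ := hK (J.erase c) hne x c
      ⟨z, by simp [hz], hzx, by rintro rfl; exact hz hcJ⟩
    simp only [Finset.mem_erase, not_and] at hj h1
    rcases hcl j hj.2 y (h1 h3) h4 with h | h
    · exact h2 h
    · exact hj.1 h.1
  · refine h.nc ⟨x, p, q, fun y hy => hcl c hcJ y (fun hyJ => hne ⟨y, ?_⟩) hy |>.imp_right And.right⟩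
    exact Finset.mem_erase.2 ⟨hy.ne.symm, hyJ⟩

/-- In a separation of `V \ {p, q, a}` one side contains `c` and the other contains `b`. -/
lemma sep_sides (h : Tri G p q c a b) (hK : K3 G) {S : Finset V} (hS : ∀ v, v ∈ S ↔ v ≠ p ∧ v ≠ q)
    {x : V} {J K : Finset V} (hs : Sep G (S.erase a) x J K) : 
    (c ∈ J ∧ b ∈ K) ∨ (b ∈ J ∧ c ∈ K) := by
  have side : ∀ J K, Sep G (S.erase a) x J K → c ∈ J ∨ b ∈ J := by
    intro J K hs
    obtain ⟨k, hk⟩ := hs.neK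
    have hkS := Finset.mem_erase.1 (hs.subK hk)
    obtain ⟨j, hj, y, h1, h2, h3, h4⟩ := hK J hs.neJ x a ⟨k, fun h => hs.dis k h hk,
        by rintro rfl; exact hs.xK hk, hkS.1⟩
    have hjS := Finset.mem_erase.1 (hs.subJ hj)
    have hjS' := (hS j).1 hjS.2
    by_cases hyp : y = p
    · subst hyp
      rcases h.np j h4.symm with e | e | e
      · exact absurd e hjS'.2
      · exact Or.inl (e ▸ hj)
      · exact absurd e hjS.1
    by_cases hyq : y = q
    · subst hyq
      rcases h.nq j h4.symm with e | e | e
      · exact absurd e hjS'.1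
      · exact Or.inl (e ▸ hj)
      · exact Or.inr (e ▸ hj)
    rcases hs.cov y (Finset.mem_erase.2 ⟨h3, (hS y).2 ⟨hyp, hyq⟩⟩) with e | e | e
    · exact absurd e h1
    · exact absurd h4 (hs.no j hj y e)
    · exact absurd e h2
  have d1 := hs.dis c
  have d2 := hs.dis b
  have := side J K hs
  have := side K J hs.symm
  tauto

end Tri

namespace Tri
variable {p q c a b : V}

lemma crossing_mem (h : Tri G p q c a b) (hK : K3 G) {S : Finset V}
    (hS : ∀ v, v ∈ S ↔ v ≠ p ∧ v ≠ q) {x1 x2 : V} {J1 K1 J2 K2 : Finset V}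
    (hs1 : Sep G (S.erase a) x1 J1 K1) (hs2 : Sep G (S.erase b) x2 J2 K2) (c1 : c ∈ J1)
    (b1 : b ∈ K1) (c2 : c ∈ J2) (a2 : a ∈ K2) : x2 ∈ J1 ∧ x1 ∈ J2 := by
  have exits : ∀ j ∈ J1 ∩ J2, ∀ y, y ∉ J1 ∩ J2 → G.Adj j y → (y = x2 ∧ y ∈ J1) ∨
      (y = x1 ∧ y ∈ J2) ∨ (y = x1 ∧ y = x2) ∨ (j = c ∧ (y = p ∨ y = q)) := by
    intro j hj y hy hjy
    simp only [Finset.mem_inter] at hj hy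
    have hj1 := Finset.mem_erase.1 (hs1.subJ hj.1)
    have hj2 := Finset.mem_erase.1 (hs2.subJ hj.2)
    have hjS := (hS j).1 hj1.2
    by_cases hyp : y = p
    · subst hyp
      rcases h.np j hjy.symm with e | e | e
      · exact absurd e hjS.2
      · simp [e]
      · exact absurd e hj1.1
    by_cases hyq : y = q
    · subst hyq
      rcases h.nq j hjy.symm with e | e | e
      · exact absurd e hjS.1
      · simp [e]
      · exact absurd e hj2.1
    have hya : y ≠ a := by rintro rfl; exact hs2.no j hj.2 _ a2 hjy
    have hyb : y ≠ b := by rintro rfl; exact hs1.no j hj.1 _ b1 hjy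
    have e1 := hs1.cov y (Finset.mem_erase.2 ⟨hya, (hS y).2 ⟨hyp, hyq⟩⟩)
    have e2 := hs2.cov y (Finset.mem_erase.2 ⟨hyb, (hS y).2 ⟨hyp, hyq⟩⟩)
    have n1 := fun h => hs1.no j hj.1 y h hjy
    have n2 := fun h => hs2.no j hj.2 y h hjy
    clear * - e1 e2 n1 n2 hy
    tauto
  have hcm : c ∈ J1 ∩ J2 := Finset.mem_inter.2 ⟨c1, c2⟩
  constructor
  · by_contra hx
    refine h.c_side hK hcm (x := x1) (z := b) ?_ (fun h => hs1.dis b (Finset.mem_inter.1 h).1 b1)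
      (by rintro rfl; exact hs1.xK b1)
    intro j hj y hy hjy
    rcases exits j hj y hy hjy with ⟨rfl, e⟩ | e | e | e
    · exact absurd e hx
    · exact Or.inl e.1
    · exact Or.inl e.1
    · exact Or.inr e
  · by_contra hx
    refine h.c_side hK hcm (x := x2) (z := a) ?_ (fun h => hs2.dis a (Finset.mem_inter.1 h).2 a2)
      (by rintro rfl; exact hs2.xK a2)
    intro j hj y hy hjy
    rcases exits j hj y hy hjy with e | ⟨rfl, e⟩ | e | e
    · exact Or.inl e.1
    · exact absurd e hx
    · exact Or.inl e.2
    · exact Or.inr e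

lemma crossing_side (h : Tri G p q c a b) (hK : K3 G) {S : Finset V}
    (hS : ∀ v, v ∈ S ↔ v ≠ p ∧ v ≠ q) {x1 x2 : V} {J1 K1 J2 K2 : Finset V}
    (hs1 : Sep G (S.erase a) x1 J1 K1) (hs2 : Sep G (S.erase b) x2 J2 K2) (c1 : c ∈ J1)
    (c2 : c ∈ J2) (a2 : a ∈ K2) (hx2 : x2 ∈ J1) (hx1 : x1 ∈ J2) :
    ∀ k ∈ K1, k = b := by
  have hpq : ∀ j ∈ K1, j ≠ b → ∀ y, G.Adj j y → y ∈ S := by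
    intro j hj hjb y hjy
    have hj1 := Finset.mem_erase.1 (hs1.subK hj)
    have hjS := (hS j).1 hj1.2
    refine (hS y).2 ⟨?_, ?_⟩
    · rintro rfl
      rcases h.np j hjy.symm with e | e | e
      · exact hjS.2 e
      · subst e; exact hs1.dis _ c1 hj
      · exact hj1.1 e
    · rintro rfl
      rcases h.nq j hjy.symm with e | e | e
      · exact hjS.1 e
      · subst e; exact hs1.dis _ c1 hj
      · exact hjb e
  have hKK : ∀ k ∈ K1, k ∉ K2 := by
    intro k hk1 hk2
    obtain ⟨j, hj, y, h1, h2, h3, h4⟩ := hK (K1 ∩ K2) ⟨k, Finset.mem_inter.2 ⟨hk1, hk2⟩⟩ a b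
      ⟨c, fun h => hs1.dis c c1 (Finset.mem_inter.1 h).1, h.ac.symm, h.bc.symm⟩
    simp only [Finset.mem_inter] at hj h1
    have hy := hpq j hj.1 (Finset.mem_erase.1 (hs2.subK hj.2)).1 y h4
    have e1 := hs1.cov y (Finset.mem_erase.2 ⟨h2, hy⟩)
    have e2 := hs2.cov y (Finset.mem_erase.2 ⟨h3, hy⟩)
    have n1 := fun h => hs1.no y h j hj.1 h4.symm
    have n2 := fun h => hs2.no y h j hj.2 h4.symm
    have := hs2.xJ
    have := hs1.xK
    have := hs1.dis x2 hx2
    have := hs2.dis x1 hx1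
    grind
  have hKJ : ∀ k ∈ K1, k ∉ J2 := by
    intro k hk1 hk2
    obtain ⟨j, hj, y, h1, h2, h3, h4⟩ := hK (K1 ∩ J2) ⟨k, Finset.mem_inter.2 ⟨hk1, hk2⟩⟩ b x1
      ⟨a, fun h => hs2.dis a (Finset.mem_inter.1 h).2 a2, h.ab, by
        rintro rfl; exact hs2.dis _ hx1 a2⟩
    simp only [Finset.mem_inter] at hj h1
    have hy := hpq j hj.1 (Finset.mem_erase.1 (hs2.subJ hj.2)).1 y h4
    have hya : y ≠ a := by rintro rfl; exact hs2.no j hj.2 _ a2 h4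
    have e1 := hs1.cov y (Finset.mem_erase.2 ⟨hya, hy⟩)
    have e2 := hs2.cov y (Finset.mem_erase.2 ⟨h2, hy⟩)
    have n1 := fun h => hs1.no y h j hj.1 h4.symm
    have n2 := fun h => hs2.no j hj.2 y h h4
    have := hs1.dis x2 hx2
    grind
  intro k hk
  by_contra hkb
  rcases hs2.cov k (Finset.mem_erase.2 ⟨hkb, (Finset.mem_erase.1 (hs1.subK hk)).2⟩) with e | e | e
  · exact hKJ k hk e
  · exact hKK k hk e
  · subst e; exact hs1.dis _ hx2 hk

lemma crossing_nbrs (h : Tri G p q c a b) {S : Finset V}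
    (hS : ∀ v, v ∈ S ↔ v ≠ p ∧ v ≠ q) {x1 : V} {J1 K1 : Finset V}
    (hs1 : Sep G (S.erase a) x1 J1 K1) (b1 : b ∈ K1) (hb : ∀ k ∈ K1, k = b) :
    ∀ y, G.Adj b y → y = x1 ∨ y = a ∨ y = q := by
  intro y hy
  by_contra hcon
  push Not at hcon
  have hyp : y ≠ p := by
    rintro rfl
    rcases h.np b hy.symm with e | e | e
    · exact h.qb.ne e.symm
    · exact h.bc e
    · exact h.ab e.symm
  rcases hs1.cov y (Finset.mem_erase.2 ⟨hcon.2.1, (hS y).2 ⟨hyp, hcon.2.2⟩⟩) with e | e | e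
  · exact hs1.no y e b b1 hy.symm
  · exact hy.ne (hb y e).symm
  · exact hcon.1 e

lemma crossing_false [Fintype V] (h : Tri G p q c a b) (hK : K3 G) (h4 : N4 G)
    (hV : 7 ≤ Fintype.card V) {S : Finset V}
    (hS : ∀ v, v ∈ S ↔ v ≠ p ∧ v ≠ q) {x1 x2 : V} {J1 K1 J2 K2 : Finset V}
    (hs1 : Sep G (S.erase a) x1 J1 K1) (hs2 : Sep G (S.erase b) x2 J2 K2) (c1 : c ∈ J1)
    (b1 : b ∈ K1) (c2 : c ∈ J2) (a2 : a ∈ K2) : False := by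
  obtain ⟨hx2, hx1⟩ := h.crossing_mem hK hS hs1 hs2 c1 b1 c2 a2
  have hS' : ∀ v, v ∈ S ↔ v ≠ q ∧ v ≠ p := fun v => (hS v).trans and_comm
  have kb := h.crossing_side hK hS hs1 hs2 c1 c2 a2 hx2 hx1
  have ka := h.symm.crossing_side hK hS' hs2 hs1 c2 c1 b1 hx1 hx2
  have nb := h.crossing_nbrs hS hs1 b1 kb
  have na := h.symm.crossing_nbrs hS' hs2 a2 ka
  have hab : G.Adj a b := by
    obtain ⟨y, h1, h2, h3⟩ := hK.exists_nbr (by omega) b x1 q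
    rcases nb y h3 with e | e | e
    · exact absurd e h1
    · exact (e ▸ h3).symm
    · exact absurd e h2
  have hx12 : x1 ≠ x2 := by rintro rfl; exact hs2.xJ hx1
  have hx1c : c ≠ x1 := by rintro rfl; exact hs1.xJ c1
  have hx2c : c ≠ x2 := by rintro rfl; exact hs2.xJ c2
  have hcard : ({p, q, a, b} : Finset V).card = 4 := card_four (by
    have := h.pq.ne; have := h.pa.ne; have := h.bp; have := h.aq; have := h.qb.ne; have := h.ab
    simp; tauto)
  have hpath : ({p, q, a, b} : Finset V) = {p, a, b, q} := by ext; simp; tauto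
  set T : Finset V := Finset.univ \ {p, q, a, b} with hT
  have hmT : ∀ v, v ∈ T ↔ v ∉ ({p, q, a, b} : Finset V) := by intro v; simp [T]
  have hmT' : ∀ v, v ∈ T ↔ v ≠ p ∧ v ≠ q ∧ v ≠ a ∧ v ≠ b := by intro v; simp [T]
  refine h4 _ T hcard (hpath ▸ Cn.path4 h.pa hab h.qb.symm) hmT ?_
  have hT3 : 3 ≤ T.card := by
    have := Finset.le_card_sdiff ({p, q, a, b} : Finset V) Finset.univ
    rw [Finset.card_univ, hcard] at this
    rw [hT]
    omega
  by_contra hcon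
  obtain ⟨x, J, K, hs⟩ := exists_sep hT3 hcon
  have exits : ∀ J K, Sep G T x J K → ∀ j ∈ J, ∀ y, y ∉ J → G.Adj j y → y = x ∨
      (j = c ∧ (y = p ∨ y = q)) ∨ (j = x2 ∧ y = a) ∨ (j = x1 ∧ y = b) := by
    intro J K hs j hj y hy hjy
    have hjT := (hmT' j).1 (hs.subJ hj)
    by_cases hyp : y = p
    · subst hyp
      have := h.np j hjy.symm
      tauto
    by_cases hyq : y = q
    · subst hyq
      have := h.nq j hjy.symm
      tauto
    by_cases hya : y = a
    · subst hya
      have := na j hjy.symm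
      tauto
    by_cases hyb : y = b
    · subst hyb
      have := nb j hjy.symm
      tauto
    rcases hs.cov y ((hmT' y).2 ⟨hyp, hyq, hya, hyb⟩) with e | e | e
    · exact absurd e hy
    · exact absurd hjy (hs.no j hj y e)
    · exact Or.inl e
  have hout : ∀ J K, Sep G T x J K → ∃ z, z ∉ J ∧ z ≠ x ∧ z ∈ T := by
    intro J K hs
    obtain ⟨k, hk⟩ := hs.neK
    exact ⟨k, fun h => hs.dis k h hk, by rintro rfl; exact hs.xK hk, hs.subK hk⟩
  have noc : ∀ J K, Sep G T x J K → c ∉ J → x1 ∈ J ∧ x2 ∈ J := by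
    intro J K hs hcJ
    obtain ⟨z, hz1, hz2, hz3⟩ := hout J K hs
    have hzT := (hmT' z).1 hz3
    constructor
    · obtain ⟨j, hj, y, h1, h2, h3, h4⟩ := hK J hs.neJ x a ⟨z, hz1, hz2, hzT.2.2.1⟩
      rcases exits J K hs j hj y h1 h4 with e | e | e | e
      · exact absurd e h2
      · exact absurd (e.1 ▸ hj) hcJ
      · exact absurd e.2 h3
      · exact e.1 ▸ hj
    · obtain ⟨j, hj, y, h1, h2, h3, h4⟩ := hK J hs.neJ x b ⟨z, hz1, hz2, hzT.2.2.2⟩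
      rcases exits J K hs j hj y h1 h4 with e | e | e | e
      · exact absurd e h2
      · exact absurd (e.1 ▸ hj) hcJ
      · exact e.1 ▸ hj
      · exact absurd e.2 h3
  have yesc : ∀ J K, Sep G T x J K → c ∈ J → False := by
    intro J K hs hcJ
    have hK' := noc K J hs.symm (hs.dis c hcJ)
    obtain ⟨z, hz1, hz2, hz3⟩ := hout J K hs
    refine h.c_side hK hcJ (x := x) (z := z) ?_ hz1 hz2
    intro j hj y hy hjy
    rcases exits J K hs j hj y hy hjy with e | e | e | e
    · exact Or.inl e
    · exact Or.inr e
    · exact absurd (e.1 ▸ hK'.2) (hs.dis j hj)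
    · exact absurd (e.1 ▸ hK'.1) (hs.dis j hj)
  have k1 := noc J K hs fun h => yesc J K hs h
  have k2 := noc K J hs.symm fun h => yesc K J hs.symm h
  exact hs.dis x1 k1.1 k2.1

lemma tc_triple [Fintype V] (h : Tri G p q c a b) (hK : K3 G) (h4 : N4 G)
    (hV : 7 ≤ Fintype.card V) {S : Finset V} (hS : ∀ v, v ∈ S ↔ v ≠ p ∧ v ≠ q) :
    TC G (S.erase a) ∨ TC G (S.erase b) := by
  have hS' : ∀ v, v ∈ S ↔ v ≠ q ∧ v ≠ p := fun v => (hS v).trans and_comm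
  have hcard : ∀ d, 3 ≤ (S.erase d).card := by
    intro d
    have h1 : S = Finset.univ \ {p, q} := by ext v; simp [hS v]
    have h2 := Finset.le_card_sdiff ({p, q} : Finset V) Finset.univ
    have h3 := Finset.card_le_two (a := p) (b := q)
    have h4 := Finset.pred_card_le_card_erase (s := S) (a := d)
    rw [Finset.card_univ, ← h1] at h2
    omega
  by_contra hcon
  push Not at hcon
  obtain ⟨x1, J1, K1, hs1⟩ := exists_sep (hcard a) hcon.1
  obtain ⟨x2, J2, K2, hs2⟩ := exists_sep (hcard b) hcon.2
  rcases h.sep_sides hK hS hs1 with ⟨c1, b1⟩ | ⟨b1, c1⟩ <;>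
    rcases h.symm.sep_sides hK hS' hs2 with ⟨c2, a2⟩ | ⟨a2, c2⟩
  · exact h.crossing_false hK h4 hV hS hs1 hs2 c1 b1 c2 a2
  · exact h.crossing_false hK h4 hV hS hs1 hs2.symm c1 b1 c2 a2
  · exact h.crossing_false hK h4 hV hS hs1.symm hs2 c1 b1 c2 a2
  · exact h.crossing_false hK h4 hV hS hs1.symm hs2.symm c1 b1 c2 a2

end Tri

lemma Leaf.exit_avoid {W S U X J : Finset V} (h : Leaf G W S U) (hXU : X ⊆ U) (hX : Cn G X)
    (hJU : J ⊆ U) (hd : Disjoint J X) (hJ : J.Nonempty) :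
    ∃ j ∈ J, ∃ y ∈ S, y ∉ J ∧ y ∉ X ∧ G.Adj j y := by
  by_contra hcon
  have hcl : ∀ j ∈ J, ∀ y ∈ S, G.Adj j y → y ∈ J ∨ y ∈ X := by
    intro j hj y hy hjy
    by_contra hc
    push Not at hc
    exact hcon ⟨j, hj, y, hy, hc.1, hc.2, hjy⟩
  have hC : Cn G (U \ J) := by
    refine Cn.of_attach hX (fun x hx => Finset.mem_sdiff.2 ⟨hXU hx, fun hxJ =>
      Finset.disjoint_left.1 hd hxJ hx⟩) fun J' hJ' hd' hne' => ?_
    obtain ⟨z, hz⟩ := hX.1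
    obtain ⟨x, hx, y, hy, hyJ', hxy⟩ := h.cn.exists_adj (hJ'.trans Finset.sdiff_subset) hne'
      ⟨z, hXU hz, fun h' => Finset.disjoint_left.1 hd' h' hz⟩
    have hx' := Finset.mem_sdiff.1 (hJ' hx)
    refine ⟨x, hx, y, Finset.mem_sdiff.2 ⟨hy, fun hyJ => ?_⟩, hyJ', hxy⟩
    rcases hcl y hyJ x (h.sub hx'.1) hxy.symm with e | e
    · exact hx'.2 e
    · exact Finset.disjoint_left.1 hd' hx e
  obtain ⟨p, hp, q, hq, s, hs, t, ht, -, hst, hps, hqt, -⟩ := h.ends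
  have hend : ∀ p ∈ U, ∀ s ∈ S \ U, G.Adj p s → p ∈ U \ J := by
    intro p hp s hs hps
    refine Finset.mem_sdiff.2 ⟨hp, fun hpJ => ?_⟩
    have hs' := Finset.mem_sdiff.1 hs
    rcases hcl p hpJ s hs'.1 hps with e | e
    · exact hs'.2 (hJU e)
    · exact hs'.2 (hXU e)
  have := h.min (U \ J) Finset.sdiff_subset hC
    ⟨s, hs, t, ht, hst, ⟨p, hend p hp s hs hps, hps⟩, q, hend q hq t ht hqt, hqt⟩
  obtain ⟨j, hj⟩ := hJ
  have hjU := hJU hj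
  rw [← this] at hjU
  exact (Finset.mem_sdiff.1 hjU).2 hj

/-- Deleting two consecutive vertices from a cycle leaves a path. -/
lemma cycle_sdiff_pair_cn {S : Finset V} (hS : TC G S) (hd : ∀ x ∈ S, D2 G S x) {c x : V}
    (hc : c ∈ S) (hx : x ∈ S) (hcx : G.Adj c x) : Cn G (S \ {c, x}) := by
  have hmem : ∀ y, y ∈ S \ {c, x} ↔ y ∈ S ∧ y ≠ c ∧ y ≠ x := by intro y; simp
  have hSc := hS.1
  refine ⟨?_, fun J hJ hne hcl y hy => ?_⟩
  · obtain ⟨y, hy, h1, h2⟩ := exists_mem_avoid hSc c x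
    exact ⟨y, (hmem y).2 ⟨hy, h1, h2⟩⟩
  by_contra hyJ
  have side : ∀ J ⊆ S \ {c, x}, J.Nonempty → (∀ j ∈ J, ∀ y ∈ S \ {c, x}, G.Adj j y → y ∈ J) →
      ∃ j ∈ J, G.Adj x j := by
    intro J hJ hne hcl
    by_contra hcon
    push Not at hcon
    have := hS.2 J (hJ.trans Finset.sdiff_subset) hne c (fun h => ((hmem c).1 (hJ h)).2.1 rfl)
      (fun j hj y hy hjy => by
        by_cases h1 : y = c
        · exact Or.inr h1
        by_cases h2 : y = x
        · exact absurd (h2 ▸ hjy.symm) (hcon j hj)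
        · exact Or.inl (hcl j hj y ((hmem y).2 ⟨hy, h1, h2⟩) hjy)) x hx
    rcases this with e | e
    · exact ((hmem x).1 (hJ e)).2.2 rfl
    · exact hcx.ne e.symm
  obtain ⟨j, hj, hxj⟩ := side J hJ hne hcl
  obtain ⟨k, hk, hxk⟩ := side ((S \ {c, x}) \ J) Finset.sdiff_subset ⟨y, Finset.mem_sdiff.2 ⟨hy, hyJ⟩⟩
    (fun k hk z hz hkz => Finset.mem_sdiff.2 ⟨hz, fun hzJ =>
      (Finset.mem_sdiff.1 hk).2 (hcl z hzJ k (Finset.mem_sdiff.1 hk).1 hkz.symm)⟩)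
  have hk' := Finset.mem_sdiff.1 hk
  have hjm := (hmem j).1 (hJ hj)
  have hkm := (hmem k).1 hk'.1
  rcases hd x hx c hc j hjm.1 k hkm.1 hcx.symm hxj hxk with e | e | e
  · exact hjm.2.1 e.symm
  · exact hkm.2.1 e.symm
  · exact hk'.2 (e ▸ hj)

lemma TC.cone {Q : Finset V} (hQ : Cn G Q) {a b : V} (haQ : a ∉ Q) (h2 : 2 ≤ Q.card)
    (hadj : ∀ x ∈ Q, x ≠ b → G.Adj a x)
    (hb : b ∈ Q → G.Adj a b ∨ ∃ y ∈ Q, ∃ z ∈ Q, y ≠ z ∧ G.Adj b y ∧ G.Adj b z) :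
    TC G (insert a Q) := by
  by_contra hcon
  obtain ⟨x, J, K, hs⟩ := exists_sep (by rw [Finset.card_insert_of_notMem haQ]; omega) hcon
  have main : ∀ J K, Sep G (insert a Q) x J K → a ∈ J → False := by
    intro J K hs haJ
    have hKQ : ∀ k ∈ K, k ∈ Q ∧ k = b := by
      intro k hk
      have hkQ : k ∈ Q := by
        rcases Finset.mem_insert.1 (hs.subK hk) with e | e
        · exact absurd (e ▸ hk) (hs.dis a haJ)
        · exact e
      refine ⟨hkQ, ?_⟩
      by_contra hkb
      exact hs.no a haJ k hk (hadj k hkQ hkb)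
    obtain ⟨k, hk⟩ := hs.neK
    obtain ⟨hbQ, rfl⟩ := hKQ k hk
    rcases hb hbQ with e | ⟨y, hy, z, hz, hyz, hby, hbz⟩
    · exact hs.no a haJ _ hk e
    · have key : ∀ w ∈ Q, G.Adj k w → w = x := by
        intro w hw hkw
        rcases hs.cov w (Finset.mem_insert_of_mem hw) with e | e | e
        · exact absurd hkw.symm (hs.no w e k hk)
        · exact absurd (hKQ w e).2 hkw.ne.symm
        · exact e
      exact hyz ((key y hy hby).trans (key z hz hbz).symm)
  rcases hs.cov a (Finset.mem_insert_self _ _) with e | e | e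
  · exact main J K hs e
  · exact main K J hs.symm e
  · subst e
    have sub : ∀ J ⊆ insert a Q, a ∉ J → J ⊆ Q := by
      intro J hJ ha j hj
      exact (Finset.mem_insert.1 (hJ hj)).resolve_left (by rintro rfl; exact ha hj)
    obtain ⟨k, hk⟩ := hs.neK
    have := hQ.2 J (sub J hs.subJ hs.xJ) hs.neJ (fun j hj y hy hjy => by
      rcases hs.cov y (Finset.mem_insert_of_mem hy) with e | e | e
      · exact e
      · exact absurd hjy (hs.no j hj y e)
      · exact absurd (e ▸ hy) haQ) k (sub K hs.subK hs.xK hk)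
    exact hs.dis k this hk

/-- A `Tri` configuration in which deleting the path `q p a` leaves a `2`-connected graph on `S`. -/
structure TriPath (G : SimpleGraph V) (p q c a b : V) (S : Finset V) : Prop extends
    Tri G p q c a b where
  mem : ∀ v, v ∈ S ↔ v ≠ p ∧ v ≠ q ∧ v ≠ a
  tc : TC G S

namespace TriPath
variable {p q c a b : V} {S U F F1 F2 : Finset V}

lemma mem_c (h : TriPath G p q c a b S) : c ∈ S := (h.mem c).2 ⟨h.pc.ne.symm, h.qc.ne.symm, h.ac.symm⟩
lemma mem_b (h : TriPath G p q c a b S) : b ∈ S := (h.mem b).2 ⟨h.bp, h.qb.ne.symm, h.ab.symm⟩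
lemma not_p (h : TriPath G p q c a b S) : p ∉ S := fun hp => ((h.mem p).1 hp).1 rfl
lemma not_q (h : TriPath G p q c a b S) : q ∉ S := fun hq => ((h.mem q).1 hq).2.1 rfl
lemma not_a (h : TriPath G p q c a b S) : a ∉ S := fun ha => ((h.mem a).1 ha).2.2 rfl

lemma att_cases (h : TriPath G p q c a b S) {x : V} (hx : x ∈ S) (hA : Att G {p, q, a} x) :
    x = c ∨ x = b ∨ G.Adj a x := by
  obtain ⟨w, hw, hxw⟩ := hA
  have hxS := (h.mem x).1 hx
  simp only [Finset.mem_insert, Finset.mem_singleton] at hw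
  rcases hw with rfl | rfl | rfl
  · have := h.np x hxw.symm
    tauto
  · have := h.nq x hxw.symm
    tauto
  · exact Or.inr (Or.inr hxw.symm)

lemma leaf_adj (h : TriPath G p q c a b S) (hU : Leaf G {p, q, a} S U) {x : V} (hx : x ∈ U)
    (hc : x ≠ c) (hb : x ≠ b) : G.Adj a x :=
  ((h.att_cases (hU.sub hx) (hU.att x hx)).resolve_left hc).resolve_left hb

lemma nadj_qa (h : TriPath G p q c a b S) : ¬ G.Adj q a := by
  intro hqa
  rcases h.nq a hqa with e | e | e
  · exact h.pa.ne e.symm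
  · exact h.ac e
  · exact h.ab e

lemma not_leaf_subset_pair (h : TriPath G p q c a b S) (h4 : N4 G) (hF : Leaf G {p, q, a} S F1)
    (hF' : Leaf G {p, q, a} S F2) (hd : Disjoint F1 F2) (hs : F1 ⊆ {b, c}) : False := by
  have hcard := h.bc
  have hF1 : F1 = {b, c} := Finset.eq_of_subset_of_card_le hs (by
    rw [Finset.card_pair h.bc]; exact hF.two)
  subst hF1
  have hW : ({p, q, b, c} : Finset V).card = 4 := card_four (by
    have := h.pq.ne; have := h.pc.ne; have := h.bp; have := h.bc; have := h.qb.ne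
    have := h.qc.ne
    simp; tauto)
  have hcn : Cn G {p, q, b, c} := by
    have : ({p, q, b, c} : Finset V) = {c, p, q, b} := by ext; simp; tauto
    rw [this]
    exact Cn.path4 h.pc.symm h.pq h.qb
  refine h4 _ (insert a (S \ {b, c})) hW hcn ?_ ?_
  · intro v
    have := h.mem v
    have := h.pa.ne
    have := h.aq
    have := h.ab
    have := h.ac
    simp only [Finset.mem_insert, Finset.mem_sdiff, Finset.mem_singleton]
    by_cases hva : v = a
    · subst hva; tauto
    · tauto
  · obtain ⟨x, hx, y, hy, hxy⟩ := Finset.one_lt_card.1 (lt_of_lt_of_le one_lt_two hF'.two)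
    have key : ∀ x ∈ F2, x ∈ S \ {b, c} ∧ G.Adj a x := by
      intro x hx
      have hx' : x ∉ ({b, c} : Finset V) := fun h' => Finset.disjoint_left.1 hd h' hx
      have hx'' := hx'
      simp only [Finset.mem_insert, Finset.mem_singleton, not_or] at hx''
      exact ⟨Finset.mem_sdiff.2 ⟨hF'.sub hx, hx'⟩, h.leaf_adj hF' hx hx''.2 hx''.1⟩
    exact hF.tcR.add_one (key x hx).1 (key y hy).1 hxy (key x hx).2 (key y hy).2

lemma not_leaf_avoid (h : TriPath G p q c a b S) (h4 : N4 G) (hF : Leaf G {p, q, a} S F)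
    (hb : b ∉ F) (hc : c ∉ F) {z : V} (hz : z ∈ S) (hzF : z ∉ F) (haz : G.Adj a z) : False := by
  have hadj : ∀ x ∈ F, G.Adj a x := fun x hx =>
    h.leaf_adj hF hx (by rintro rfl; exact hc hx) (by rintro rfl; exact hb hx)
  have hbR : b ∈ S \ F := Finset.mem_sdiff.2 ⟨h.mem_b, hb⟩
  have hcR : c ∈ S \ F := Finset.mem_sdiff.2 ⟨h.mem_c, hc⟩
  have hzR : z ∈ S \ F := Finset.mem_sdiff.2 ⟨hz, hzF⟩
  have haF : a ∉ F := fun h' => h.not_a (hF.sub h')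
  have hpF : p ∉ F := fun h' => h.not_p (hF.sub h')
  have hqF : q ∉ F := fun h' => h.not_q (hF.sub h')
  have hpq := h.pq.ne
  have hpa := h.pa.ne
  have haq := h.aq
  have t1 : TC G (insert q (S \ F)) := hF.tcR.add_one hbR hcR h.bc h.qb h.qc
  have t2 : TC G (insert p (insert q (S \ F))) := t1.add_one (u := q) (v := c)
    (Finset.mem_insert_self _ _) (Finset.mem_insert_of_mem hcR) h.qc.ne h.pq h.pc
  obtain ⟨f, hf⟩ := hF.cn.1
  have hFa : Cn G (insert a F) := hF.cn.insert_adj hf (hadj f hf).symm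
  have hcard : (insert a F).card = F.card + 1 := Finset.card_insert_of_notMem haF
  rcases lt_trichotomy F.card 3 with hlt | heq | hgt
  · have h2 : F.card = 2 := by have := hF.two; omega
    refine h4 (insert p (insert a F)) (insert q (S \ F)) ?_ ?_ ?_ t1
    · rw [Finset.card_insert_of_notMem (by simp [hpa, hpF]), hcard, h2]
    · exact hFa.insert_adj (Finset.mem_insert_self _ _) h.pa.symm
    · intro v
      have := h.mem v
      simp only [Finset.mem_insert, Finset.mem_sdiff]
      by_cases hvq : v = q
      · subst hvq; tauto
      · tauto
  · refine h4 (insert a F) (insert p (insert q (S \ F))) (by omega) hFa ?_ t2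
    intro v
    have := h.mem v
    simp only [Finset.mem_insert, Finset.mem_sdiff]
    by_cases hvq : v = q
    · subst hvq; tauto
    · by_cases hvp : v = p
      · subst hvp; tauto
      · tauto
  · obtain ⟨X, hXF, hX, hX4⟩ := hF.cn.exists_subset (k := 4) (by omega) (by omega)
    have t3 : TC G (insert a (insert p (insert q (S \ F)))) := t2.add_one (u := p) (v := z)
      (Finset.mem_insert_self _ _)
      (Finset.mem_insert_of_mem (Finset.mem_insert_of_mem hzR))
      (by rintro rfl; exact h.not_p hz) h.pa.symm haz
    set T : Finset V := insert a (insert p (insert q (S \ X))) with hT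
    have hmT : ∀ v, v ∈ T ↔ v = a ∨ v = p ∨ v = q ∨ (v ∈ S ∧ v ∉ X) := by
      intro v; simp [T]
    refine h4 X T hX4 hX ?_ (t3.extend ?_ ?_)
    · intro v
      rw [hmT]
      have := h.mem v
      have e1 : v = a → v ∉ X := by rintro rfl h'; exact haF (hXF h')
      have e2 : v = p → v ∉ X := by rintro rfl h'; exact hpF (hXF h')
      have e3 : v = q → v ∉ X := by rintro rfl h'; exact hqF (hXF h')
      clear * - this e1 e2 e3
      grind
    · intro v hv
      simp only [Finset.mem_insert, Finset.mem_sdiff] at hv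
      rw [hmT]
      have : v ∈ X → v ∈ F := fun h' => hXF h'
      clear * - this hv
      tauto
    · intro J hJ hdJ hne
      have hJm : ∀ j ∈ J, j ∈ F ∧ j ∉ X := by
        intro j hj
        have h1 := (hmT j).1 (hJ hj)
        have h2 := fun h' => Finset.disjoint_left.1 hdJ hj h'
        simp only [Finset.mem_insert, Finset.mem_sdiff] at h2
        clear * - h1 h2
        grind
      obtain ⟨j, hj, y, hy, hyJ, hyX, hjy⟩ := hF.exit_avoid hXF hX (fun j hj => (hJm j hj).1)
        (Finset.disjoint_left.2 fun j hj => (hJm j hj).2) hne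
      refine ⟨a, Finset.mem_sdiff.2 ⟨(hmT a).2 (Or.inl rfl), fun h' => haF (hJm a h').1⟩, y,
        Finset.mem_sdiff.2 ⟨(hmT y).2 (Or.inr (Or.inr (Or.inr ⟨hy, hyX⟩))), hyJ⟩, ?_,
        ⟨j, hj, (hadj j (hJm j hj).1).symm⟩, j, hj, hjy⟩
      rintro rfl
      exact h.not_a hy

lemma not_leaves_split (h : TriPath G p q c a b S) (h4 : N4 G) (hF : Leaf G {p, q, a} S F1)
    (hF' : Leaf G {p, q, a} S F2) (hd : Disjoint F1 F2) (hc : c ∈ F1) (hb : b ∈ F2)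
    (hac : ¬ G.Adj a c) (ha : ¬ Deg3 G a) : False := by
  have hb1 : b ∉ F1 := fun h' => Finset.disjoint_left.1 hd h' hb
  have hc2 : c ∉ F2 := fun h' => Finset.disjoint_left.1 hd hc h'
  obtain ⟨f, hf, hcf⟩ := hF.cn.exists_nbr hc hF.two
  have hfb : f ≠ b := by rintro rfl; exact hb1 hf
  have haf : G.Adj a f := h.leaf_adj hF hf hcf.ne.symm hfb
  obtain ⟨g, hg, hgb⟩ : ∃ g ∈ F2, g ≠ b := Finset.exists_mem_ne (by have := hF'.two; omega) b
  have hag : G.Adj a g := h.leaf_adj hF' hg (by rintro rfl; exact hc2 hg) hgb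
  have hfS := hF.sub hf
  have hgS := hF'.sub hg
  have hcS := h.mem_c
  have hfm := (h.mem f).1 hfS
  have hpc := h.pc.ne
  have hqc := h.qc.ne
  have hac' := h.ac
  have hW : ({p, q, c, f} : Finset V).card = 4 := card_four (by
    have := h.pq.ne; have := hcf.ne
    simp; tauto)
  have hcn : Cn G {p, q, c, f} := by
    have : ({p, q, c, f} : Finset V) = {q, p, c, f} := by ext; simp; tauto
    rw [this]
    exact Cn.path4 h.pq.symm h.pc hcf
  have hg1 : g ∉ F1 := fun h' => Finset.disjoint_left.1 hd h' hg
  set T : Finset V := insert a (S \ {c, f}) with hT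
  have hmT : ∀ v, v ∈ T ↔ v = a ∨ (v ∈ S ∧ v ≠ c ∧ v ≠ f) := by intro v; simp [T]
  have hXF : ({c, f} : Finset V) ⊆ F1 := by
    intro x hx
    simp only [Finset.mem_insert, Finset.mem_singleton] at hx
    rcases hx with rfl | rfl <;> assumption
  refine h4 _ T hW hcn ?_ (hF.tcR.extend ?_ ?_)
  · intro v
    rw [hmT]
    have := h.mem v
    have hpa := h.pa.ne
    have haq := h.aq
    simp only [Finset.mem_insert, Finset.mem_singleton]
    clear * - this hpa haq hac' hfm
    by_cases hva : v = a
    · subst hva; tauto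
    · tauto
  · intro v hv
    have hv' := Finset.mem_sdiff.1 hv
    refine (hmT v).2 (Or.inr ⟨hv'.1, ?_, ?_⟩) <;> rintro rfl <;> exact hv'.2 ‹_›
  · intro J hJ hdJ hne
    have hJm : ∀ j ∈ J, j ≠ a → j ∈ F1 ∧ j ∉ ({c, f} : Finset V) := by
      intro j hj hja
      have h1 := ((hmT j).1 (hJ hj)).resolve_left hja
      have h2 := fun h' => Finset.disjoint_left.1 hdJ hj h'
      simp only [Finset.mem_sdiff, Finset.mem_insert, Finset.mem_singleton] at h2 ⊢
      clear * - h1 h2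
      tauto
    have exit : (J.erase a).Nonempty → ∃ j ∈ J.erase a, ∃ y ∈ S, y ∉ J ∧ y ∉ ({c, f} : Finset V) ∧
        G.Adj j y := by
      intro hne'
      obtain ⟨j, hj, y, hy, hyJ, hyX, hjy⟩ := hF.exit_avoid hXF (Cn.pair hcf) (J := J.erase a)
        (fun j hj => (hJm j (Finset.mem_erase.1 hj).2 (Finset.mem_erase.1 hj).1).1)
        (Finset.disjoint_left.2 fun j hj =>
          (hJm j (Finset.mem_erase.1 hj).2 (Finset.mem_erase.1 hj).1).2) hne'
      exact ⟨j, hj, y, hy, fun h' => hyJ (Finset.mem_erase.2 ⟨by rintro rfl; exact h.not_a hy, h'⟩),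
        hyX, hjy⟩
    have hTS : ∀ y ∈ S, y ∉ J → y ∉ ({c, f} : Finset V) → y ∈ T \ J := by
      intro y hy hyJ hyX
      simp only [Finset.mem_insert, Finset.mem_singleton, not_or] at hyX
      exact Finset.mem_sdiff.2 ⟨(hmT y).2 (Or.inr ⟨hy, hyX⟩), hyJ⟩
    have hgX : g ∉ ({c, f} : Finset V) := fun h' => hg1 (hXF h')
    have hgJ : g ∉ J := fun h' => hg1 (hJm g h' (by rintro rfl; exact h.not_a hgS)).1
    by_cases haJ : a ∈ J
    · by_cases hne' : (J.erase a).Nonempty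
      · obtain ⟨j, hj, y, hy, hyJ, hyX, hjy⟩ := exit hne'
        have hj' := Finset.mem_erase.1 hj
        have hjF := (hJm j hj'.2 hj'.1).1
        refine ⟨g, hTS g hgS hgJ hgX, y, hTS y hy hyJ hyX, ?_, ⟨a, haJ, hag⟩, j, hj'.2, hjy⟩
        rintro rfl
        exact Finset.disjoint_left.1 hd hjF
          (hF'.mem_of_adj hg (hF.sub hjF) hjy.symm (hF.d2 hjF))
      · obtain ⟨y, hay, hyp, hyf, hyg⟩ : ∃ y, G.Adj a y ∧ y ≠ p ∧ y ≠ f ∧ y ≠ g := by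
          by_contra hcon
          push Not at hcon
          refine ha ⟨p, f, g, fun y hy => ?_⟩
          have := hcon y hy
          tauto
        have hyS : y ∈ S := (h.mem y).2 ⟨hyp, by rintro rfl; exact h.nadj_qa hay.symm, hay.ne.symm⟩
        have hyJ : y ∉ J := fun h' => hne' ⟨y, Finset.mem_erase.2 ⟨hay.ne.symm, h'⟩⟩
        have hyc : y ≠ c := by rintro rfl; exact hac hay
        exact ⟨g, hTS g hgS hgJ hgX, y, hTS y hyS hyJ (by simp [hyc, hyf]), hyg.symm,
          ⟨a, haJ, hag⟩, a, haJ, hay⟩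
    · have hJe : J.erase a = J := Finset.erase_eq_of_notMem haJ
      rw [hJe] at exit
      obtain ⟨j, hj, y, hy, hyJ, hyX, hjy⟩ := exit hne
      have hja : j ≠ a := by rintro rfl; exact haJ hj
      have hjm := hJm j hj hja
      refine ⟨a, Finset.mem_sdiff.2 ⟨(hmT a).2 (Or.inl rfl), haJ⟩, y, hTS y hy hyJ hyX, ?_,
        ⟨j, hj, (h.leaf_adj hF hjm.1 ?_ ?_).symm⟩, j, hj, hjy⟩
      · rintro rfl; exact h.not_a hy
      · rintro rfl; simp at hjm
      · rintro rfl; exact hb1 hjm.1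

end TriPath

namespace TriPath
variable {p q c a b : V} {S U F F1 F2 : Finset V}

lemma exists_split_leaves (h : TriPath G p q c a b S) (h4 : N4 G) (hF : Leaf G {p, q, a} S F1)
    (hF' : Leaf G {p, q, a} S F2) (hd : Disjoint F1 F2) :
    ∃ F1 F2, Leaf G {p, q, a} S F1 ∧ Leaf G {p, q, a} S F2 ∧ Disjoint F1 F2 ∧ c ∈ F1 ∧ b ∈ F2 := by
  have key : ∀ F1 F2, Leaf G {p, q, a} S F1 → Leaf G {p, q, a} S F2 → Disjoint F1 F2 →
      b ∈ F1 ∨ c ∈ F1 := by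
    intro F1 F2 hF hF' hd
    by_contra hcon
    push Not at hcon
    obtain ⟨z, hz, hzbc⟩ := Finset.not_subset.1 (h.not_leaf_subset_pair h4 hF' hF hd.symm)
    simp only [Finset.mem_insert, Finset.mem_singleton, not_or] at hzbc
    exact h.not_leaf_avoid h4 hF hcon.1 hcon.2 (hF'.sub hz)
      (fun h' => Finset.disjoint_left.1 hd h' hz) (h.leaf_adj hF' hz hzbc.2 hzbc.1)
  have hb : b ∈ F1 → b ∉ F2 := fun h1 => Finset.disjoint_left.1 hd h1
  have hc : c ∈ F1 → c ∉ F2 := fun h1 => Finset.disjoint_left.1 hd h1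
  rcases key F1 F2 hF hF' hd with h1 | h1 <;> rcases key F2 F1 hF' hF hd.symm with h2 | h2
  · exact absurd h2 (hb h1)
  · exact ⟨F2, F1, hF', hF, hd.symm, h2, h1⟩
  · exact ⟨F1, F2, hF, hF', hd, h1, h2⟩
  · exact absurd h2 (hc h1)

lemma leaf_not_mem (h1 : Leaf G {p, q, a} S F1) (h2 : Leaf G {p, q, a} S F2) (hd : Disjoint F1 F2)
    {x y : V} (hx : x ∈ F1) (hxy : G.Adj x y) : y ∉ F2 := fun hy =>
  Finset.disjoint_left.1 hd hx (h2.mem_of_adj hy (h1.sub hx) hxy.symm (h1.d2 hx))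

set_option maxHeartbeats 1000000 in
lemma not_leaves_deg3 [Fintype V] (h : TriPath G p q c a b S) (hK : K3 G) (h4 : N4 G)
    (hF : Leaf G {p, q, a} S F1) (hF' : Leaf G {p, q, a} S F2) (hd : Disjoint F1 F2) (hc : c ∈ F1)
    (hb : b ∈ F2) (ha : Deg3 G a) : False := by
  have hb1 : b ∉ F1 := fun h' => Finset.disjoint_left.1 hd h' hb
  have hc2 : c ∉ F2 := fun h' => Finset.disjoint_left.1 hd hc h'
  obtain ⟨a1, ha1, ha1c⟩ : ∃ x ∈ F1, x ≠ c := Finset.exists_mem_ne (by have := hF.two; omega) c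
  obtain ⟨a2, ha2, ha2b⟩ : ∃ x ∈ F2, x ≠ b := Finset.exists_mem_ne (by have := hF'.two; omega) b
  have ha1b : a1 ≠ b := by rintro rfl; exact hb1 ha1
  have ha2c : a2 ≠ c := by rintro rfl; exact hc2 ha2
  have haa1 : G.Adj a a1 := h.leaf_adj hF ha1 ha1c ha1b
  have haa2 : G.Adj a a2 := h.leaf_adj hF' ha2 ha2c ha2b
  have ha12 : a1 ∉ F2 := fun h' => Finset.disjoint_left.1 hd ha1 h'
  have ha21 : a2 ∉ F1 := fun h' => Finset.disjoint_left.1 hd h' ha2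
  have ha1a2 : a1 ≠ a2 := by rintro rfl; exact ha12 ha2
  have ha1S := hF.sub ha1
  have ha2S := hF'.sub ha2
  have hcS := h.mem_c
  have hbS := h.mem_b
  have hpS := h.not_p
  have hqS := h.not_q
  have haS := h.not_a
  have na : ∀ x, G.Adj a x → x = p ∨ x = a1 ∨ x = a2 := ha.cover h.pa.symm haa1 haa2
    (by rintro rfl; exact hpS ha1S) (by rintro rfl; exact hpS ha2S) ha1a2
  have e1 : F1 = {c, a1} := by
    ext x
    simp only [Finset.mem_insert, Finset.mem_singleton]
    refine ⟨fun hx => ?_, by rintro (rfl | rfl) <;> assumption⟩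
    by_contra hcon
    push Not at hcon
    rcases na x (h.leaf_adj hF hx hcon.1 (by rintro rfl; exact hb1 hx)) with rfl | rfl | rfl
    · exact hpS (hF.sub hx)
    · exact hcon.2 rfl
    · exact ha21 hx
  have e2 : F2 = {b, a2} := by
    ext x
    simp only [Finset.mem_insert, Finset.mem_singleton]
    refine ⟨fun hx => ?_, by rintro (rfl | rfl) <;> assumption⟩
    by_contra hcon
    push Not at hcon
    rcases na x (h.leaf_adj hF' hx (by rintro rfl; exact hc2 hx) hcon.1) with rfl | rfl | rfl
    · exact hpS (hF'.sub hx)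
    · exact ha12 hx
    · exact hcon.2 rfl
  obtain ⟨a1x, c', a1', e1', hca1, hca', hc'R, ha1R, hcc', ha1a1', hcu, ha1u⟩ :=
    hF.exists_pair (by rw [e1, Finset.card_pair ha1c.symm]) hc
  obtain ⟨a2x, b', a2', e2', hba2, hba', hb'R, ha2R, hbb', ha2a2', hbu, ha2u⟩ :=
    hF'.exists_pair (by rw [e2, Finset.card_pair ha2b.symm]) hb
  obtain rfl : a1x = a1 := by
    have := e1' ▸ ha1
    simp only [Finset.mem_insert, Finset.mem_singleton] at this
    exact (this.resolve_left ha1c).symm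
  obtain rfl : a2x = a2 := by
    have := e2' ▸ ha2
    simp only [Finset.mem_insert, Finset.mem_singleton] at this
    exact (this.resolve_left ha2b).symm
  rw [Finset.mem_sdiff] at hc'R ha1R hb'R ha2R
  have hc'2 := leaf_not_mem hF hF' hd hc hcc'
  have ha1'2 := leaf_not_mem hF hF' hd ha1 ha1a1'
  have hb'1 := leaf_not_mem hF' hF hd.symm hb hbb'
  have ha2'1 := leaf_not_mem hF' hF hd.symm ha2 ha2a2'
  have mem1 : ∀ x, x ∈ F1 ↔ x = c ∨ x = a1x := by intro x; rw [e1]; simp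
  have mem2 : ∀ x, x ∈ F2 ↔ x = b ∨ x = a2x := by intro x; rw [e2]; simp
  have hpq := h.pq.ne
  have hpa := h.pa.ne
  have haq := h.aq
  obtain rfl : b' = c' := by
    obtain ⟨g, hg, e, he, hge, hg1, -, hee1, -, hgA, heA, -⟩ := exists_edge_in hK h4 hF'.tcR
      (x := a) (y := a2x) (u := a1x) (v := a2') (i := p) (j := q) (k := b)
      (fun h' => haS (Finset.mem_sdiff.1 h').1) (fun h' => (Finset.mem_sdiff.1 h').2 ha2)
      (Finset.mem_sdiff.2 ⟨ha1S, ha12⟩) (Finset.mem_sdiff.2 ha2R)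
      (by rintro rfl; exact ha2'1 ha1) haa1 haa2 ha2a2'
      (fun z hz haz => by
        have hz' := Finset.mem_sdiff.1 hz
        rcases na z haz with e | e | e
        · exact absurd (e ▸ hz'.1) hpS
        · exact e
        · exact absurd (e ▸ ha2) hz'.2)
      ha2u h.pq h.qb h.bp.symm (by
        intro v
        have := h.mem v
        have := mem2 v
        simp only [Finset.mem_insert, Finset.mem_sdiff, Finset.mem_singleton]
        have := (h.mem a2x).1 ha2S
        by_cases hva : v = a
        · subst hva; clear * - hpa haq h; have := h.ab; tauto
        · by_cases hv2 : v = a2x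
          · subst hv2; clear * - this ha2b; tauto
          · grind)
    have att : ∀ g ∈ S \ F2, G.Adj p g ∨ G.Adj q g ∨ G.Adj b g → g = c ∨ g = b' := by
      intro g hg hgA
      have hg' := Finset.mem_sdiff.1 hg
      rcases hgA with e | e | e
      · rcases h.np g e with rfl | rfl | rfl
        · exact absurd hg'.1 hqS
        · exact Or.inl rfl
        · exact absurd hg'.1 haS
      · rcases h.nq g e with rfl | rfl | rfl
        · exact absurd hg'.1 hpS
        · exact Or.inl rfl
        · exact absurd hb hg'.2
      · exact Or.inr (hbu g hg e)
    refine hcu b' (Finset.mem_sdiff.2 ⟨hb'R.1, hb'1⟩) ?_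
    rcases att g hg hgA with rfl | rfl <;> rcases att e he heA with rfl | rfl
    · exact absurd rfl hge.ne
    · exact hge
    · exact hge.symm
    · exact absurd rfl hge.ne
  obtain rfl : a1' = a2' := by
    obtain ⟨g, hg, e, he, hge, hg1, -, hee1, -, hgA, heA, -⟩ := exists_edge_in hK h4 hF.tcR
      (x := q) (y := c) (u := b) (v := b') (i := a1x) (j := a) (k := p)
      (fun h' => hqS (Finset.mem_sdiff.1 h').1) (fun h' => (Finset.mem_sdiff.1 h').2 hc)
      (Finset.mem_sdiff.2 ⟨hbS, hb1⟩) (Finset.mem_sdiff.2 hc'R)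
      (by rintro rfl; exact hc'2 hb) h.qb h.qc hcc'
      (fun z hz haz => by
        have hz' := Finset.mem_sdiff.1 hz
        rcases h.nq z haz with e | e | e
        · exact absurd (e ▸ hz'.1) hpS
        · exact absurd (e ▸ hc) hz'.2
        · exact e)
      hcu haa1.symm h.pa.symm (by rintro rfl; exact hpS ha1S) (by
        intro v
        have := h.mem v
        have := mem1 v
        simp only [Finset.mem_insert, Finset.mem_sdiff, Finset.mem_singleton]
        have := (h.mem a1x).1 ha1S
        have := (h.mem c).1 hcS
        grind)
    have att : ∀ g ∈ S \ F1, G.Adj a1x g ∨ G.Adj a g ∨ G.Adj p g → g = a2x ∨ g = a1' := by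
      intro g hg hgA
      have hg' := Finset.mem_sdiff.1 hg
      rcases hgA with e | e | e
      · exact Or.inr (ha1u g hg e)
      · rcases na g e with rfl | rfl | rfl
        · exact absurd hg'.1 hpS
        · exact absurd ha1 hg'.2
        · exact Or.inl rfl
      · rcases h.np g e with rfl | rfl | rfl
        · exact absurd hg'.1 hqS
        · exact absurd hc hg'.2
        · exact absurd hg'.1 haS
    refine ha2u a1' (Finset.mem_sdiff.2 ⟨ha1R.1, ha1'2⟩) ?_
    rcases att g hg hgA with rfl | rfl <;> rcases att e he heA with rfl | rfl
    · exact absurd rfl hge.ne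
    · exact hge
    · exact hge.symm
    · exact absurd rfl hge.ne
  have hM : ∀ v ∈ S, v ∉ F1 → v ∉ F2 → v = b' ∨ v = a1' := by
    by_contra hcon
    push Not at hcon
    obtain ⟨v, hv, hv1, hv2, hvb, hva⟩ := hcon
    obtain ⟨j, hj, y, hyJ, hyb, hya, hjy⟩ := hK
      (S.filter fun v => v ∉ F1 ∧ v ∉ F2 ∧ v ≠ b' ∧ v ≠ a1')
      ⟨v, Finset.mem_filter.2 ⟨hv, hv1, hv2, hvb, hva⟩⟩ b' a1'
      ⟨p, fun h' => hpS (Finset.mem_filter.1 h').1, by rintro rfl; exact hpS hc'R.1,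
        by rintro rfl; exact hpS ha1R.1⟩
    obtain ⟨hjS, hj1, hj2, hjb, hja⟩ := Finset.mem_filter.1 hj
    by_cases hyS : y ∈ S
    · by_cases hy1 : y ∈ F1
      · rcases (mem1 y).1 hy1 with rfl | rfl
        · exact hjb (hcu j (Finset.mem_sdiff.2 ⟨hjS, hj1⟩) hjy.symm)
        · exact hja (ha1u j (Finset.mem_sdiff.2 ⟨hjS, hj1⟩) hjy.symm)
      · by_cases hy2 : y ∈ F2
        · rcases (mem2 y).1 hy2 with rfl | rfl
          · exact hjb (hbu j (Finset.mem_sdiff.2 ⟨hjS, hj2⟩) hjy.symm)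
          · exact hja (ha2u j (Finset.mem_sdiff.2 ⟨hjS, hj2⟩) hjy.symm)
        · exact hyJ (Finset.mem_filter.2 ⟨hyS, hy1, hy2, hyb, hya⟩)
    · have hyW : y ∈ ({p, q, a} : Finset V) := by
        have := h.mem y
        simp only [Finset.mem_insert, Finset.mem_singleton]
        tauto
      rcases h.att_cases hjS ⟨y, hyW, hjy⟩ with rfl | rfl | e
      · exact hj1 hc
      · exact hj2 hb
      · rcases na j e with rfl | rfl | rfl
        · exact hpS hjS
        · exact hj1 ha1
        · exact hj2 ha2
  have hbc := h.bc
  have hcm := (h.mem c).1 hcS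
  have hbm := (h.mem b).1 hbS
  have ha1m := (h.mem a1x).1 ha1S
  have ha2m := (h.mem a2x).1 ha2S
  have hc'm := (h.mem b').1 hc'R.1
  have ha1'm := (h.mem a1').1 ha1R.1
  rw [mem1] at ha2'1 hb'1
  rw [mem2] at ha1'2 hc'2
  have hW : ({a1', a1x, a, a2x} : Finset V).card = 4 := card_four (by
    simp; grind)
  have hcyc := (TC.cycle4 hcc'.symm h.qc.symm h.qb hbb' (by tauto) hbc.symm).add_one
    (x := p) (u := c) (v := q) (by simp) (by simp) h.qc.ne.symm h.pc h.pq
  refine h4 _ _ hW (Cn.path4 ha1a1'.symm haa1.symm haa2) ?_ hcyc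
  intro v
  simp only [Finset.mem_insert, Finset.mem_singleton]
  have hv := h.mem v
  have hMv := hM v
  rw [mem1, mem2] at hMv
  grind

end TriPath

namespace TriPath
variable {p q c a b : V} {S : Finset V}

lemma not_all_att_deg3 (h : TriPath G p q c a b S) (h4 : N4 G) (hS : 4 ≤ S.card)
    (hatt : ∀ x ∈ S, Att G {p, q, a} x) (ha : Deg3 G a) : False := by
  have hcard := Finset.card_erase_of_mem h.mem_c
  have hpS := h.not_p
  have hadj : ∀ x ∈ S, x ≠ c → x ≠ b → G.Adj a x := fun x hx hc hb =>
    ((h.att_cases hx (hatt x hx)).resolve_left hc).resolve_left hb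
  obtain ⟨x, hx, hxb⟩ : ∃ x ∈ S.erase c, x ≠ b := Finset.exists_mem_ne (by omega) b
  have hx' := Finset.mem_erase.1 hx
  have hax := hadj x hx'.2 hx'.1 hxb
  have hle : S.card ≤ 4 := by
    obtain ⟨u, v, w, huvw⟩ := ha
    have hsub : S ⊆ insert c (insert b (({u, v, w} : Finset V).erase p)) := by
      intro y hy
      have := hadj y hy
      have h1 := huvw y
      have h2 : y ≠ p := by rintro rfl; exact hpS hy
      simp only [Finset.mem_insert, Finset.mem_erase, Finset.mem_singleton]
      tauto
    have h1 := Finset.card_le_card hsub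
    have h2 := Finset.card_insert_le c (insert b (({u, v, w} : Finset V).erase p))
    have h3 := Finset.card_insert_le b (({u, v, w} : Finset V).erase p)
    have h5 : p ∈ ({u, v, w} : Finset V) := by simpa using huvw p h.pa.symm
    have h6 := Finset.card_erase_of_mem h5
    have h7 := Finset.card_le_three (a := u) (b := v) (c := w)
    omega
  have haS := h.not_a
  refine h4 (insert a (S.erase c)) {p, q, c} ?_ ((h.tc.erase_cn c).insert_adj hx hax.symm) ?_
    (TC.triangle h.pq h.qc h.pc)
  · rw [Finset.card_insert_of_notMem (fun h' => haS (Finset.mem_erase.1 h').2)]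
    omega
  · intro v
    have := h.mem v
    have := h.pa.ne
    have := h.aq
    have := h.ac
    have := (h.mem c).1 h.mem_c
    simp only [Finset.mem_insert, Finset.mem_singleton, Finset.mem_erase]
    grind

/-- The neighbours of `c` on the cycle cannot both be adjacent to `b`. -/
lemma exists_cycle_nbr (h : TriPath G p q c a b S) (ha : ¬ Deg3 G a) (hac : ¬ G.Adj a c)
    (hab : ¬ G.Adj a b) (hd : ∀ x ∈ S, D2 G S x) : ∃ x ∈ S, G.Adj c x ∧ ¬ G.Adj b x := by
  obtain ⟨x1, hx1, x2, hx2, h12, h1, h2⟩ := h.tc.two_nbrs h.mem_c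
  by_contra hcon
  push Not at hcon
  have hb1 := hcon x1 hx1 h1
  have hb2 := hcon x2 hx2 h2
  have two : ∀ w ∈ S, ∀ u ∈ S, ∀ v ∈ S, u ≠ v → G.Adj w u → G.Adj w v → ∀ y ∈ S, G.Adj w y →
      y = u ∨ y = v := by
    intro w hw u hu v hv huv hwu hwv y hy hwy
    rcases hd w hw u hu v hv y hy hwu hwv hwy with e | e | e
    · exact absurd e huv
    · exact Or.inl e.symm
    · exact Or.inr e.symm
  have nc := two c h.mem_c x1 hx1 x2 hx2 h12 h1 h2
  have nb := two b h.mem_b x1 hx1 x2 hx2 h12 hb1 hb2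
  have n1 := two x1 hx1 c h.mem_c b h.mem_b h.bc.symm h1.symm hb1.symm
  have n2 := two x2 hx2 c h.mem_c b h.mem_b h.bc.symm h2.symm hb2.symm
  have hSall := h.tc.cn.2 {c, b, x1, x2} (by
      intro y hy
      simp only [Finset.mem_insert, Finset.mem_singleton] at hy
      rcases hy with rfl | rfl | rfl | rfl
      exacts [h.mem_c, h.mem_b, hx1, hx2]) ⟨c, by simp⟩ (by
    intro j hj y hy hjy
    simp only [Finset.mem_insert, Finset.mem_singleton] at hj ⊢
    rcases hj with rfl | rfl | rfl | rfl
    · have := nc y hy hjy; tauto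
    · have := nb y hy hjy; tauto
    · have := n1 y hy hjy; tauto
    · have := n2 y hy hjy; tauto)
  refine ha ⟨p, x1, x2, fun y hy => ?_⟩
  by_cases hyS : y ∈ S
  · have := hSall y hyS
    simp only [Finset.mem_insert, Finset.mem_singleton] at this
    rcases this with rfl | rfl | e | e
    · exact absurd hy hac
    · exact absurd hy hab
    · exact Or.inr (Or.inl e)
    · exact Or.inr (Or.inr e)
  · left
    by_contra hyp
    refine hyS ((h.mem y).2 ⟨hyp, ?_, hy.ne.symm⟩)
    rintro rfl
    exact h.nadj_qa hy.symm

lemma not_cycle (h : TriPath G p q c a b S) (h4 : N4 G) (hS : 4 ≤ S.card)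
    (hcyc : ∀ x ∈ S, Att G {p, q, a} x ∧ D2 G S x) (ha : ¬ Deg3 G a) (hac : ¬ G.Adj a c) :
    False := by
  have hadj : ∀ x ∈ S, x ≠ c → x ≠ b → G.Adj a x := fun x hx hc hb =>
    ((h.att_cases hx (hcyc x hx).1).resolve_left hc).resolve_left hb
  have haS := h.not_a
  have hpS := h.not_p
  have hqS := h.not_q
  have hcS := h.mem_c
  have main : ∀ x ∈ S, G.Adj c x → Cn G {p, q, c, x} →
      (b ∈ S \ {c, x} → G.Adj a b ∨ ∃ y ∈ S \ {c, x}, ∃ z ∈ S \ {c, x}, y ≠ z ∧ G.Adj b y ∧ G.Adj b z) →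
      False := by
    intro x hx hcx hcn hb
    have hQ := cycle_sdiff_pair_cn h.tc (fun x hx => (hcyc x hx).2) hcS hx hcx
    have hcard : (S \ {c, x}).card = S.card - 2 := by
      rw [Finset.card_sdiff_of_subset, Finset.card_pair hcx.ne]
      intro y hy
      simp only [Finset.mem_insert, Finset.mem_singleton] at hy
      rcases hy with rfl | rfl <;> assumption
    have hT := TC.cone hQ (a := a) (b := b) (fun h' => haS (Finset.mem_sdiff.1 h').1) (by omega)
      (fun y hy hyb => by
        have hy' := Finset.mem_sdiff.1 hy
        simp only [Finset.mem_insert, Finset.mem_singleton, not_or] at hy'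
        exact hadj y hy'.1 hy'.2.1 hyb) hb
    have hxm := (h.mem x).1 hx
    have hcm := (h.mem c).1 hcS
    have hpq := h.pq.ne
    have hpa := h.pa.ne
    have haq := h.aq
    refine h4 {p, q, c, x} _ (card_four (by have := hcx.ne; simp; tauto)) hcn ?_ hT
    intro v
    have := h.mem v
    simp only [Finset.mem_insert, Finset.mem_singleton, Finset.mem_sdiff]
    clear * - this hxm hcm hpq hpa haq
    grind
  by_cases hbc : G.Adj c b
  · refine main b h.mem_b hbc ?_ fun h' => absurd h' (by simp)
    have : ({p, q, c, b} : Finset V) = {p, q, b, c} := by ext; simp; tauto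
    rw [this]
    have : ({p, q, b, c} : Finset V) = {c, p, q, b} := by ext; simp; tauto
    rw [this]
    exact Cn.path4 h.pc.symm h.pq h.qb
  · obtain ⟨x, hx, hcx, hxb⟩ : ∃ x ∈ S, G.Adj c x ∧ (G.Adj a b ∨ ¬ G.Adj b x) := by
      by_cases hab : G.Adj a b
      · obtain ⟨x, hx, -, -, -, hcx, -⟩ := h.tc.two_nbrs hcS
        exact ⟨x, hx, hcx, Or.inl hab⟩
      · obtain ⟨x, hx, hcx, hbx⟩ := h.exists_cycle_nbr ha hac hab fun x hx => (hcyc x hx).2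
        exact ⟨x, hx, hcx, Or.inr hbx⟩
    refine main x hx hcx ?_ fun _ => ?_
    · have : ({p, q, c, x} : Finset V) = {q, p, c, x} := by ext; simp; tauto
      rw [this]
      exact Cn.path4 h.pq.symm h.pc hcx
    · refine hxb.imp_right fun hbx => ?_
      obtain ⟨y, hy, z, hz, hyz, hby, hbz⟩ := h.tc.two_nbrs h.mem_b
      have key : ∀ y ∈ S, G.Adj b y → y ∈ S \ {c, x} := by
        intro y hy hby
        simp only [Finset.mem_sdiff, Finset.mem_insert, Finset.mem_singleton, not_or]
        refine ⟨hy, ?_, ?_⟩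
        · rintro rfl; exact hbc hby.symm
        · rintro rfl; exact hbx hby
      exact ⟨y, key y hy hby, z, key z hz hbz, hyz, hby, hbz⟩

lemma contradiction [Fintype V] (h : TriPath G p q c a b S) (hK : K3 G) (hm : EdgeMinimal G)
    (h4 : N4 G) (hV : 7 ≤ Fintype.card V) : False := by
  have hWS : ∀ v, v ∈ S ↔ v ∉ ({p, q, a} : Finset V) := by
    intro v
    rw [h.mem]
    simp
  have hS : 4 ≤ S.card := by
    have : S = Finset.univ \ {p, q, a} := by ext v; simp [h.mem]
    rw [this]
    exact card_sdiff_triple_ge (by simpa using hV) p q a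
  have hW3 : ({p, q, a} : Finset V).card = 3 := Finset.card_eq_three.2
    ⟨p, q, a, h.pq.ne, h.pa.ne, h.aq.symm, rfl⟩
  have hWc : Cn G {p, q, a} := by
    have : ({p, q, a} : Finset V) = {q, p, a} := by ext; simp; tauto
    rw [this]
    exact Cn.path3 h.pq.symm h.pa
  have hn := h4.nonext hWc hW3 hWS
  have hac : ¬ Deg3 G a → ¬ G.Adj a c := fun ha hac =>
    (deg3_of_triangle hK hm hac h.pa.symm h.pc.symm).elim ha h.nc
  rcases leaves_or_cycle hK ⟨p, by simp⟩ hWS h.tc hS hn with ⟨U1, U2, h1, h2, hd⟩ | hc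
  · obtain ⟨F1, F2, h1, h2, hd, hcF, hbF⟩ := h.exists_split_leaves h4 h1 h2 hd
    by_cases ha : Deg3 G a
    · exact h.not_leaves_deg3 hK h4 h1 h2 hd hcF hbF ha
    · exact h.not_leaves_split h4 h1 h2 hd hcF hbF (hac ha) ha
  · by_cases ha : Deg3 G a
    · exact h.not_all_att_deg3 h4 hS (fun x hx => (hc x hx).1) ha
    · exact h.not_cycle h4 hS hc ha (hac ha)

end TriPath

lemma Tri.contradiction [Fintype V] {p q c a b : V} (h : Tri G p q c a b) (hK : K3 G)
    (hm : EdgeMinimal G) (h4 : N4 G) (hV : 7 ≤ Fintype.card V) : False := by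
  set S : Finset V := Finset.univ \ {p, q} with hSdef
  have hS : ∀ v, v ∈ S ↔ v ≠ p ∧ v ≠ q := by intro v; simp [S]
  rcases h.tc_triple hK h4 hV hS with ht | ht
  · exact TriPath.contradiction (S := S.erase a) ⟨h, fun v => by
      rw [Finset.mem_erase, hS]; tauto, ht⟩ hK hm h4 hV
  · exact TriPath.contradiction (S := S.erase b) ⟨h.symm, fun v => by
      rw [Finset.mem_erase, hS]; tauto, ht⟩ hK hm h4 hV

lemma triangleFree_of_edgeMinimal [Fintype V] (hK : K3 G) (hm : EdgeMinimal G) (h4 : N4 G)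
    (hV : 7 ≤ Fintype.card V) : TF G := by
  intro u v w huv hvw huw
  have key : ∀ p q c, G.Adj p q → G.Adj p c → G.Adj q c → Deg3 G p → Deg3 G q → ¬ Deg3 G c →
      False := by
    intro p q c hpq hpc hqc hp hq hc
    obtain ⟨a, b, h⟩ := exists_tri hK hV hpq hpc hqc hp hq hc
    exact h.contradiction hK hm h4 hV
  have e1 := deg3_of_triangle hK hm huv huw hvw
  have e2 := deg3_of_triangle hK hm huw huv hvw.symm
  have e3 := deg3_of_triangle hK hm hvw huv.symm huw.symm
  by_cases hu : Deg3 G u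
  · by_cases hv : Deg3 G v
    · by_cases hw : Deg3 G w
      · exact no_cubic_triangle hK h4 hV huv hvw huw hu hv hw
      · exact key u v w huv huw hvw hu hv hw
    · exact key u w v huw huv hvw.symm hu (e3.resolve_left hv) hv
  · exact key v w u hvw huv.symm huw.symm (e1.resolve_left hu) (e2.resolve_left hu) hu

lemma connected_of_closed {α : Type*} [Nonempty α] {H : SimpleGraph α}
    (h : ∀ P : α → Prop, (∃ x, P x) → (∀ x y, P x → H.Adj x y → P y) → ∀ y, P y) :
    H.Connected := by
  have : H.Preconnected := fun x y =>
    h (fun z => H.Reachable x z) ⟨x, Reachable.refl _⟩ (fun a b ha hab => ha.trans hab.reachable) y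
  exact ⟨this⟩

lemma K3.of_nConnected [Fintype V] (hG : NConnected G 3) : K3 G := by
  intro J ⟨x, hx⟩ a b ⟨y, hyJ, hya, hyb⟩
  set S : Set V := ({a, b} : Set V) \ (J : Set V) with hS
  have hc : S.ncard < 3 := by
    have h1 : S.ncard ≤ ({a, b} : Set V).ncard := Set.ncard_le_ncard Set.sdiff_subset (Set.toFinite _)
    have h2 := Set.ncard_insert_le a ({b} : Set V)
    simp at h2
    omega
  have hcon := hG.2 S hc
  obtain ⟨p⟩ := hcon.preconnected ⟨x, by simp [S, hx]⟩ ⟨y, by simp [S, hya, hyb]⟩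
  obtain ⟨d, -, hd1, hd2⟩ := p.exists_boundary_dart {z | (z : V) ∈ J} (by simpa using hx)
    (by simpa using hyJ)
  have had := d.adj
  have h2 := d.snd.2
  simp only [Set.mem_ofPred_eq] at hd1 hd2
  simp only [S, Set.mem_compl_iff, Set.mem_sdiff, Set.mem_insert_iff, Set.mem_singleton_iff,
    Finset.mem_coe, not_and, not_not] at h2
  exact ⟨_, hd1, _, hd2, fun e => hd2 (h2 (Or.inl e)), fun e => hd2 (h2 (Or.inr e)), had⟩

lemma Cn.connected_induce {W : Finset V} (h : Cn G W) : (G.induce (W : Set V)).Connected := by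
  obtain ⟨w, hw⟩ := h.1
  have : Nonempty (W : Set V) := ⟨⟨w, hw⟩⟩
  refine connected_of_closed fun P ⟨x, hx⟩ hcl y => ?_
  have key := h.2 (W.filter fun v => ∃ hv : v ∈ (W : Set V), P ⟨v, hv⟩) (Finset.filter_subset _ _)
    ⟨x, by
      simp only [Finset.mem_filter]
      exact ⟨x.2, x.2, hx⟩⟩
    (fun a ha b hb hab => by
      simp only [Finset.mem_filter] at ha ⊢
      obtain ⟨_, ha', hP⟩ := ha
      exact ⟨hb, hb, hcl ⟨a, ha'⟩ ⟨b, hb⟩ hP hab⟩) y y.2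
  simp only [Finset.mem_filter] at key
  exact key.2.2

lemma TC.nConnected_induce {S : Finset V} (h : TC G S) : NConnected (G.induce (S : Set V)) 2 := by
  have hS3 := h.1
  refine ⟨by simp; omega, fun R hR => ?_⟩
  have : Finite (S : Set V) := Finset.finite_toSet S
  have : Nonempty (Rᶜ : Set (S : Set V)) := by
    by_contra hcon
    have hu : R = Set.univ := by
      ext v
      simp only [Set.mem_univ, iff_true]
      by_contra hv
      exact hcon ⟨⟨v, hv⟩⟩
    rw [hu, Set.ncard_univ] at hR
    simp at hR
    omega
  refine connected_of_closed fun P ⟨a, ha⟩ hcl y => ?_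
  obtain ⟨x, hx, hxa, hxy⟩ : ∃ x : V, (∀ v : (S : Set V), v ∈ R → (v : V) = x) ∧
      (a : (S : Set V)).1 ≠ x ∧ (y : (S : Set V)).1 ≠ x := by
    rcases R.eq_empty_or_nonempty with hR0 | ⟨r, hr⟩
    · have h2 : ({a.1.1, y.1.1} : Finset V).card < S.card :=
        lt_of_le_of_lt Finset.card_le_two (by omega)
      obtain ⟨s, _, hs⟩ := Finset.exists_mem_notMem_of_card_lt_card h2
      simp only [Finset.mem_insert, Finset.mem_singleton, not_or] at hs
      exact ⟨s, by simp [hR0], Ne.symm hs.1, Ne.symm hs.2⟩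
    · refine ⟨r, fun v hv => ?_, fun e => a.2 ?_, fun e => y.2 ?_⟩
      · rw [(Set.ncard_le_one_iff (Set.toFinite R)).1 (by omega) hv hr]
      · rw [Subtype.ext e]; exact hr
      · rw [Subtype.ext e]; exact hr
  have key := h.2 (S.filter fun v => v ≠ x ∧ ∃ (hv : v ∈ (S : Set V))
      (hv' : (⟨v, hv⟩ : (S : Set V)) ∈ Rᶜ), P ⟨⟨v, hv⟩, hv'⟩) (Finset.filter_subset _ _)
    ⟨a.1.1, by
      simp only [Finset.mem_filter]
      exact ⟨a.1.2, hxa, a.1.2, a.2, ha⟩⟩ x (by simp) (fun j hj z hz hjz => by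
        simp only [Finset.mem_filter] at hj ⊢
        obtain ⟨_, _, hj1, hj2, hP⟩ := hj
        by_cases hzx : z = x
        · exact Or.inr hzx
        · have hzR : (⟨z, hz⟩ : (S : Set V)) ∈ Rᶜ := fun hzR => hzx (hx _ hzR)
          exact Or.inl ⟨hz, hzx, hz, hzR, hcl ⟨⟨j, hj1⟩, hj2⟩ ⟨⟨z, hz⟩, hzR⟩ hP hjz⟩) y.1.1 y.1.2
  simp only [Finset.mem_filter] at key
  exact (key.resolve_right hxy).2.2.2.2

lemma N4.of_not_contractible [Fintype V]
    (h : ¬ ∃ W : Set V, W.ncard = 4 ∧ ContractibleSet G W) : N4 G := by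
  intro W S hW hcW hS hT
  refine h ⟨W, by simpa using hW, hcW.connected_induce, ?_⟩
  have : ((W : Set V)ᶜ) = (S : Set V) := by ext v; simp [hS]
  rw [this]
  exact hT.nConnected_induce

lemma Cn.mono {H : SimpleGraph V} (hle : H ≤ G) {S : Finset V} (h : Cn H S) : Cn G S :=
  ⟨h.1, fun J hJ hn hcl => h.2 J hJ hn fun x hx y hy hxy => hcl x hx y hy (hle hxy)⟩

lemma TC.mono {H : SimpleGraph V} (hle : H ≤ G) {S : Finset V} (h : TC H S) : TC G S :=
  ⟨h.1, fun J hJ hn x hx hcl => h.2 J hJ hn x hx fun j hj y hy hxy => hcl j hj y hy (hle hxy)⟩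

lemma N4.anti {H : SimpleGraph V} (hle : H ≤ G) (h : N4 G) : N4 H :=
  fun W S hW hc hS hT => h W S hW (hc.mono hle) hS (hT.mono hle)

lemma exists_edgeMinimal_le [Fintype V] (hK : K3 G) :
    ∃ H ≤ G, K3 H ∧ EdgeMinimal H := by
  obtain ⟨H, hle, hH⟩ := exists_minimal_le_of_wellFoundedLT (fun H : SimpleGraph V => K3 H) G hK
  refine ⟨H, hle, hH.prop, fun u v huv hK' => ?_⟩
  have := hH.le_of_le hK' (H.deleteEdges_le _)
  have h2 := this huv
  simp at h2

lemma K3.three_le_degree [Fintype V] (hK : K3 G) (hV : 4 ≤ Fintype.card V) (v : V) :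
    3 ≤ G.degree v := by
  obtain ⟨x, -, -, hx⟩ := hK.exists_nbr hV v v v
  obtain ⟨y, hyx, -, hy⟩ := hK.exists_nbr hV v x x
  obtain ⟨z, hzx, hzy, hz⟩ := hK.exists_nbr hV v x y
  rw [← card_neighborFinset_eq_degree]
  have : ({x, y, z} : Finset V).card = 3 := Finset.card_eq_three.2
    ⟨x, y, z, hyx.symm, hzx.symm, hzy.symm, rfl⟩
  rw [← this]
  apply Finset.card_le_card
  intro w hw
  simp only [Finset.mem_insert, Finset.mem_singleton] at hw
  rw [mem_neighborFinset]
  rcases hw with rfl | rfl | rfl <;> assumption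

/-- A triangle-free `3`-connected graph on seven vertices contains `K_{3,4}`. -/
lemma K3.exists_bipartition [Fintype V] (hK : K3 G) (hT : TF G) (hV : Fintype.card V = 7) :
    ∃ A : Finset V, A.card = 3 ∧ ∀ a ∈ A, ∀ b, b ∉ A → G.Adj a b := by
  have hd := hK.three_le_degree (by omega)
  obtain ⟨v, hv⟩ : ∃ v, 4 ≤ G.degree v := by
    by_contra! hcon
    have h3 : ∀ v ∈ Finset.univ, G.degree v = 3 := fun v _ => by
      have := hd v; have := hcon v; omega
    have := G.sum_degrees_eq_twice_card_edges
    rw [Finset.sum_congr rfl h3, Finset.sum_const, Finset.card_univ, hV, smul_eq_mul] at this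
    omega
  have hsub : ∀ x ∈ G.neighborFinset v, G.neighborFinset x ⊆ (G.neighborFinset v)ᶜ := by
    intro x hx y hy
    rw [mem_neighborFinset] at hx hy
    rw [Finset.mem_compl, mem_neighborFinset]
    exact hT v x y hx hy
  have hcard : (G.neighborFinset v)ᶜ.card = 7 - G.degree v := by
    rw [Finset.card_compl, hV, card_neighborFinset_eq_degree]
  have heq : ∀ x ∈ G.neighborFinset v, G.neighborFinset x = (G.neighborFinset v)ᶜ := by
    intro x hx
    refine Finset.eq_of_subset_of_card_le (hsub x hx) ?_
    have := hd x
    rw [hcard, card_neighborFinset_eq_degree]; omega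
  refine ⟨(G.neighborFinset v)ᶜ, ?_, fun a ha b hb => ?_⟩
  · obtain ⟨x, -, -, hx⟩ := hK.exists_nbr (by omega) v v v
    have h1 := heq x (by simpa using hx)
    rw [← h1, card_neighborFinset_eq_degree]
    have := hd x
    have h2 := hcard
    rw [← h1, card_neighborFinset_eq_degree] at h2
    omega
  · rw [Finset.mem_compl, not_not] at hb
    rw [← heq b hb, mem_neighborFinset] at ha
    exact ha.symm

lemma N4.false_of_bipartition [Fintype V] (h4 : N4 G) (hV : Fintype.card V = 7)
    (hK : IsEmpty (G ≃g completeBipartiteGraph (Fin 3) (Fin 4))) {A : Finset V}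
    (hA : A.card = 3) (h : ∀ a ∈ A, ∀ b, b ∉ A → G.Adj a b) : False := by
  have hB : Aᶜ.card = 4 := by rw [Finset.card_compl, hV, hA]
  have hAin : ∀ a ∈ A, ∀ b ∈ A, ¬ G.Adj a b := by
    intro a ha b hb hab
    obtain ⟨c, hc⟩ : ∃ c, c ∈ (A.erase a).erase b := by
      apply Finset.card_pos.1
      rw [Finset.card_erase_of_mem (by simp [hb, hab.ne']), Finset.card_erase_of_mem ha]; omega
    obtain ⟨w, x, y, z, hwx, hwy, hwz, hxy, hxz, hyz, hBe⟩ := Finset.card_eq_four.1 hB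
    simp only [Finset.mem_erase] at hc
    have hAe : A = {a, b, c} := by
      refine (Finset.eq_of_subset_of_card_le ?_ ?_).symm
      · intro t; simp only [Finset.mem_insert, Finset.mem_singleton]; rintro (rfl | rfl | rfl)
        exacts [ha, hb, hc.2.2]
      · rw [hA, Finset.card_eq_three.2 ⟨a, b, c, hab.ne, Ne.symm hc.2.1, Ne.symm hc.1, rfl⟩]
    have hmem : ∀ v, v ∉ A ↔ v = w ∨ v = x ∨ v = y ∨ v = z := by
      intro v; rw [← Finset.mem_compl, hBe]; simp
    have hw := (hmem w).2 (by simp)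
    have hx := (hmem x).2 (by simp)
    have hy := (hmem y).2 (by simp)
    have hz := (hmem z).2 (by simp)
    have hcA := hc.2.2
    refine h4 {z, y, x, c} {a, b, w} (card_four ?_) ?_ ?_
      (TC.triangle hab (h b hb w hw) (h a ha w hw))
    · simp only [List.nodup_cons, List.mem_cons, List.not_mem_nil, or_false, not_or,
        List.nodup_nil, and_true, not_false_eq_true]
      refine ⟨⟨hyz.symm, hxz.symm, ?_⟩, ⟨hxy.symm, ?_⟩, ?_⟩ <;> rintro rfl <;> contradiction
    · have h1 : Cn G {x, c} := (Cn.singleton c).insert_adj (by simp) (h c hcA x hx)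
      exact (h1.insert_adj (x := c) (by simp) (h c hcA y hy)).insert_adj (x := c) (by simp)
        (h c hcA z hz)
    · intro v
      have h1 := hmem v
      rw [hAe] at h1 hw hx hy hz
      simp only [Finset.mem_insert, Finset.mem_singleton, not_or] at *
      clear * - h1 hw hx hy hz hwx hwy hwz hxy hxz hyz hc
      grind
  have hBin : ∀ a, a ∉ A → ∀ b, b ∉ A → ¬ G.Adj a b := by
    intro a ha b hb hab
    have hcd : (((Aᶜ).erase a).erase b).card = 2 := by
      rw [Finset.card_erase_of_mem (by simp [hb, hab.ne']), Finset.card_erase_of_mem (by simpa)]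
      omega
    obtain ⟨c, d, hcd', he⟩ := Finset.card_eq_two.1 hcd
    obtain ⟨x, y, z, hxy, hxz, hyz, hAe⟩ := Finset.card_eq_three.1 hA
    have hmem : ∀ v, v ∉ A ↔ v = a ∨ v = b ∨ v = c ∨ v = d := by
      intro v
      have := Finset.ext_iff.1 he v
      simp only [Finset.mem_erase, Finset.mem_compl, Finset.mem_insert, Finset.mem_singleton]
        at this
      by_cases h1 : v = a
      · simp [h1, ha]
      · by_cases h2 : v = b
        · simp [h2, hb]
        · simp only [h1, h2, false_or, ne_eq, not_false_eq_true, true_and] at this ⊢; exact this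
    have hcA := (hmem c).2 (by simp)
    have hdA := (hmem d).2 (by simp)
    have hce : c ∈ ((Aᶜ).erase a).erase b := by simp [he]
    have hde : d ∈ ((Aᶜ).erase a).erase b := by simp [he]
    simp only [Finset.mem_erase] at hce hde
    have hxA : x ∈ A := by simp [hAe]
    have hyA : y ∈ A := by simp [hAe]
    have hzA : z ∈ A := by simp [hAe]
    refine h4 {z, d, y, c} {x, a, b} (card_four ?_) ?_ ?_
      (TC.triangle (h x hxA a ha) hab (h x hxA b hb))
    · simp only [List.nodup_cons, List.mem_cons, List.not_mem_nil, or_false, not_or,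
        List.nodup_nil, and_true, not_false_eq_true]
      refine ⟨⟨?_, hyz.symm, ?_⟩, ⟨?_, hcd'.symm⟩, ?_⟩ <;> rintro rfl <;> contradiction
    · have h1 : Cn G {y, c} := (Cn.singleton c).insert_adj (by simp) (h y hyA c hcA).symm
      exact (h1.insert_adj (x := y) (by simp) (h y hyA d hdA)).insert_adj (x := d) (by simp)
        (h z hzA d hdA).symm
    · intro v
      have h1 := hmem v
      rw [hAe] at h1 ha hb hcA hdA
      simp only [Finset.mem_insert, Finset.mem_singleton, not_or] at *
      clear * - h1 ha hb hcA hdA hxy hxz hyz hcd' hce hde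
      grind
  have eA : {v // v ∈ A} ≃ Fin 3 := Fintype.equivFinOfCardEq (by simpa using hA)
  have eB : {v // v ∉ A} ≃ Fin 4 := Fintype.equivFinOfCardEq (by
    rw [Fintype.card_subtype_compl, hV, Fintype.card_coe, hA])
  refine hK.false ⟨(Equiv.sumCompl (· ∈ A)).symm.trans (Equiv.sumCongr eA eB), ?_⟩
  intro u v
  by_cases hu : u ∈ A <;> by_cases hv : v ∈ A
  · simp [Equiv.sumCompl_symm_apply_of_pos, hu, hv, hAin u hu v hv]
  · simp [Equiv.sumCompl_symm_apply_of_pos, Equiv.sumCompl_symm_apply_of_neg, hu, hv, h u hu v hv]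
  · simp [Equiv.sumCompl_symm_apply_of_pos, Equiv.sumCompl_symm_apply_of_neg, hu, hv,
      (h v hv u hu).symm]
  · simp [Equiv.sumCompl_symm_apply_of_neg, hu, hv, hBin u hu v hv]

lemma N4.false [Fintype V] (h4 : N4 G) (hK : K3 G) (hV : 7 ≤ Fintype.card V)
    (hiso : IsEmpty (G ≃g completeBipartiteGraph (Fin 3) (Fin 4))) : False := by
  obtain ⟨H, hle, hK', hm⟩ := exists_edgeMinimal_le hK
  have h4' := h4.anti hle
  have hT := triangleFree_of_edgeMinimal hK' hm h4' hV
  rcases hV.eq_or_lt with h7 | h8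
  · obtain ⟨A, hA, h⟩ := hK'.exists_bipartition hT h7.symm
    exact h4.false_of_bipartition h7.symm hiso hA fun a ha b hb => hle (h a ha b hb)
  · exact not_triangleFree hK' hT h4' h8

end FourContractible

/-- Kriesell's theorem: every `3`-connected graph on at least `7` vertices that is not
isomorphic to `K_{3,4}` has a `4`-contractible set. -/
theorem stmt_7 {V : Type*} [Fintype V] (G : SimpleGraph V)
    (hG : NConnected G 3) (hv : 7 ≤ Fintype.card V)
    (hK : IsEmpty (G ≃g completeBipartiteGraph (Fin 3) (Fin 4))) :
    ∃ W : Set V, W.ncard = 4 ∧ ContractibleSet G W := by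
  by_contra hcon
  exact (FourContractible.N4.of_not_contractible hcon).false
    (FourContractible.K3.of_nConnected hG) hv hK
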